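/- arXiv:1503.08790 — 2 statements merged into one kernel-verified Lean document; each statement's English description precedes it below -/
import Mathlib

section
/- Let H̃_n be the height of a random admissible walk of length n on ℤ. For every fixed integer r ≥ 1, the r-th moment satisfies E H̃_n^r ∼ (r/√π) Γ((r+1)/2) (2^{r+1} − 1) 2^{−r/2} ζ(r+1) n^{r/2} as n → ∞, i.e. the ratio of the two sides tends to 1, where E H̃_n^r = (Σ_{h≥0} h^r W(n,h))/(Σ_{h≥0} W(n,h)), Γ is the Gamma function and ζ(r+1) = Σ_{k≥1} k^{−(r+1)}. -/
open Real Filter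

/-- Partial sum `S_k` of the `±1`-walk encoded by `ε : Fin n → Bool`
(`true` = step `+1`, `false` = step `-1`). -/
def walkSum (n : ℕ) (ε : Fin n → Bool) (k : ℕ) : ℤ :=
  ∑ i : Fin n, if (i : ℕ) < k then (if ε i then 1 else -1) else 0

/-- `W n h`: number of `±1`-paths of length `n` with `0 ≤ S_k ≤ h` for all `k` and `S_n = h`. -/
noncomputable def W (n h : ℕ) : ℕ :=
  Nat.card {ε : Fin n → Bool //
    (∀ k ≤ n, 0 ≤ walkSum n ε k ∧ walkSum n ε k ≤ (h : ℤ)) ∧ walkSum n ε n = (h : ℤ)}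

/-- The `r`-th moment `E H̃_n^r = (Σ_h h^r·W(n,h))/(Σ_h W(n,h))` of the height of a random
admissible walk on `ℤ`. -/
noncomputable def heightMomentZ (n r : ℕ) : ℝ :=
  (∑' h : ℕ, (h : ℝ) ^ r * (W n h : ℝ)) / (∑' h : ℕ, (W n h : ℝ))


/-! ### Combinatorics -/

/-- Transfer operator on the strip `[0,h]`. -/
def stripT (h : ℕ) (f : ℤ → ℝ) : ℤ → ℝ :=
  fun j => if 0 ≤ j ∧ j ≤ (h : ℤ) then f (j - 1) + f (j + 1) else 0

/-- Dirac mass at `c`. -/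
def dirac0 (c : ℤ) : ℤ → ℝ := fun j => if j = c then 1 else 0

/-- Number of free walks of length `n` from `0` to `y`. -/
def freeB : ℕ → ℤ → ℝ
  | 0, y => if y = 0 then 1 else 0
  | n + 1, y => freeB n (y - 1) + freeB n (y + 1)

lemma walkSum_snoc_le (n : ℕ) (ε : Fin n → Bool) (b : Bool) (k : ℕ) (hk : k ≤ n) :
    walkSum (n + 1) (Fin.snoc (α := fun _ => Bool) ε b) k = walkSum n ε k := by
  unfold walkSum
  rw [Fin.sum_univ_castSucc]
  have : ¬ (n < k) := by omega
  simp [this]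

lemma walkSum_snoc_last (n : ℕ) (ε : Fin n → Bool) (b : Bool) :
    walkSum (n + 1) (Fin.snoc (α := fun _ => Bool) ε b) (n + 1)
      = walkSum n ε n + (if b then 1 else -1) := by
  unfold walkSum
  rw [Fin.sum_univ_castSucc]
  have h : ∀ i : Fin n, (i : ℕ) < n + 1 := fun i => by omega
  simp [h]

open Classical in
lemma walk_count (h : ℕ) (n : ℕ) : ∀ j : ℤ,
    (∑ ε : Fin n → Bool, if (∀ k ≤ n, 0 ≤ walkSum n ε k ∧ walkSum n ε k ≤ (h : ℤ)) ∧
      walkSum n ε n = j then (1 : ℝ) else 0) = (stripT h)^[n] (dirac0 0) j := by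
  induction n with
  | zero =>
    intro j
    have h0 : ∀ ε : Fin 0 → Bool, ∀ k, walkSum 0 ε k = 0 := by intro ε k; simp [walkSum]
    simp [h0, dirac0, eq_comm]
  | succ n ih =>
    intro j
    rw [Function.iterate_succ_apply', stripT, ← ih, ← ih]
    rw [← (Fin.snocEquiv (fun _ => Bool)).sum_comp, Fintype.sum_prod_type, Fintype.sum_bool]
    have hcond : ∀ (ε : Fin n → Bool) (b : Bool),
        ((∀ k ≤ n + 1, 0 ≤ walkSum (n + 1) (Fin.snoc (α := fun _ => Bool) ε b) k ∧
          walkSum (n + 1) (Fin.snoc (α := fun _ => Bool) ε b) k ≤ (h : ℤ)) ∧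
          walkSum (n + 1) (Fin.snoc (α := fun _ => Bool) ε b) (n + 1) = j) ↔
        ((0 ≤ j ∧ j ≤ h) ∧ (∀ k ≤ n, 0 ≤ walkSum n ε k ∧ walkSum n ε k ≤ (h : ℤ)) ∧
          walkSum n ε n = j - (if b then 1 else -1)) := by
      intro ε b
      constructor
      · rintro ⟨h1, h2⟩
        refine ⟨?_, ?_, ?_⟩
        · have := h1 (n + 1) le_rfl
          rwa [h2] at this
        · intro k hk
          have := h1 k (by omega)
          rwa [walkSum_snoc_le n ε b k hk] at this
        · rw [walkSum_snoc_last] at h2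
          omega
      · rintro ⟨h1, h2, h3⟩
        have h4 : walkSum (n + 1) (Fin.snoc (α := fun _ => Bool) ε b) (n + 1) = j := by
          rw [walkSum_snoc_last]; omega
        refine ⟨?_, h4⟩
        intro k hk
        rcases Nat.lt_or_ge n k with hk' | hk'
        · have : k = n + 1 := by omega
          subst this
          rw [h4]; exact h1
        · rw [walkSum_snoc_le n ε b k hk']; exact h2 k hk'
    simp only [Fin.snocEquiv, Equiv.coe_fn_mk, hcond]
    by_cases hj : 0 ≤ j ∧ j ≤ (h : ℤ)
    · simp [hj]
    · simp [hj]

lemma W_eq_iter (n h : ℕ) : (W n h : ℝ) = (stripT h)^[n] (dirac0 0) h := by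
  classical
  rw [← walk_count]
  unfold W
  rw [Nat.card_eq_fintype_card, Fintype.card_subtype, Finset.sum_boole]

/-! ### Free walks -/

lemma freeB_nonneg (n : ℕ) : ∀ y, 0 ≤ freeB n y := by
  induction n with
  | zero => intro y; simp only [freeB]; split_ifs <;> norm_num
  | succ n ih => intro y; simp only [freeB]; exact add_nonneg (ih _) (ih _)

lemma freeB_neg (n : ℕ) : ∀ y, freeB n (-y) = freeB n y := by
  induction n with
  | zero => intro y; simp [freeB]
  | succ n ih =>
    intro y; simp only [freeB]
    rw [← ih (y - 1), ← ih (y + 1), add_comm]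
    congr 2 <;> ring

lemma freeB_zero_of_gt (n : ℕ) : ∀ y : ℤ, (n : ℤ) < y → freeB n y = 0 := by
  induction n with
  | zero => intro y hy; simp only [freeB]; rw [if_neg]; simp at hy; omega
  | succ n ih =>
    intro y hy; simp only [freeB]; push_cast at hy
    rw [ih _ (by omega), ih _ (by omega), add_zero]

lemma freeB_zero_of_abs (n : ℕ) (y : ℤ) (hy : (n : ℤ) < |y|) : freeB n y = 0 := by
  rcases abs_cases y with ⟨h, _⟩ | ⟨h, _⟩
  · exact freeB_zero_of_gt n y (by omega)
  · rw [← freeB_neg]; exact freeB_zero_of_gt n _ (by omega)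

lemma freeB_parity (n : ℕ) : ∀ y : ℤ, (y - n) % 2 ≠ 0 → freeB n y = 0 := by
  induction n with
  | zero => intro y hy; simp only [freeB]; rw [if_neg]; simp at hy; omega
  | succ n ih =>
    intro y hy; simp only [freeB]; push_cast at hy
    rw [ih _ (by omega), ih _ (by omega), add_zero]

lemma freeB_diff (n : ℕ) : ∀ y : ℤ,
    ((n : ℝ) + 1) * (freeB n (y - 1) - freeB n (y + 1)) = y * freeB (n + 1) y := by
  induction n with
  | zero =>
    intro y
    simp only [freeB]
    by_cases h1 : y = 1
    · subst h1; norm_num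
    · by_cases h2 : y = -1
      · subst h2; norm_num
      · have e1 : ¬ (y - 1 = 0) := by omega
        have e2 : ¬ (y + 1 = 0) := by omega
        simp [e1, e2]
  | succ n ih =>
    intro y
    have e1 := ih (y - 1)
    have e2 := ih (y + 1)
    have a1 : y - 1 - 1 = y - 2 := by ring
    have a2 : y - 1 + 1 = y := by ring
    have a3 : y + 1 - 1 = y := by ring
    have a4 : y + 1 + 1 = y + 2 := by ring
    rw [a1, a2] at e1
    rw [a3, a4] at e2
    have f1 : freeB (n + 1) (y - 1) = freeB n (y - 2) + freeB n y := by
      simp only [freeB, a1, a2]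
    have f2 : freeB (n + 1) (y + 1) = freeB n y + freeB n (y + 2) := by
      simp only [freeB, a3, a4]
    have f3 : freeB (n + 1 + 1) y = freeB (n + 1) (y - 1) + freeB (n + 1) (y + 1) := rfl
    rw [f3]
    push_cast at e1 e2 ⊢
    have : ((n : ℝ) + 1) * (freeB (n + 1) (y - 1) - freeB (n + 1) (y + 1)) =
        (y - 1) * freeB (n + 1) (y - 1) + (y + 1) * freeB (n + 1) (y + 1) := by
      rw [← e1, ← e2, f1, f2]; ring
    linarith

lemma freeB_second_diff (n : ℕ) (y : ℤ) :
    ((n : ℝ) + 2) * (n + 1) * (freeB n (y - 2) - 2 * freeB n y + freeB n (y + 2))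
      = freeB (n + 2) y * ((y : ℝ) ^ 2 - (n + 2)) := by
  have e1 := freeB_diff n (y - 1)
  have e2 := freeB_diff n (y + 1)
  have e3 := freeB_diff (n + 1) y
  have a1 : y - 1 - 1 = y - 2 := by ring
  have a2 : y - 1 + 1 = y := by ring
  have a3 : y + 1 - 1 = y := by ring
  have a4 : y + 1 + 1 = y + 2 := by ring
  rw [a1, a2] at e1
  rw [a3, a4] at e2
  have f3 : freeB (n + 2) y = freeB (n + 1) (y - 1) + freeB (n + 1) (y + 1) := rfl
  rw [show n + 1 + 1 = n + 2 from rfl] at e3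
  push_cast at e1 e2 e3
  have : ((n : ℝ) + 2) * (n + 1) * (freeB n (y - 2) - 2 * freeB n y + freeB n (y + 2)) =
     (n + 2) * ((y - 1) * freeB (n + 1) (y - 1) - (y + 1) * freeB (n + 1) (y + 1)) := by
    rw [← e1, ← e2]; ring
  rw [this]
  have : (y : ℝ) * (((n : ℝ) + 1 + 1) * (freeB (n + 1) (y - 1) - freeB (n + 1) (y + 1)))
     = y * (y * freeB (n + 2) y) := by rw [e3]
  rw [f3] at this ⊢
  linarith

lemma freeB_ratio (n : ℕ) (y : ℤ) :
    ((n : ℝ) - y) * freeB n y = (n + y + 2) * freeB n (y + 2) := by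
  have e := freeB_diff n (y + 1)
  have a3 : y + 1 - 1 = y := by ring
  have a4 : y + 1 + 1 = y + 2 := by ring
  have f : freeB (n + 1) (y + 1) = freeB n y + freeB n (y + 2) := by
      simp only [freeB, a3, a4]
  rw [f, a3, a4] at e
  push_cast at e
  linarith

lemma freeB_choose (n : ℕ) : ∀ a : ℕ, freeB n (2 * a - n) = (n.choose a : ℝ) := by
  induction n with
  | zero =>
    intro a
    rcases a with _ | a
    · simp [freeB]
    · simp only [freeB, Nat.choose_zero_succ]; rw [if_neg]; · simp
      push_cast; omega
  | succ n ih =>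
    intro a
    rcases a with _ | a
    · simp only [freeB]
      have := ih 0
      simp only [Nat.choose_zero_right] at this ⊢
      rw [← this, freeB_zero_of_abs n _ (by rw [abs_of_neg] <;> push_cast <;> omega), zero_add]
      congr 1; push_cast; ring
    · simp only [freeB]
      have e : (((n + 1).choose (a + 1) : ℕ) : ℝ) = n.choose a + n.choose (a + 1) := by
        rw [Nat.choose_succ_succ]; push_cast; rfl
      rw [e, ← ih a, ← ih (a + 1)]
      congr 2 <;> (push_cast; ring)

/-! ### Reflection -/

lemma freeB_summable (n : ℕ) (c d : ℤ) (hd : 0 < d) :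
    Summable (fun k : ℤ => freeB n (c + k * d)) := by
  apply summable_of_hasFiniteSupport
  apply (Set.finite_Icc (-(n + |c|) : ℤ) (n + |c|)).subset
  intro k hk
  rw [Function.mem_support] at hk
  have h1 : ¬ ((n : ℤ) < |c + k * d|) := fun h => hk (freeB_zero_of_abs _ _ h)
  push Not at h1
  have h2 : |k| ≤ |k * d| := by
    rw [abs_mul, abs_of_pos hd]; nlinarith [abs_nonneg k]
  have h3 : |k * d| ≤ |c + k * d| + |c| := by
    have := abs_sub_abs_le_abs_sub (k * d) (-c)
    rw [abs_neg, sub_neg_eq_add, add_comm (k * d) c] at this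
    linarith
  have := abs_le.1 (show |k| ≤ n + |c| by linarith)
  exact ⟨by linarith [this.1], this.2⟩

/-- periodised free walk counts -/
noncomputable def perB (n : ℕ) (d c : ℤ) : ℝ := ∑' k : ℤ, freeB n (c + k * d)

lemma perB_succ (n : ℕ) (d c : ℤ) (hd : 0 < d) :
    perB (n + 1) d c = perB n d (c - 1) + perB n d (c + 1) := by
  unfold perB
  rw [← (freeB_summable n _ d hd).tsum_add (freeB_summable n _ d hd)]
  congr 1; ext k
  simp only [freeB]
  congr 2 <;> ring

lemma perB_shift (n : ℕ) (d c : ℤ) : perB n d (c + d) = perB n d c := by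
  unfold perB
  rw [← (Equiv.addRight (1 : ℤ)).tsum_eq (fun k : ℤ => freeB n (c + k * d))]
  congr 1; ext k
  simp only [Equiv.coe_addRight]
  congr 1; ring

lemma perB_zero_self (d : ℤ) (hd : 0 < d) : perB 0 d 0 = 1 := by
  unfold perB
  rw [tsum_eq_single 0]
  · simp [freeB]
  · intro k hk
    have : k * d ≠ 0 := mul_ne_zero hk hd.ne'
    simp only [freeB, zero_add, if_neg this]

lemma perB_zero_of (d c : ℤ) (h0 : 0 < c) (h1 : c < d) : perB 0 d c = 0 := by
  unfold perB
  convert tsum_zero with k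
  simp only [freeB]
  rw [if_neg]
  intro h
  have h2 : c = (-k) * d := by linarith
  have : 0 < -k := by
    by_contra h3; push Not at h3; nlinarith
  nlinarith

lemma iter_eq_per (h : ℕ) (n : ℕ) : ∀ j : ℤ, -1 ≤ j → j ≤ h + 1 →
    (stripT h)^[n] (dirac0 0) j = perB n (2 * (h + 2)) j - perB n (2 * (h + 2)) (-2 - j) := by
  have hd : (0 : ℤ) < 2 * (h + 2) := by positivity
  induction n with
  | zero =>
    intro j h1 h2
    rw [Function.iterate_zero, id_eq, dirac0]
    rcases eq_or_lt_of_le h1 with h3 | h3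
    · subst h3; norm_num
    · rw [← perB_shift 0 _ (-2 - j), perB_zero_of _ (-2 - j + _) (by omega) (by omega)]
      split_ifs with h4
      · subst h4; rw [perB_zero_self _ hd]; ring
      · rw [perB_zero_of _ _ (by omega) (by omega)]; ring
  | succ n ih =>
    intro j h1 h2
    rw [Function.iterate_succ_apply', stripT]
    split_ifs with h4
    · rw [ih _ (by omega) (by omega), ih _ (by omega) (by omega), perB_succ _ _ _ hd,
        perB_succ _ _ _ hd, show -2 - (j - 1) = -2 - j + 1 by ring,
        show -2 - (j + 1) = -2 - j - 1 by ring]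
      ring
    · rcases (show j = -1 ∨ j = h + 1 by omega) with h5 | h5
      · subst h5; norm_num
      · rw [← perB_shift (n + 1) _ (-2 - j), h5]
        rw [show (-2 - ((h : ℤ) + 1) + 2 * (h + 2)) = h + 1 by ring]; ring

lemma W_formula (n h : ℕ) :
    Summable (fun k : ℕ => freeB n ((2 * k + 1) * (h + 2) - 2) - 2 * freeB n ((2 * k + 1) * (h + 2))
      + freeB n ((2 * k + 1) * (h + 2) + 2)) ∧
    (W n h : ℝ) = ∑' k : ℕ, (freeB n ((2 * k + 1) * (h + 2) - 2)
      - 2 * freeB n ((2 * k + 1) * (h + 2)) + freeB n ((2 * k + 1) * (h + 2) + 2)) := by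
  have hd : (0 : ℤ) < 2 * (h + 2) := by positivity
  have key : ∀ c : ℤ, Summable (fun k : ℕ => freeB n (c + k * (2 * (h + 2)))) ∧
      Summable (fun k : ℕ => freeB n (c + (-(k + 1)) * (2 * (h + 2)))) ∧
      perB n (2 * (h + 2)) c = (∑' k : ℕ, freeB n (c + k * (2 * (h + 2)))) +
        ∑' k : ℕ, freeB n (c + (-(k + 1)) * (2 * (h + 2))) := by
    intro c
    have s := freeB_summable n c _ hd
    have s1 : Summable (fun k : ℕ => freeB n (c + (k : ℤ) * (2 * (h + 2)))) :=
      s.comp_injective (i := fun k : ℕ => (k : ℤ)) Nat.cast_injective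
    have s2 : Summable (fun k : ℕ => freeB n (c + (-((k : ℤ) + 1)) * (2 * (h + 2)))) :=
      s.comp_injective (i := fun k : ℕ => (-((k : ℤ) + 1))) (fun a b hab => by
        simp at hab; exact hab)
    exact ⟨s1, s2, tsum_of_nat_of_neg_add_one s1 s2⟩
  obtain ⟨a1, a2, a3⟩ := key h
  obtain ⟨b1, b2, b3⟩ := key (h + 2)
  have c1 : ∀ k : ℕ, freeB n ((2 * k + 1) * (h + 2) - 2) - 2 * freeB n ((2 * k + 1) * (h + 2))
      + freeB n ((2 * k + 1) * (h + 2) + 2) =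
      freeB n (h + k * (2 * (h + 2))) + freeB n (h + (-(k + 1)) * (2 * (h + 2)))
      - (freeB n ((h + 2) + k * (2 * (h + 2))) + freeB n ((h + 2) + (-(k + 1)) * (2 * (h + 2)))) := by
    intro k
    rw [← freeB_neg n (h + (-(k + 1)) * (2 * (h + 2))),
      ← freeB_neg n ((h + 2) + (-(k + 1)) * (2 * (h + 2)))]
    rw [show ((h : ℤ) + k * (2 * (h + 2))) = (2 * k + 1) * (h + 2) - 2 by ring,
      show (-((h : ℤ) + (-(k + 1)) * (2 * (h + 2)))) = (2 * k + 1) * (h + 2) + 2 by ring,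
      show (((h : ℤ) + 2) + k * (2 * (h + 2))) = (2 * k + 1) * (h + 2) by ring,
      show (-(((h : ℤ) + 2) + (-(k + 1)) * (2 * (h + 2)))) = (2 * k + 1) * (h + 2) by ring]
    ring
  simp only [c1]
  refine ⟨(a1.add a2).sub (b1.add b2), ?_⟩
  rw [(a1.add a2).tsum_sub (b1.add b2), a1.tsum_add a2, b1.tsum_add b2, ← a3, ← b3,
    W_eq_iter, iter_eq_per h n h (by omega) (by omega), ← perB_shift n _ (-2 - h)]
  congr 2; ring

/-! ### Local limit theorem -/

lemma entropy_bound (u : ℝ) (hu : |u| ≤ 1 / 2) :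
    |((1 + u) * Real.log (1 + u) + (1 - u) * Real.log (1 - u)) - u ^ 2| ≤ 6 * |u| ^ 3 := by
  have h1 : |u| < 1 := by linarith
  have h2 : |-u| < 1 := by rwa [abs_neg]
  have e1 := Real.abs_log_sub_add_sum_range_le h1 2
  have e2 := Real.abs_log_sub_add_sum_range_le h2 2
  simp only [Finset.sum_range_succ, Finset.sum_range_zero, abs_neg, sub_neg_eq_add] at e1 e2
  norm_num at e1 e2
  have hb : |u| ^ 3 / (1 - |u|) ≤ 2 * |u| ^ 3 := by
    rw [div_le_iff₀ (by linarith)]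
    have : 0 ≤ |u| ^ 3 := by positivity
    nlinarith
  obtain ⟨a1, a2⟩ := abs_le.1 (e1.trans hb)
  obtain ⟨b1, b2⟩ := abs_le.1 (e2.trans hb)
  obtain ⟨c1, c2⟩ := abs_le.1 hu
  set R1 := u + u ^ 2 / 2 + Real.log (1 - u) with hR1
  set R2 := -u + u ^ 2 / 2 + Real.log (1 + u) with hR2
  have e : ((1 + u) * Real.log (1 + u) + (1 - u) * Real.log (1 - u)) - u ^ 2 =
      (1 + u) * R2 + (1 - u) * R1 := by rw [hR1, hR2]; ring
  rw [e, abs_le]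
  have : 0 ≤ |u| ^ 3 := by positivity
  constructor <;> nlinarith

lemma factorial_stirling (k : ℕ) (hk : k ≠ 0) :
    (k.factorial : ℝ) = Stirling.stirlingSeq k * (√(2 * k) * ((k : ℝ) / Real.exp 1) ^ k) := by
  unfold Stirling.stirlingSeq
  have : (0 : ℝ) < k := by positivity
  field_simp

lemma choose_exact (a b : ℕ) (ha : a ≠ 0) (hb : b ≠ 0) (M u : ℝ) (hM : (a : ℝ) + b = M)
    (hau : (a : ℝ) = M * (1 + u) / 2) (hbu : (b : ℝ) = M * (1 - u) / 2) :
    √M * ((a + b).choose a : ℝ) / 2 ^ (a + b) =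
      Stirling.stirlingSeq (a + b) / (Stirling.stirlingSeq a * Stirling.stirlingSeq b) *
      √(2 / ((1 + u) * (1 - u))) *
      Real.exp (-(M / 2 * ((1 + u) * Real.log (1 + u) + (1 - u) * Real.log (1 - u)))) := by
  have ha0 : (0 : ℝ) < a := by positivity
  have hb0 : (0 : ℝ) < b := by positivity
  have hM0 : 0 < M := by linarith
  have hu1 : 0 < 1 + u := by
    have : 0 < M * (1 + u) := by linarith
    exact pos_of_mul_pos_right this hM0.le
  have hu2 : 0 < 1 - u := by
    have : 0 < M * (1 - u) := by linarith
    exact pos_of_mul_pos_right this hM0.le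
  rw [Nat.cast_add_choose, factorial_stirling (a + b) (by omega), factorial_stirling a ha,
    factorial_stirling b hb]
  have sa : Stirling.stirlingSeq a ≠ 0 := by
    obtain ⟨c, rfl⟩ := Nat.exists_eq_succ_of_ne_zero ha
    exact (Stirling.stirlingSeq'_pos c).ne'
  have sb : Stirling.stirlingSeq b ≠ 0 := by
    obtain ⟨c, rfl⟩ := Nat.exists_eq_succ_of_ne_zero hb
    exact (Stirling.stirlingSeq'_pos c).ne'
  have e1 : √(2 / ((1 + u) * (1 - u))) = √M * √(2 * M) / (√(2 * a) * √(2 * b)) := by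
    rw [← Real.sqrt_mul hM0.le, ← Real.sqrt_mul (by positivity), ← Real.sqrt_div (by positivity),
      hau, hbu]
    congr 1
    field_simp
  have pw : ∀ k : ℕ, 0 < (k : ℝ) → ((k : ℝ) / Real.exp 1) ^ k =
      Real.exp (k * Real.log k - k) := by
    intro k hk
    rw [← Real.exp_log (show 0 < (k : ℝ) / Real.exp 1 by positivity), ← Real.exp_nat_mul,
      Real.log_div hk.ne' (Real.exp_pos 1).ne', Real.log_exp]
    congr 1; ring
  have e2 : Real.exp (-(M / 2 * ((1 + u) * Real.log (1 + u) + (1 - u) * Real.log (1 - u)))) =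
      (((a + b : ℕ) : ℝ) / Real.exp 1) ^ (a + b) /
      (((a : ℝ) / Real.exp 1) ^ a * ((b : ℝ) / Real.exp 1) ^ b) / 2 ^ (a + b) := by
    have two : (2 : ℝ) ^ (a + b) = Real.exp (M * Real.log 2) := by
      rw [← hM, ← Nat.cast_add, Real.exp_nat_mul, Real.exp_log (by norm_num)]
    rw [pw (a + b) (by push_cast; linarith), pw a ha0, pw b hb0, two, ← Real.exp_add, ← Real.exp_sub,
      ← Real.exp_sub]
    congr 1
    push_cast
    rw [hM]
    have la : Real.log a = Real.log M + Real.log (1 + u) - Real.log 2 := by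
      rw [hau, Real.log_div (by positivity) (by norm_num), Real.log_mul hM0.ne' hu1.ne']
    have lb : Real.log b = Real.log M + Real.log (1 - u) - Real.log 2 := by
      rw [hbu, Real.log_div (by positivity) (by norm_num), Real.log_mul hM0.ne' hu2.ne']
    rw [la, lb, hau, hbu]; ring
  rw [e1, e2]
  push_cast
  rw [hM]
  have : 0 < √(2 * (a : ℝ)) := by positivity
  have : 0 < √(2 * (b : ℝ)) := by positivity
  field_simp

lemma local_limit (M : ℕ → ℕ) (hM : Tendsto M atTop atTop) (y : ℕ → ℤ) (x : ℝ)
    (hpar : ∀ n, (y n - M n) % 2 = 0)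
    (hy : Tendsto (fun n => (y n : ℝ) / √(M n)) atTop (nhds x)) :
    Tendsto (fun n => √(M n) * freeB (M n) (y n) / 2 ^ (M n)) atTop
      (nhds (√(2 / π) * Real.exp (-x ^ 2 / 2))) := by
  have hMr : Tendsto (fun n => (M n : ℝ)) atTop atTop := tendsto_natCast_atTop_atTop.comp hM
  have hMs : Tendsto (fun n => √(M n : ℝ)) atTop atTop := Real.tendsto_sqrt_atTop.comp hMr
  set u : ℕ → ℝ := fun n => (y n : ℝ) / M n with hu
  have hu0 : Tendsto u atTop (nhds 0) := by
    have := hy.div_atTop hMs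
    refine this.congr (fun n => ?_)
    rw [div_div, Real.mul_self_sqrt (by positivity)]
  set a : ℕ → ℕ := fun n => ((M n + y n) / 2).toNat with ha
  set b : ℕ → ℕ := fun n => ((M n - y n) / 2).toNat with hb
  have hev : ∀ᶠ n in atTop, 0 < M n ∧ |u n| ≤ 1 / 2 := by
    have h1 := hM.eventually_gt_atTop 0
    have h2 : ∀ᶠ n in atTop, |u n| ≤ 1 / 2 := by
      have := hu0.abs
      rw [abs_zero] at this
      exact this.eventually (eventually_le_nhds (by norm_num))
    exact h1.and h2
  have hab : ∀ᶠ n in atTop, (a n : ℤ) = (M n + y n) / 2 ∧ (b n : ℤ) = (M n - y n) / 2 ∧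
      a n + b n = M n ∧ y n = 2 * a n - M n ∧ (a n : ℝ) = M n * (1 + u n) / 2 ∧
      (b n : ℝ) = M n * (1 - u n) / 2 ∧ a n ≠ 0 ∧ b n ≠ 0 := by
    filter_upwards [hev] with n ⟨h1, h2⟩
    have hM1 : (0 : ℝ) < M n := by exact_mod_cast h1
    have hyu : (y n : ℝ) = M n * u n := by rw [hu]; field_simp
    obtain ⟨c1, c2⟩ := abs_le.1 h2
    have d1 : -(M n : ℤ) < y n := by
      have : -(M n : ℝ) < y n := by rw [hyu]; nlinarith
      exact_mod_cast this
    have d2 : y n < M n := by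
      have : (y n : ℝ) < M n := by rw [hyu]; nlinarith
      exact_mod_cast this
    have hp := hpar n
    have f1 : (a n : ℤ) = (M n + y n) / 2 := by
      simp only [ha]; omega
    have f2 : (b n : ℤ) = (M n - y n) / 2 := by
      simp only [hb]; omega
    have f4 : y n = 2 * a n - M n := by omega
    have f3 : a n + b n = M n := by omega
    have g1 : (a n : ℝ) = M n * (1 + u n) / 2 := by
      have : (y n : ℝ) = 2 * a n - M n := by exact_mod_cast f4
      linarith
    have g2 : (b n : ℝ) = M n * (1 - u n) / 2 := by
      have : (a n : ℝ) + b n = M n := by exact_mod_cast f3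
      linarith
    exact ⟨f1, f2, f3, f4, g1, g2, by omega, by omega⟩
  have hat : Tendsto a atTop atTop := by
    rw [← tendsto_natCast_atTop_iff (R := ℝ)]
    have : Tendsto (fun n => (M n : ℝ) * ((1 + u n) / 2)) atTop atTop := by
      apply hMr.atTop_mul_pos (C := (1 + 0) / 2) (by norm_num)
      exact (hu0.const_add 1).div_const 2
    refine this.congr' ?_
    filter_upwards [hab] with n h
    rw [h.2.2.2.2.1]; ring
  have hbt : Tendsto b atTop atTop := by
    rw [← tendsto_natCast_atTop_iff (R := ℝ)]
    have : Tendsto (fun n => (M n : ℝ) * ((1 - u n) / 2)) atTop atTop := by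
      apply hMr.atTop_mul_pos (C := (1 - 0) / 2) (by norm_num)
      exact (hu0.const_sub 1).div_const 2
    refine this.congr' ?_
    filter_upwards [hab] with n h
    rw [h.2.2.2.2.2.1]; ring
  have st := Stirling.tendsto_stirlingSeq_sqrt_pi
  have hsq : √π ≠ 0 := by positivity
  have L1 : Tendsto (fun n => Stirling.stirlingSeq (M n) /
      (Stirling.stirlingSeq (a n) * Stirling.stirlingSeq (b n))) atTop (nhds (√π / (√π * √π))) :=
    (st.comp hM).div ((st.comp hat).mul (st.comp hbt)) (by positivity)
  have L2 : Tendsto (fun n => √(2 / ((1 + u n) * (1 - u n)))) atTop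
      (nhds (√(2 / ((1 + 0) * (1 - 0))))) := by
    apply Tendsto.sqrt
    exact tendsto_const_nhds.div ((hu0.const_add 1).mul (hu0.const_sub 1)) (by norm_num)
  have L3 : Tendsto (fun n => (M n : ℝ) / 2 * ((1 + u n) * Real.log (1 + u n)
      + (1 - u n) * Real.log (1 - u n))) atTop (nhds (x ^ 2 / 2)) := by
    have m1 : Tendsto (fun n => (M n : ℝ) / 2 * u n ^ 2) atTop (nhds (x ^ 2 / 2)) := by
      refine ((hy.pow 2).div_const 2).congr' ?_
      filter_upwards [hev] with n h
      have hM1 : (0 : ℝ) < M n := by exact_mod_cast h.1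
      rw [div_pow, Real.sq_sqrt hM1.le, hu]
      field_simp
    have m2 : Tendsto (fun n => 6 * ((M n : ℝ) / 2 * u n ^ 2) * |u n|) atTop (nhds 0) := by
      have := (m1.const_mul 6).mul hu0.abs
      simpa using this
    have m3 : Tendsto (fun n => (M n : ℝ) / 2 * ((1 + u n) * Real.log (1 + u n)
      + (1 - u n) * Real.log (1 - u n)) - (M n : ℝ) / 2 * u n ^ 2) atTop (nhds 0) := by
      apply squeeze_zero_norm' _ m2
      filter_upwards [hev] with n h
      rw [← mul_sub, Real.norm_eq_abs, abs_mul, abs_of_nonneg (by positivity)]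
      have := entropy_bound (u n) h.2
      calc (M n : ℝ) / 2 * _ ≤ (M n : ℝ) / 2 * (6 * |u n| ^ 3) := by gcongr
        _ = 6 * ((M n : ℝ) / 2 * |u n| ^ 2) * |u n| := by ring
        _ = _ := by rw [sq_abs]
    have := m3.add m1
    simpa using this
  have L := (L1.mul L2).mul ((Real.continuous_exp.tendsto _).comp L3.neg)
  have hval : √π / (√π * √π) * √(2 / ((1 + 0) * (1 - 0))) * Real.exp (-(x ^ 2 / 2)) =
      √(2 / π) * Real.exp (-x ^ 2 / 2) := by
    rw [Real.sqrt_div (by norm_num)]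
    norm_num
    field_simp
  rw [hval] at L
  refine L.congr' ?_
  filter_upwards [hab] with n ⟨_, _, h3, h4, h5, h6, h7, h8⟩
  have := choose_exact (a n) (b n) h7 h8 (M n) (u n) (by exact_mod_cast h3) h5 h6
  rw [h3] at this
  conv_rhs => rw [h4, freeB_choose, this]
  rfl

/-! ### Uniform bounds -/

lemma freeB_unif : ∃ K : ℝ, 0 < K ∧ ∀ N : ℕ, 1 ≤ N → ∀ y : ℤ,
    freeB N y ≤ K / √N * 2 ^ N := by
  have hl := local_limit (fun n => n) tendsto_id (fun n => 2 * ((n / 2 : ℕ) : ℤ) - n) 0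
    (fun n => by push_cast; omega) (by
      have hs : Tendsto (fun n : ℕ => 1 / √(n : ℝ)) atTop (nhds 0) :=
        tendsto_const_nhds.div_atTop (Real.tendsto_sqrt_atTop.comp tendsto_natCast_atTop_atTop)
      apply squeeze_zero_norm _ hs
      intro n
      rw [norm_div, Real.norm_eq_abs, Real.norm_eq_abs, abs_of_nonneg (Real.sqrt_nonneg _)]
      gcongr
      have : |2 * ((n / 2 : ℕ) : ℤ) - n| ≤ 1 := by rw [abs_le]; push_cast; omega
      exact_mod_cast this)
  obtain ⟨K, hK⟩ := hl.bddAbove_range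
  refine ⟨max K 1, by positivity, ?_⟩
  intro N hN y
  have hN0 : (0 : ℝ) < √N := by positivity
  have hKN : √N * freeB N (2 * ((N / 2 : ℕ) : ℤ) - N) / 2 ^ N ≤ K := hK ⟨N, rfl⟩
  rw [freeB_choose] at hKN
  have h2 : (N.choose (N / 2) : ℝ) ≤ max K 1 / √N * 2 ^ N := by
    rw [div_mul_eq_mul_div, le_div_iff₀ hN0, mul_comm]
    rw [div_le_iff₀ (by positivity)] at hKN
    refine hKN.trans ?_
    gcongr
    exact le_max_left _ _
  by_cases hp : (y - N) % 2 = 0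
  · by_cases hy : (N : ℤ) < |y|
    · rw [freeB_zero_of_abs N y hy]; positivity
    · push Not at hy
      obtain ⟨h3, h4⟩ := abs_le.1 hy
      have e : y = 2 * (((N + y) / 2).toNat : ℤ) - N := by omega
      rw [e, freeB_choose]
      refine le_trans ?_ h2
      exact_mod_cast Nat.choose_le_middle _ N
  · rw [freeB_parity N y hp]; positivity

lemma freeB_gauss_aux (N : ℕ) (p : ℤ) (hp0 : 0 ≤ p) (j : ℕ) :
    freeB N (p + 2 * j) ≤ freeB N p *
      Real.exp (((p : ℝ) ^ 2 - (p + 2 * j) ^ 2) / (4 * (N + 1))) := by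
  induction j with
  | zero => simp
  | succ j ih =>
    set y : ℤ := p + 2 * j with hy
    have hyr : (y : ℝ) = p + 2 * j := by rw [hy]; push_cast; ring
    have e : p + 2 * ((j + 1 : ℕ) : ℤ) = y + 2 := by rw [hy]; push_cast; ring
    have er : (p : ℝ) + 2 * ((j + 1 : ℕ) : ℝ) = y + 2 := by rw [hyr]; push_cast; ring
    rw [e, er]
    rw [← hyr] at ih
    have hB := freeB_nonneg N y
    have hy0 : (0 : ℝ) ≤ y := by
      have : 0 ≤ y := by rw [hy]; positivity
      exact_mod_cast this
    by_cases hyN : (N : ℤ) < y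
    · rw [freeB_zero_of_gt N (y + 2) (by omega)]
      exact mul_nonneg (freeB_nonneg _ _) (Real.exp_pos _).le
    · have hyN' : (y : ℝ) ≤ N := by exact_mod_cast (not_lt.1 hyN)
      have hN0 : (0 : ℝ) ≤ N := by positivity
      have hr := freeB_ratio N y
      have h1 : freeB N (y + 2) = (1 - (2 * y + 2) / (N + y + 2)) * freeB N y := by
        have : (N : ℝ) + y + 2 ≠ 0 := by positivity
        field_simp
        linarith
      have h2 : 1 - (2 * (y : ℝ) + 2) / (N + y + 2) ≤ Real.exp (-((y + 1) / (N + 1))) := by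
        have h3 : (y + 1) / ((N : ℝ) + 1) ≤ (2 * (y : ℝ) + 2) / (N + y + 2) := by
          rw [div_le_div_iff₀ (by positivity) (by positivity)]
          nlinarith
        have := Real.add_one_le_exp (-(((y : ℝ) + 1) / (N + 1)))
        linarith
      calc freeB N (y + 2) ≤ Real.exp (-((y + 1) / (N + 1))) * freeB N y := by
            rw [h1]; gcongr
        _ ≤ Real.exp (-((y + 1) / (N + 1))) * (freeB N p *
              Real.exp (((p : ℝ) ^ 2 - y ^ 2) / (4 * (N + 1)))) := by gcongr
        _ = freeB N p * (Real.exp (-((y + 1) / (N + 1))) *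
              Real.exp (((p : ℝ) ^ 2 - y ^ 2) / (4 * (N + 1)))) := by ring
        _ = _ := by
            rw [← Real.exp_add]
            congr 2
            field_simp
            ring

lemma freeB_gauss : ∃ K : ℝ, 0 < K ∧ ∀ N : ℕ, 1 ≤ N → ∀ y : ℤ, 0 ≤ y →
    freeB N y ≤ K / √N * 2 ^ N * Real.exp (-(y : ℝ) ^ 2 / (4 * (N + 1))) := by
  obtain ⟨K, hK, h⟩ := freeB_unif
  refine ⟨K * Real.exp 1, by positivity, ?_⟩
  intro N hN y hy
  obtain ⟨j, hj⟩ := Int.eq_ofNat_of_zero_le (show 0 ≤ y / 2 by omega)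
  have e : y = y % 2 + 2 * j := by omega
  have h1 := freeB_gauss_aux N (y % 2) (by omega) j
  have er : (y : ℝ) = ((y % 2 : ℤ) : ℝ) + 2 * j := by exact_mod_cast e
  rw [← e, ← er] at h1
  have hp1 : (((y % 2 : ℤ) : ℝ)) ^ 2 ≤ 1 := by
    have : (y % 2) ^ 2 ≤ 1 := by
      rcases Int.emod_two_eq_zero_or_one y with h | h <;> rw [h] <;> norm_num
    exact_mod_cast this
  refine h1.trans ?_
  calc _ ≤ (K / √N * 2 ^ N) * Real.exp (1 + -(y : ℝ) ^ 2 / (4 * (N + 1))) := by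
        gcongr
        · exact h N hN _
        · rw [sub_div, sub_eq_add_neg, neg_div]
          gcongr
          rw [div_le_one (by positivity)]
          have : (0 : ℝ) ≤ N := by positivity
          linarith
    _ = _ := by rw [Real.exp_add]; ring

lemma stripT_iter_nonneg (h : ℕ) (f : ℤ → ℝ) (hf : ∀ j, 0 ≤ f j) (n : ℕ) :
    ∀ j, 0 ≤ (stripT h)^[n] f j := by
  induction n with
  | zero => exact hf
  | succ n ih =>
    intro j
    rw [Function.iterate_succ_apply', stripT]
    split_ifs
    · exact add_nonneg (ih _) (ih _)
    · exact le_rfl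

lemma stripT_iter_supp (h : ℕ) (f : ℤ → ℝ) (hf : ∀ j, (j < 0 ∨ (h : ℤ) < j) → f j = 0) (n : ℕ) :
    ∀ j, (j < 0 ∨ (h : ℤ) < j) → (stripT h)^[n] f j = 0 := by
  cases n with
  | zero => exact hf
  | succ n =>
    intro j hj
    rw [Function.iterate_succ_apply', stripT, if_neg (by omega)]

lemma stripT_adjoint (h : ℕ) (f g : ℤ → ℝ) (hf : ∀ j, (j < 0 ∨ (h : ℤ) < j) → f j = 0)
    (hg : ∀ j, (j < 0 ∨ (h : ℤ) < j) → g j = 0) :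
    ∑ j ∈ Finset.range (h + 1), stripT h f j * g j =
      ∑ j ∈ Finset.range (h + 1), f j * stripT h g j := by
  have shift : ∀ f g : ℤ → ℝ, (∀ j, (j < 0 ∨ (h : ℤ) < j) → f j = 0) →
      (∀ j, (j < 0 ∨ (h : ℤ) < j) → g j = 0) →
      ∑ j ∈ Finset.range (h + 1), f ((j : ℤ) - 1) * g j =
      ∑ j ∈ Finset.range (h + 1), f (j : ℤ) * g ((j : ℤ) + 1) := by
    intro f g hf hg
    rw [Finset.sum_range_succ', Finset.sum_range_succ _ h, hf (((0 : ℕ) : ℤ) - 1) (by simp),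
      hg ((h : ℤ) + 1) (by omega)]
    simp
  have e1 : ∀ f : ℤ → ℝ, ∀ j ∈ Finset.range (h + 1),
      stripT h f (j : ℤ) = f ((j : ℤ) - 1) + f ((j : ℤ) + 1) := by
    intro f j hj
    rw [Finset.mem_range] at hj
    rw [stripT, if_pos (by omega)]
  rw [Finset.sum_congr rfl (fun j hj => by rw [e1 f j hj]),
    Finset.sum_congr (s₁ := Finset.range (h + 1)) (f := fun j : ℕ => f j * stripT h g j) rfl
      (fun j hj => by rw [e1 g j hj])]
  simp only [add_mul, mul_add, Finset.sum_add_distrib]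
  rw [shift f g hf hg]
  have := shift g f hg hf
  simp only [mul_comm (g _)] at this
  rw [← this]
  ring

lemma stripT_iter_adjoint (h : ℕ) (n : ℕ) : ∀ (f g : ℤ → ℝ),
    (∀ j, (j < 0 ∨ (h : ℤ) < j) → f j = 0) → (∀ j, (j < 0 ∨ (h : ℤ) < j) → g j = 0) →
    ∑ j ∈ Finset.range (h + 1), (stripT h)^[n] f j * g j =
      ∑ j ∈ Finset.range (h + 1), f j * (stripT h)^[n] g j := by
  induction n with
  | zero => intro f g _ _; rfl
  | succ n ih =>
    intro f g hf hg
    rw [Function.iterate_succ_apply, ih (stripT h f) g (stripT_iter_supp h f hf 1) hg,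
      stripT_adjoint h f _ hf (stripT_iter_supp h g hg n)]
    simp only [Function.iterate_succ_apply']

lemma stripT_iter_reflect (h : ℕ) (n : ℕ) : ∀ j : ℤ,
    (stripT h)^[n] (dirac0 h) j = (stripT h)^[n] (dirac0 0) (h - j) := by
  induction n with
  | zero =>
    intro j
    simp only [Function.iterate_zero, id_eq, dirac0]
    congr 1
    simp only [eq_iff_iff]; omega
  | succ n ih =>
    intro j
    rw [Function.iterate_succ_apply', Function.iterate_succ_apply', stripT, stripT, ih, ih,
      show (h : ℤ) - (j - 1) = h - j + 1 by ring, show (h : ℤ) - (j + 1) = h - j - 1 by ring]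
    by_cases hj : 0 ≤ j ∧ j ≤ (h : ℤ)
    · rw [if_pos hj, if_pos (by omega), add_comm]
    · rw [if_neg hj, if_neg (by omega)]

lemma stripT_iter_le_free (h : ℕ) (f : ℤ → ℝ) (hf : ∀ j, 0 ≤ f j)
    (hs : ∀ j, (j < 0 ∨ (h : ℤ) < j) → f j = 0) (n : ℕ) : ∀ j : ℤ,
    (stripT h)^[n] f j ≤ ∑ i ∈ Finset.range (h + 1), freeB n (j - i) * f i := by
  induction n with
  | zero =>
    intro j
    rw [Function.iterate_zero, id_eq]
    by_cases hj : j < 0 ∨ (h : ℤ) < j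
    · rw [hs j hj]
      exact Finset.sum_nonneg (fun i _ => mul_nonneg (freeB_nonneg _ _) (hf _))
    · have hm : j.toNat ∈ Finset.range (h + 1) := by rw [Finset.mem_range]; omega
      refine le_trans (le_of_eq ?_) (Finset.single_le_sum (f := fun i : ℕ => freeB 0 (j - i) * f i)
        (fun i _ => mul_nonneg (freeB_nonneg _ _) (hf _)) hm)
      have : ((j.toNat : ℕ) : ℤ) = j := by omega
      simp only [this, freeB, sub_self, if_true, one_mul]
  | succ n ih =>
    intro j
    rw [Function.iterate_succ_apply', stripT]
    split_ifs with hj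
    · refine (add_le_add (ih _) (ih _)).trans (le_of_eq ?_)
      rw [← Finset.sum_add_distrib]
      refine Finset.sum_congr rfl (fun i _ => ?_)
      simp only [freeB]
      rw [show j - i - 1 = j - 1 - i by ring, show j - i + 1 = j + 1 - i by ring]
      ring
    · exact Finset.sum_nonneg (fun i _ => mul_nonneg (freeB_nonneg _ _) (hf _))

lemma freeB_anti (n : ℕ) (y : ℤ) (hy : -1 ≤ y) : freeB n (y + 2) ≤ freeB n y := by
  have h := freeB_diff n (y + 1)
  rw [show y + 1 - 1 = y by ring, show y + 1 + 1 = y + 2 by ring] at h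
  have h1 : (0 : ℝ) ≤ ((y + 1 : ℤ) : ℝ) := by exact_mod_cast (by omega : 0 ≤ y + 1)
  have h2 := mul_nonneg h1 (freeB_nonneg (n + 1) (y + 1))
  rw [← h] at h2
  have := nonneg_of_mul_nonneg_right h2 (by positivity)
  linarith

lemma stripT_iter_le_half (h : ℕ) (n : ℕ) : ∀ j : ℤ, -1 ≤ j →
    (stripT h)^[n] (dirac0 0) j ≤ freeB n j - freeB n (j + 2) := by
  induction n with
  | zero =>
    intro j hj
    simp only [Function.iterate_zero, id_eq, dirac0, freeB]
    by_cases h1 : j = 0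
    · subst h1; norm_num
    · have : ¬ (j + 2 = 0) := by omega
      simp [h1, this]
  | succ n ih =>
    intro j hj
    rw [Function.iterate_succ_apply', stripT]
    split_ifs with hj'
    · refine (add_le_add (ih _ (by omega)) (ih _ (by omega))).trans (le_of_eq ?_)
      simp only [freeB]
      rw [show j - 1 + 2 = j + 2 - 1 by ring, show j + 1 + 2 = j + 2 + 1 by ring]
      ring
    · linarith [freeB_anti (n + 1) j hj]

lemma sum_half (h n : ℕ) (S : ℝ) (hS : ∀ y, freeB n y ≤ S) :
    ∑ j ∈ Finset.range (h + 1), (stripT h)^[n] (dirac0 0) j ≤ 2 * S := by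
  have tel : ∀ m : ℕ, ∑ j ∈ Finset.range m, (freeB n (j : ℤ) - freeB n ((j : ℤ) + 2)) =
      freeB n 0 + freeB n 1 - freeB n m - freeB n (m + 1) := by
    intro m
    induction m with
    | zero => simp
    | succ m ih =>
      rw [Finset.sum_range_succ, ih]; push_cast
      rw [show (m : ℤ) + 1 + 1 = m + 2 by ring]; ring
  calc _ ≤ ∑ j ∈ Finset.range (h + 1), (freeB n (j : ℤ) - freeB n ((j : ℤ) + 2)) :=
        Finset.sum_le_sum (fun j _ => stripT_iter_le_half h n j (by omega))
    _ ≤ _ := by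
      rw [tel]
      linarith [hS 0, hS 1, freeB_nonneg n (h + 1 : ℕ), freeB_nonneg n ((h + 1 : ℕ) + 1)]

lemma W_three_split (h a b c : ℕ) (A B C : ℝ) (hA : ∀ y, freeB a y ≤ A)
    (hB : ∀ y, freeB b y ≤ B) (hC : ∀ y, freeB c y ≤ C) :
    (W (c + (b + a)) h : ℝ) ≤ (2 * C) * (B * (2 * A)) := by
  have s0 : ∀ j, (j < 0 ∨ (h : ℤ) < j) → dirac0 0 j = 0 := by
    intro j hj; simp only [dirac0]; rw [if_neg]; omega
  have sh : ∀ j, (j < 0 ∨ (h : ℤ) < j) → dirac0 h j = 0 := by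
    intro j hj; simp only [dirac0]; rw [if_neg]; omega
  have n0 : ∀ c j, 0 ≤ dirac0 c j := by
    intro c j; simp only [dirac0]; split_ifs <;> norm_num
  have hB0 : 0 ≤ B := (freeB_nonneg b 0).trans (hB 0)
  have hA0 : 0 ≤ A := (freeB_nonneg a 0).trans (hA 0)
  set g := (stripT h)^[a] (dirac0 0) with hg
  have g0 : ∀ j, 0 ≤ g j := stripT_iter_nonneg h _ (n0 0) a
  have gs := stripT_iter_supp h _ s0 a
  have e1 : (W (c + (b + a)) h : ℝ) = ∑ j ∈ Finset.range (h + 1),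
      (stripT h)^[c] (dirac0 h) j * (stripT h)^[b] g j := by
    rw [stripT_iter_adjoint h c _ _ sh (stripT_iter_supp h g gs b), W_eq_iter,
      Function.iterate_add_apply, Function.iterate_add_apply,
      Finset.sum_eq_single_of_mem h (by simp)]
    · simp [dirac0, hg]
    · intro j _ hj
      have : ¬ ((j : ℤ) = h) := by exact_mod_cast hj
      simp [dirac0, this]
  have e2 : ∀ j, (stripT h)^[b] g j ≤ B * (2 * A) := by
    intro j
    refine (stripT_iter_le_free h g g0 gs b j).trans ?_
    calc _ ≤ ∑ i ∈ Finset.range (h + 1), B * g i := by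
          apply Finset.sum_le_sum
          intro i _
          exact mul_le_mul_of_nonneg_right (hB _) (g0 _)
      _ = B * ∑ i ∈ Finset.range (h + 1), g i := by rw [Finset.mul_sum]
      _ ≤ _ := by
        gcongr
        exact sum_half h a A hA
  have e3 : ∑ j ∈ Finset.range (h + 1), (stripT h)^[c] (dirac0 h) j ≤ 2 * C := by
    rw [← Finset.sum_range_reflect]
    refine le_trans (le_of_eq ?_) (sum_half h c C hC)
    refine Finset.sum_congr rfl (fun j hj => ?_)
    rw [Finset.mem_range] at hj
    rw [stripT_iter_reflect, show (h : ℤ) - ((h + 1 - 1 - j : ℕ) : ℤ) = j by omega]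
  rw [e1]
  calc _ ≤ ∑ j ∈ Finset.range (h + 1), (stripT h)^[c] (dirac0 h) j * (B * (2 * A)) := by
        apply Finset.sum_le_sum
        intro j _
        exact mul_le_mul_of_nonneg_left (e2 _) (stripT_iter_nonneg h _ (n0 h) c _)
    _ = (∑ j ∈ Finset.range (h + 1), (stripT h)^[c] (dirac0 h) j) * (B * (2 * A)) := by
        rw [Finset.sum_mul]
    _ ≤ _ := by gcongr

lemma W_unif : ∃ K : ℝ, 0 < K ∧ ∀ n h : ℕ, 3 ≤ n →
    ((n : ℝ) + 2) * √((n : ℝ) + 2) * W n h / 2 ^ n ≤ K := by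
  obtain ⟨K, hK, hB⟩ := freeB_unif
  refine ⟨4 * (K * 3) ^ 3, by positivity, ?_⟩
  intro n h hn
  have key : ∀ k : ℕ, n + 2 ≤ 9 * k → ∀ y, freeB k y ≤ (K * 3) / √((n : ℝ) + 2) * 2 ^ k := by
    intro k hk y
    have hk1 : 1 ≤ k := by omega
    have hk0 : (0 : ℝ) < k := by exact_mod_cast hk1
    refine (hB k hk1 y).trans ?_
    gcongr ?_ * _
    rw [div_le_div_iff₀ (by positivity) (by positivity)]
    have : √((n : ℝ) + 2) ≤ 3 * √k := by
      rw [show (3 : ℝ) * √k = √(9 * k) by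
        rw [Real.sqrt_mul (by norm_num), show (9 : ℝ) = 3 ^ 2 by norm_num,
          Real.sqrt_sq (by norm_num)]]
      apply Real.sqrt_le_sqrt
      exact_mod_cast hk
    nlinarith
  set a := n / 3
  set b := n - 2 * a with hb
  have e : n = a + (b + a) := by omega
  have h1 := W_three_split h a b a _ _ _ (key a (by omega)) (key b (by omega)) (key a (by omega))
  rw [← e] at h1
  have hp : (2 : ℝ) ^ n = 2 ^ a * (2 ^ b * 2 ^ a) := by
    rw [← pow_add, ← pow_add, ← e]
  have hn2 : (0 : ℝ) < (n : ℝ) + 2 := by positivity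
  have hs : √((n : ℝ) + 2) ^ 2 = n + 2 := Real.sq_sqrt hn2.le
  have hs0 : 0 < √((n : ℝ) + 2) := by positivity
  rw [div_le_iff₀ (by positivity), hp]
  calc _ ≤ ((n : ℝ) + 2) * √((n : ℝ) + 2) * _ := mul_le_mul_of_nonneg_left h1 (by positivity)
    _ = _ := by
      generalize √((n : ℝ) + 2) = s at hs hs0
      rw [← hs]
      field_simp
      ring

/-! ### Scaling limit of the height counts -/

/-- second derivative of the Gaussian -/
noncomputable def psi (u : ℝ) : ℝ := Real.exp (-u ^ 2 / 2) * (u ^ 2 - 1)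

/-- limiting density (up to a constant) -/
noncomputable def gfun (x : ℝ) : ℝ := ∑' k : ℕ, psi ((2 * k + 1) * x)

/-- rescaled count -/
noncomputable def qcount (n h : ℕ) : ℝ := ((n : ℝ) + 2) * √((n : ℝ) + 2) * W n h / 2 ^ n

/-- terms of the rescaled count -/
noncomputable def qterm (n h k : ℕ) : ℝ :=
  4 * (√((n : ℝ) + 2) * freeB (n + 2) ((2 * k + 1) * (h + 2)) / 2 ^ (n + 2)) *
    (((2 * k + 1) * ((h : ℝ) + 2) / √((n : ℝ) + 2)) ^ 2 - 1) * (((n : ℝ) + 2) / (n + 1))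

lemma qcount_eq (n h : ℕ) : Summable (qterm n h) ∧ qcount n h = ∑' k, qterm n h k := by
  obtain ⟨hs, hW⟩ := W_formula n h
  have hn2 : (0 : ℝ) < (n : ℝ) + 2 := by positivity
  have hn1 : (0 : ℝ) < (n : ℝ) + 1 := by positivity
  have e : ∀ k : ℕ, qterm n h k = ((n : ℝ) + 2) * √((n : ℝ) + 2) / 2 ^ n *
      (freeB n ((2 * k + 1) * (h + 2) - 2)
      - 2 * freeB n ((2 * k + 1) * (h + 2)) + freeB n ((2 * k + 1) * (h + 2) + 2)) := by
    intro k
    have h2 := freeB_second_diff n ((2 * k + 1) * (h + 2))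
    set D := freeB n ((2 * k + 1) * (h + 2) - 2)
      - 2 * freeB n ((2 * k + 1) * (h + 2)) + freeB n ((2 * k + 1) * (h + 2) + 2)
    push_cast at h2
    have hD : D = freeB (n + 2) ((2 * k + 1) * (h + 2)) *
        (((2 * (k : ℝ) + 1) * (h + 2)) ^ 2 - (n + 2)) / ((n + 2) * (n + 1)) := by
      rw [← h2]; field_simp
    rw [hD, qterm, div_pow, Real.sq_sqrt hn2.le]
    field_simp
    ring
  constructor
  · rw [show qterm n h = fun k => _ from funext e]
    exact hs.mul_left _
  · rw [tsum_congr e, tsum_mul_left, ← hW, qcount]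
    ring

lemma gauss_exp_bound (v : ℝ) :
    Real.exp (-(v ^ 2 / 8)) * (1 + v ^ 2) ≤ 16 * Real.exp 4 * Real.exp (-v) := by
  have h1 : 1 + v ^ 2 ≤ 16 * Real.exp (v ^ 2 / 16) := by
    have := Real.add_one_le_exp (v ^ 2 / 16)
    linarith
  calc _ ≤ Real.exp (-(v ^ 2 / 8)) * (16 * Real.exp (v ^ 2 / 16)) := by gcongr
    _ = 16 * Real.exp (-(v ^ 2 / 16)) := by
      rw [mul_left_comm, ← Real.exp_add]; congr 2; ring
    _ ≤ 16 * Real.exp (4 + -v) := by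
      gcongr
      nlinarith [sq_nonneg (v - 8)]
    _ = _ := by rw [Real.exp_add]; ring

lemma qterm_bound : ∃ C : ℝ, 0 < C ∧ ∀ n h k : ℕ,
    |qterm n h k| ≤ C * Real.exp (-((2 * k + 1) * (((h : ℝ) + 2) / √((n : ℝ) + 2)))) := by
  obtain ⟨K, hK, hB⟩ := freeB_gauss
  refine ⟨8 * K * (16 * Real.exp 4), by positivity, ?_⟩
  intro n h k
  have hn0 : (0 : ℝ) ≤ n := by positivity
  have hn2 : (0 : ℝ) < (n : ℝ) + 2 := by positivity
  have hs0 : 0 < √((n : ℝ) + 2) := by positivity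
  have hb := hB (n + 2) (by omega) ((2 * k + 1) * (h + 2)) (by positivity)
  set B := freeB (n + 2) ((2 * k + 1) * (h + 2)) with hBd
  have hB0 : 0 ≤ B := freeB_nonneg _ _
  set v : ℝ := (2 * k + 1) * ((h : ℝ) + 2) / √((n : ℝ) + 2) with hv
  have hv2 : ((2 * (k : ℝ) + 1) * ((h : ℝ) + 2)) ^ 2 = v ^ 2 * (n + 2) := by
    rw [hv, div_pow, Real.sq_sqrt hn2.le]; field_simp
  push_cast at hb
  have h1 : √((n : ℝ) + 2) * B / 2 ^ (n + 2) ≤ K * Real.exp (-(v ^ 2 / 8)) := by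
    rw [div_le_iff₀ (by positivity)]
    calc _ ≤ √((n : ℝ) + 2) * (K / √((n : ℝ) + 2) * 2 ^ (n + 2) * _) :=
          mul_le_mul_of_nonneg_left hb hs0.le
      _ = K * 2 ^ (n + 2) *
          Real.exp (-((2 * (k : ℝ) + 1) * ((h : ℝ) + 2)) ^ 2 / (4 * (n + 2 + 1))) := by
          field_simp
      _ ≤ K * 2 ^ (n + 2) * Real.exp (-(v ^ 2 / 8)) := by
          gcongr
          rw [hv2, neg_div, neg_le_neg_iff, div_le_div_iff₀ (by norm_num) (by positivity)]
          nlinarith [sq_nonneg v]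
      _ = _ := by ring
  have h2 : ((n : ℝ) + 2) / (n + 1) ≤ 2 := by
    rw [div_le_iff₀ (by positivity)]; linarith
  have h3 : |v ^ 2 - 1| ≤ 1 + v ^ 2 := by
    rw [abs_le]; constructor <;> nlinarith [sq_nonneg v]
  have e : (2 * (k : ℝ) + 1) * (((h : ℝ) + 2) / √((n : ℝ) + 2)) = v := by rw [hv]; ring
  rw [e, qterm, ← hBd, ← hv, abs_mul, abs_mul, abs_mul, abs_of_nonneg (show (0 : ℝ) ≤ 4 by norm_num),
    abs_of_nonneg (show 0 ≤ √((n : ℝ) + 2) * B / 2 ^ (n + 2) by positivity),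
    abs_of_nonneg (show 0 ≤ ((n : ℝ) + 2) / (n + 1) by positivity)]
  calc _ ≤ 4 * (K * Real.exp (-(v ^ 2 / 8))) * (1 + v ^ 2) * 2 := by gcongr
    _ = 8 * K * (Real.exp (-(v ^ 2 / 8)) * (1 + v ^ 2)) := by ring
    _ ≤ 8 * K * (16 * Real.exp 4 * Real.exp (-v)) := by
      gcongr ?_ * ?_
      exact gauss_exp_bound v
    _ = _ := by ring

lemma summable_exp_odd (x : ℝ) (hx : 0 < x) :
    Summable (fun k : ℕ => Real.exp (-((2 * k + 1) * x))) := by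
  have : ∀ k : ℕ, Real.exp (-((2 * k + 1) * x)) = Real.exp (-x) * Real.exp (-(2 * x)) ^ k := by
    intro k
    rw [← Real.exp_nat_mul, ← Real.exp_add]; congr 1; ring
  simp only [this]
  apply Summable.mul_left
  apply summable_geometric_of_lt_one (Real.exp_pos _).le
  rw [Real.exp_lt_one_iff]; linarith

lemma qcount_nonneg (n h : ℕ) : 0 ≤ qcount n h := by unfold qcount; positivity

lemma qcount_bound : ∃ C : ℝ, 0 < C ∧ ∀ n h : ℕ, 3 ≤ n →
    qcount n h ≤ C * Real.exp (-(((h : ℝ) + 2) / √((n : ℝ) + 2))) := by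
  obtain ⟨K, hK, hU⟩ := W_unif
  obtain ⟨C, hC, hT⟩ := qterm_bound
  set S : ℝ := ∑' k : ℕ, Real.exp (-((2 * k + 1) * 1)) with hS
  have hS0 : 0 ≤ S := tsum_nonneg (fun k => (Real.exp_pos _).le)
  refine ⟨K * Real.exp 1 + C * (S * Real.exp 1), by positivity, ?_⟩
  intro n h hn
  set t := ((h : ℝ) + 2) / √((n : ℝ) + 2) with ht
  rw [add_mul]
  rcases le_total t 1 with h1 | h1
  · have : K ≤ K * Real.exp 1 * Real.exp (-t) := by
      rw [mul_assoc, ← Real.exp_add]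
      have := Real.one_le_exp (show 0 ≤ 1 + -t by linarith)
      nlinarith
    have h2 : 0 ≤ C * (S * Real.exp 1) * Real.exp (-t) := by positivity
    have := hU n h hn
    unfold qcount
    linarith
  · have h2 : 0 ≤ K * Real.exp 1 * Real.exp (-t) := by positivity
    obtain ⟨q1, q2⟩ := qcount_eq n h
    have h3 : qcount n h ≤ ∑' k : ℕ, (C * Real.exp (1 - t)) * Real.exp (-((2 * k + 1) * 1)) := by
      rw [q2]
      apply Summable.tsum_le_tsum _ q1 ((summable_exp_odd 1 one_pos).mul_left _)
      intro k
      refine (le_abs_self _).trans ((hT n h k).trans ?_)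
      rw [mul_assoc, ← Real.exp_add, ← ht]
      gcongr
      have : (0 : ℝ) ≤ k := by positivity
      nlinarith
    rw [tsum_mul_left, ← hS] at h3
    have : C * Real.exp (1 - t) * S = C * (S * Real.exp 1) * Real.exp (-t) := by
      rw [sub_eq_add_neg, Real.exp_add]; ring
    linarith

lemma qcount_limit (x : ℝ) (hx : 0 < x) (h : ℕ → ℕ) (hpar : ∀ n, (h n + n) % 2 = 0)
    (hlim : Tendsto (fun n => ((h n : ℝ) + 2) / √((n : ℝ) + 2)) atTop (nhds x))
    (hge : ∀ n, x ≤ ((h n : ℝ) + 2) / √((n : ℝ) + 2)) :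
    Tendsto (fun n => qcount n (h n)) atTop (nhds (4 * √(2 / π) * gfun x)) := by
  obtain ⟨C, hC, hT⟩ := qterm_bound
  have e : ∀ n, qcount n (h n) = ∑' k, qterm n (h n) k := fun n => (qcount_eq n (h n)).2
  simp only [e]
  rw [gfun, ← tsum_mul_left]
  apply tendsto_tsum_of_dominated_convergence
    (bound := fun k : ℕ => C * Real.exp (-((2 * k + 1) * x)))
  · exact (summable_exp_odd x hx).mul_left C
  · intro k
    have hl := local_limit (fun n => n + 2) (tendsto_add_atTop_nat 2)
      (fun n => (2 * k + 1) * (h n + 2)) ((2 * k + 1) * x)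
      (fun n => by
        have := hpar n
        have e : ((2 * (k : ℤ) + 1) * (h n + 2)) = 2 * (k * (h n + 2)) + h n + 2 := by ring
        rw [e]; push_cast
        generalize (k : ℤ) * (h n + 2) = z
        omega)
      (by
        refine (hlim.const_mul (2 * (k : ℝ) + 1)).congr (fun n => ?_)
        push_cast; ring)
    have h2 : Tendsto (fun n : ℕ => ((2 * (k : ℝ) + 1) * ((h n : ℝ) + 2) / √((n : ℝ) + 2)) ^ 2 - 1)
        atTop (nhds (((2 * (k : ℝ) + 1) * x) ^ 2 - 1)) := by
      have := ((hlim.const_mul (2 * (k : ℝ) + 1)).pow 2).sub_const 1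
      refine this.congr (fun n => ?_)
      ring
    have h3 : Tendsto (fun n : ℕ => ((n : ℝ) + 2) / (n + 1)) atTop (nhds 1) := by
      have : Tendsto (fun n : ℕ => 1 + 1 / ((n : ℝ) + 1)) atTop (nhds (1 + 0)) :=
        tendsto_one_div_add_atTop_nhds_zero_nat.const_add 1
      rw [add_zero] at this
      refine this.congr (fun n => ?_)
      have : (n : ℝ) + 1 ≠ 0 := by positivity
      field_simp
      ring
    have h4 := ((hl.const_mul 4).mul h2).mul h3
    have ev : 4 * (√(2 / π) * Real.exp (-((2 * (k : ℝ) + 1) * x) ^ 2 / 2)) *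
        (((2 * (k : ℝ) + 1) * x) ^ 2 - 1) * 1 = 4 * √(2 / π) * psi ((2 * k + 1) * x) := by
      unfold psi; ring
    rw [ev] at h4
    refine h4.congr (fun n => ?_)
    unfold qterm
    push_cast
    rfl
  · refine Eventually.of_forall (fun n k => ?_)
    rw [Real.norm_eq_abs]
    refine (hT n (h n) k).trans ?_
    gcongr
    exact hge n

/-! ### Riemann sums -/

open MeasureTheory in
lemma integral_floor (a : ℕ → ℝ) (s : ℝ) (hs : 0 < s)
    (hi : IntegrableOn (fun x : ℝ => a ⌊x * s⌋₊) (Set.Ioi 0)) :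
    ∫ x in Set.Ioi (0 : ℝ), a ⌊x * s⌋₊ = (∑' i, a i) / s := by
  have hi' : IntegrableOn (fun x : ℝ => a ⌊x * s⌋₊) (Set.Ici 0) := by
    rwa [integrableOn_Ici_iff_integrableOn_Ioi]
  have hU : (⋃ i : ℕ, Set.Ico ((i : ℝ) / s) ((i + 1) / s)) = Set.Ici (0 : ℝ) := by
    ext x
    simp only [Set.mem_iUnion, Set.mem_Ico, Set.mem_Ici]
    constructor
    · rintro ⟨i, h1, _⟩
      exact le_trans (by positivity) h1
    · intro hx
      refine ⟨⌊x * s⌋₊, ?_, ?_⟩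
      · rw [div_le_iff₀ hs]; exact Nat.floor_le (by positivity)
      · rw [lt_div_iff₀ hs]; exact Nat.lt_floor_add_one _
  have hfl : ∀ i : ℕ, ∀ x ∈ Set.Ico ((i : ℝ) / s) ((i + 1) / s), ⌊x * s⌋₊ = i := by
    intro i x hx
    have h0 : 0 ≤ x := le_trans (by positivity) hx.1
    rw [Nat.floor_eq_iff (by positivity)]
    exact ⟨(div_le_iff₀ hs).1 hx.1, (lt_div_iff₀ hs).1 hx.2⟩
  have hd : Pairwise (Function.onFun Disjoint fun i : ℕ => Set.Ico ((i : ℝ) / s) ((i + 1) / s)) := by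
    intro i j hij
    rw [Function.onFun, Set.disjoint_left]
    intro x h1 h2
    exact hij ((hfl i x h1).symm.trans (hfl j x h2))
  rw [← integral_Ici_eq_integral_Ioi, ← hU, integral_iUnion (fun i => measurableSet_Ico) hd
    (by rw [hU]; exact hi')]
  rw [← tsum_div_const]
  congr 1; ext i
  rw [setIntegral_congr_fun measurableSet_Ico (g := fun _ => a i)
    (fun x hx => by simp only [hfl i x hx])]
  rw [setIntegral_const, Measure.real, Real.volume_Ico, ENNReal.toReal_ofReal]
  · rw [smul_eq_mul]; field_simp; ring
  · rw [← sub_div]; ring_nf; positivity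

open MeasureTheory in
lemma riemann_sum (a : ℕ → ℕ → ℝ) (s : ℕ → ℝ) (hs : ∀ n, 0 < s n) (F G : ℝ → ℝ)
    (hG : IntegrableOn G (Set.Ioi 0))
    (hb : ∀ᶠ n in atTop, ∀ x : ℝ, 0 < x → |a n ⌊x * s n⌋₊| ≤ G x)
    (hl : ∀ x : ℝ, 0 < x → Tendsto (fun n => a n ⌊x * s n⌋₊) atTop (nhds (F x))) :
    Tendsto (fun n => (∑' i, a n i) / s n) atTop (nhds (∫ x in Set.Ioi (0 : ℝ), F x)) := by
  have hm : ∀ n, AEStronglyMeasurable (fun x : ℝ => a n ⌊x * s n⌋₊)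
      (volume.restrict (Set.Ioi 0)) := by
    intro n
    apply Measurable.aestronglyMeasurable
    exact (measurable_from_nat (f := a n)).comp (Nat.measurable_floor.comp (measurable_id.mul_const _))
  have hb' : ∀ᶠ n in atTop, ∀ᵐ x ∂(volume.restrict (Set.Ioi (0 : ℝ))),
      ‖a n ⌊x * s n⌋₊‖ ≤ G x := by
    filter_upwards [hb] with n hn
    exact (ae_restrict_iff' measurableSet_Ioi).2 (Eventually.of_forall (fun x hx => hn x hx))
  have := tendsto_integral_filter_of_dominated_convergence (μ := volume.restrict (Set.Ioi (0 : ℝ)))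
    (l := atTop) (F := fun n x => a n ⌊x * s n⌋₊) (f := F) G (Eventually.of_forall hm) hb' hG
    ((ae_restrict_iff' measurableSet_Ioi).2 (Eventually.of_forall (fun x hx => hl x hx)))
  refine this.congr' ?_
  filter_upwards [hb'] with n hn
  exact integral_floor (a n) (s n) (hs n) (Integrable.mono' hG (hm n) hn)

/-! ### Limits of the rescaled moments -/

lemma floor_facts (x S : ℝ) (hx : 0 < x) (hS : 1 ≤ S) (p : ℕ) (hp : p ≤ 1) :
    x ≤ (((2 * ⌊x * (S / 2)⌋₊ + p : ℕ) : ℝ) + 2) / S ∧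
    (((2 * ⌊x * (S / 2)⌋₊ + p : ℕ) : ℝ) + 2) / S ≤ x + 3 / S ∧
    ((2 * ⌊x * (S / 2)⌋₊ + p : ℕ) : ℝ) / S ≤ x + 1 := by
  have hS0 : 0 < S := by linarith
  have h1 := Nat.floor_le (show 0 ≤ x * (S / 2) by positivity)
  have h2 := Nat.lt_floor_add_one (x * (S / 2))
  have hp0 : (0 : ℝ) ≤ p := by positivity
  have hp1 : (p : ℝ) ≤ 1 := by exact_mod_cast hp
  push_cast
  refine ⟨?_, ?_, ?_⟩
  · rw [le_div_iff₀ hS0]; linarith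
  · rw [div_le_iff₀ hS0, add_mul, div_mul_cancel₀ _ hS0.ne']; linarith
  · rw [div_le_iff₀ hS0]; linarith

lemma pow_exp_bound (r : ℕ) (x : ℝ) (hx : 0 < x) :
    (x + 1) ^ r * Real.exp (-x) ≤
      (2 ^ r * r.factorial * Real.exp (1 / 2)) * Real.exp (-(1 / 2) * x) := by
  have h := Real.pow_div_factorial_le_exp ((x + 1) / 2) (by positivity) r
  rw [div_le_iff₀ (by positivity), div_pow, div_le_iff₀ (by positivity)] at h
  calc _ ≤ (Real.exp ((x + 1) / 2) * r.factorial * 2 ^ r) * Real.exp (-x) := by gcongr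
    _ = (2 ^ r * r.factorial) * (Real.exp ((x + 1) / 2) * Real.exp (-x)) := by ring
    _ = (2 ^ r * r.factorial) * (Real.exp (1 / 2) * Real.exp (-(1 / 2) * x)) := by
      rw [← Real.exp_add, ← Real.exp_add]; congr 2; ring
    _ = _ := by ring

lemma sqrt_tendsto : Tendsto (fun n : ℕ => √((n : ℝ) + 2)) atTop atTop :=
  Real.tendsto_sqrt_atTop.comp (tendsto_atTop_add_const_right _ _ tendsto_natCast_atTop_atTop)

lemma one_le_sqrt_two (n : ℕ) : 1 ≤ √((n : ℝ) + 2) := by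
  rw [Real.one_le_sqrt]
  have : (0 : ℝ) ≤ n := by positivity
  linarith

lemma scaled_limit (x : ℝ) (hx : 0 < x) :
    Tendsto (fun n : ℕ => (((2 * ⌊x * (√((n : ℝ) + 2) / 2)⌋₊ + n % 2 : ℕ) : ℝ) + 2) /
      √((n : ℝ) + 2)) atTop (nhds x) := by
  have h3 : Tendsto (fun n : ℕ => x + 3 / √((n : ℝ) + 2)) atTop (nhds (x + 0)) :=
    (tendsto_const_nhds.div_atTop sqrt_tendsto).const_add x
  rw [add_zero] at h3
  refine tendsto_of_tendsto_of_tendsto_of_le_of_le tendsto_const_nhds h3 (fun n => ?_) (fun n => ?_)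
  · exact (floor_facts x _ hx (one_le_sqrt_two n) (n % 2) (by omega)).1
  · exact (floor_facts x _ hx (one_le_sqrt_two n) (n % 2) (by omega)).2.1

lemma qcount_limit' (x : ℝ) (hx : 0 < x) :
    Tendsto (fun n : ℕ => qcount n (2 * ⌊x * (√((n : ℝ) + 2) / 2)⌋₊ + n % 2)) atTop
      (nhds (4 * √(2 / π) * gfun x)) := by
  apply qcount_limit x hx _ (fun n => by omega) (scaled_limit x hx)
  intro n
  exact (floor_facts x _ hx (one_le_sqrt_two n) (n % 2) (by omega)).1

open MeasureTheory in
lemma moment_limit (r : ℕ) :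
    Tendsto (fun n : ℕ => (∑' i : ℕ, (((2 * i + n % 2 : ℕ) : ℝ) / √((n : ℝ) + 2)) ^ r *
        qcount n (2 * i + n % 2)) / (√((n : ℝ) + 2) / 2)) atTop
      (nhds (∫ x in Set.Ioi (0 : ℝ), x ^ r * (4 * √(2 / π) * gfun x))) := by
  obtain ⟨C, hC, hq⟩ := qcount_bound
  apply riemann_sum (fun n i => (((2 * i + n % 2 : ℕ) : ℝ) / √((n : ℝ) + 2)) ^ r *
        qcount n (2 * i + n % 2)) (fun n => √((n : ℝ) + 2) / 2) (fun n => by positivity) _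
    (fun x => C * ((2 ^ r * r.factorial * Real.exp (1 / 2)) * Real.exp (-(1 / 2) * x)))
  · exact ((exp_neg_integrableOn_Ioi 0 (by norm_num)).const_mul _).const_mul _
  · filter_upwards [eventually_ge_atTop 3] with n hn x hx
    obtain ⟨f1, f2, f3⟩ := floor_facts x _ hx (one_le_sqrt_two n) (n % 2) (by omega)
    rw [abs_of_nonneg (mul_nonneg (by positivity) (qcount_nonneg _ _))]
    calc _ ≤ (x + 1) ^ r * (C * Real.exp (-x)) := by
          gcongr
          · exact qcount_nonneg _ _
          · refine (hq n _ hn).trans ?_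
            gcongr
      _ = C * ((x + 1) ^ r * Real.exp (-x)) := by ring
      _ ≤ _ := by
        gcongr ?_ * ?_
        exact pow_exp_bound r x hx
  · intro x hx
    refine Tendsto.mul (Tendsto.pow ?_ r) (qcount_limit' x hx)
    have h1 := scaled_limit x hx
    have h2 : Tendsto (fun n : ℕ => 2 / √((n : ℝ) + 2)) atTop (nhds 0) :=
      tendsto_const_nhds.div_atTop sqrt_tendsto
    have := h1.sub h2
    rw [sub_zero] at this
    refine this.congr (fun n => ?_)
    rw [← sub_div, add_sub_cancel_right]

lemma W_parity (n h : ℕ) (hp : (h + n) % 2 ≠ 0) : W n h = 0 := by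
  have := (W_formula n h).2
  have z : ∀ k : ℕ, (freeB n ((2 * k + 1) * (h + 2) - 2)
      - 2 * freeB n ((2 * k + 1) * (h + 2)) + freeB n ((2 * k + 1) * (h + 2) + 2)) = 0 := by
    intro k
    have e : ((2 * (k : ℤ) + 1) * (h + 2)) = 2 * (k * (h + 2)) + h + 2 := by ring
    rw [e]
    generalize (k : ℤ) * (h + 2) = z
    rw [freeB_parity n _ (by omega), freeB_parity n _ (by omega), freeB_parity n _ (by omega)]
    ring
  simp only [z, tsum_zero] at this
  exact_mod_cast this

lemma moment_sum (n r : ℕ) :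
    (∑' i : ℕ, (((2 * i + n % 2 : ℕ) : ℝ) / √((n : ℝ) + 2)) ^ r * qcount n (2 * i + n % 2)) =
    (((n : ℝ) + 2) * √((n : ℝ) + 2) / 2 ^ n) / √((n : ℝ) + 2) ^ r *
      ∑' h : ℕ, (h : ℝ) ^ r * (W n h : ℝ) := by
  have inj : Function.Injective (fun i : ℕ => 2 * i + n % 2) := by
    intro i j hij; simp only at hij; omega
  rw [← inj.tsum_eq (f := fun h : ℕ => (h : ℝ) ^ r * (W n h : ℝ)), ← tsum_mul_left]
  · congr 1; ext i
    unfold qcount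
    rw [div_pow]; ring
  · intro h hh
    rw [Function.mem_support] at hh
    have : (h + n) % 2 = 0 := by
      by_contra h2
      exact hh (by rw [W_parity n h h2]; simp)
    exact ⟨h / 2, by simp only; omega⟩

lemma heightMoment_limit (r : ℕ)
    (h0 : ∫ x in Set.Ioi (0 : ℝ), x ^ 0 * (4 * √(2 / π) * gfun x) ≠ 0) :
    Tendsto (fun n : ℕ => heightMomentZ n r / √((n : ℝ) + 2) ^ r) atTop
      (nhds ((∫ x in Set.Ioi (0 : ℝ), x ^ r * (4 * √(2 / π) * gfun x)) /
        ∫ x in Set.Ioi (0 : ℝ), x ^ 0 * (4 * √(2 / π) * gfun x))) := by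
  refine ((moment_limit r).div (moment_limit 0) h0).congr (fun n => ?_)
  simp only [Pi.div_apply]
  rw [moment_sum, moment_sum, heightMomentZ]
  simp only [pow_zero, one_mul, div_one]
  have : 0 < √((n : ℝ) + 2) := by positivity
  have : (0 : ℝ) < (n : ℝ) + 2 := by positivity
  generalize (∑' h : ℕ, (h : ℝ) ^ r * (W n h : ℝ)) = A
  generalize (∑' h : ℕ, (W n h : ℝ)) = B
  by_cases hB : B = 0
  · subst hB; simp
  · field_simp

lemma psi_bound (u : ℝ) : |psi u| ≤ 16 * Real.exp 4 * Real.exp (-u) := by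
  refine le_trans ?_ (gauss_exp_bound u)
  unfold psi
  rw [abs_mul, abs_of_pos (Real.exp_pos _)]
  have h3 : |u ^ 2 - 1| ≤ 1 + u ^ 2 := by
    rw [abs_le]; constructor <;> nlinarith [sq_nonneg u]
  gcongr
  nlinarith [sq_nonneg u]

lemma psi_continuous : Continuous psi := by unfold psi; fun_prop

lemma psi_summable (x : ℝ) (hx : 0 < x) : Summable (fun k : ℕ => psi ((2 * k + 1) * x)) := by
  refine Summable.of_norm_bounded ((summable_exp_odd x hx).mul_left (16 * Real.exp 4)) (fun k => ?_)
  exact psi_bound _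

lemma gfun_bound : ∃ C : ℝ, 0 < C ∧ ∀ x : ℝ, 0 < x → |gfun x| ≤ C * Real.exp (-x) := by
  obtain ⟨C, hC, hq⟩ := qcount_bound
  have hc : 0 < 4 * √(2 / π) := by positivity
  refine ⟨C / (4 * √(2 / π)), by positivity, ?_⟩
  intro x hx
  have hl := (qcount_limit' x hx).abs
  have : |4 * √(2 / π) * gfun x| ≤ C * Real.exp (-x) := by
    refine le_of_tendsto hl ?_
    filter_upwards [eventually_ge_atTop 3] with n hn
    rw [abs_of_nonneg (qcount_nonneg _ _)]
    refine (hq n _ hn).trans ?_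
    gcongr
    exact (floor_facts x _ hx (one_le_sqrt_two n) (n % 2) (by omega)).1
  rw [abs_mul, abs_of_pos hc] at this
  rw [div_mul_eq_mul_div, le_div_iff₀ hc, mul_comm]
  exact this

open MeasureTheory in
lemma gfun_integrable : IntegrableOn gfun (Set.Ioi 0) := by
  obtain ⟨C, hC, hg⟩ := gfun_bound
  have hi : IntegrableOn (fun x : ℝ => C * Real.exp (-1 * x)) (Set.Ioi 0) :=
    (exp_neg_integrableOn_Ioi 0 one_pos).const_mul _
  refine Integrable.mono' hi ?_ ?_
  · apply aestronglyMeasurable_of_tendsto_ae atTop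
      (f := fun (m : ℕ) x => ∑ k ∈ Finset.range m, psi ((2 * k + 1) * x))
    · intro m
      apply Continuous.aestronglyMeasurable
      have := psi_continuous
      fun_prop
    · refine (ae_restrict_iff' measurableSet_Ioi).2 (Eventually.of_forall (fun x hx => ?_))
      exact (psi_summable x hx).hasSum.tendsto_sum_nat
  · refine (ae_restrict_iff' measurableSet_Ioi).2 (Eventually.of_forall (fun x hx => ?_))
    rw [neg_one_mul]
    exact hg x hx

/-! ### Evaluation of the integrals -/

open MeasureTheory in
lemma psi_integral_tail (m e : ℝ) (hm : 1 ≤ m) (he : 0 < e) :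
    IntegrableOn (fun x => psi (m * x)) (Set.Ioi e) ∧
    (∫ x in Set.Ioi e, psi (m * x)) = e * Real.exp (-(m * e) ^ 2 / 2) ∧
    (∫ x in Set.Ioi e, ‖psi (m * x)‖) ≤ 16 * Real.exp 4 * Real.exp (-(m * e)) := by
  have hm0 : 0 < m := by linarith
  have hi0 : IntegrableOn (fun x : ℝ => 16 * Real.exp 4 * Real.exp (-m * x)) (Set.Ioi e) :=
    (exp_neg_integrableOn_Ioi e hm0).const_mul _
  have hle : ∀ x, ‖psi (m * x)‖ ≤ 16 * Real.exp 4 * Real.exp (-m * x) := by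
    intro x; rw [neg_mul]; exact psi_bound _
  have hi : IntegrableOn (fun x => psi (m * x)) (Set.Ioi e) := by
    refine Integrable.mono' hi0 ?_ (Eventually.of_forall hle)
    exact (psi_continuous.comp (continuous_const.mul continuous_id)).aestronglyMeasurable
  refine ⟨hi, ?_, ?_⟩
  · have hd : ∀ x : ℝ, HasDerivAt (fun x => -(x * Real.exp (-(m * x) ^ 2 / 2))) (psi (m * x)) x := by
      intro x
      have h1 : HasDerivAt (fun x : ℝ => -(m * x) ^ 2 / 2) (-(m ^ 2 * x)) x := by
        have := ((((hasDerivAt_id x).const_mul m).pow 2).neg).div_const 2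
        refine HasDerivAt.congr_deriv (f := fun x : ℝ => -(m * x) ^ 2 / 2) this ?_
        norm_num; ring
      have := ((hasDerivAt_id x).mul h1.exp).neg
      refine HasDerivAt.congr_deriv (f := fun x : ℝ => -(x * Real.exp (-(m * x) ^ 2 / 2))) this ?_
      unfold psi; simp only [id]; ring
    have ht : Tendsto (fun x : ℝ => -(x * Real.exp (-(m * x) ^ 2 / 2))) atTop (nhds 0) := by
      have hz : Tendsto (fun x : ℝ => 16 * Real.exp 4 * Real.exp (-x)) atTop (nhds 0) := by
        have := Real.tendsto_exp_neg_atTop_nhds_zero.const_mul (16 * Real.exp 4)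
        simpa using this
      refine squeeze_zero_norm' ?_ hz
      filter_upwards [eventually_ge_atTop 0] with x hx
      rw [norm_neg, Real.norm_eq_abs, abs_of_nonneg (by positivity)]
      refine le_trans ?_ (gauss_exp_bound x)
      rw [mul_comm]
      have : x ^ 2 ≤ (m * x) ^ 2 := by
        apply pow_le_pow_left₀ hx; nlinarith
      gcongr
      · nlinarith [sq_nonneg x]
      · nlinarith
    rw [integral_Ioi_of_hasDerivAt_of_tendsto (hd e).continuousAt.continuousWithinAt
      (fun x _ => hd x) hi ht]
    ring
  · calc _ ≤ ∫ x in Set.Ioi e, 16 * Real.exp 4 * Real.exp (-m * x) :=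
          integral_mono hi.norm hi0 hle
      _ = 16 * Real.exp 4 * (Real.exp (-(m * e)) / m) := by
        rw [integral_const_mul, integral_exp_mul_Ioi (by linarith), neg_div_neg_eq, neg_mul]
      _ ≤ _ := by
        gcongr
        exact div_le_self (Real.exp_pos _).le hm

open MeasureTheory in
lemma gfun_tail (e : ℝ) (he : 0 < e) :
    ∫ x in Set.Ioi e, gfun x = e * ∑' k : ℕ, Real.exp (-((2 * k + 1) * e) ^ 2 / 2) := by
  have h1 : ∀ k : ℕ, (1 : ℝ) ≤ 2 * k + 1 := fun k => by
    have : (0 : ℝ) ≤ k := by positivity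
    linarith
  unfold gfun
  rw [← integral_tsum_of_summable_integral_norm (fun k => (psi_integral_tail _ e (h1 k) he).1)
    (Summable.of_nonneg_of_le (fun k => integral_nonneg (fun _ => norm_nonneg _))
      (fun k => (psi_integral_tail _ e (h1 k) he).2.2) ((summable_exp_odd e he).mul_left _)),
    ← tsum_mul_left]
  congr 1; ext k
  exact (psi_integral_tail _ e (h1 k) he).2.1

open MeasureTheory in
lemma gfun_integral_zero : ∫ x in Set.Ioi (0 : ℝ), gfun x = √(2 * π) / 4 := by
  -- truncated integrals
  have hU : (⋃ n : ℕ, Set.Ioi (1 / ((n : ℝ) + 1))) = Set.Ioi (0 : ℝ) := by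
    ext x
    simp only [Set.mem_iUnion, Set.mem_Ioi]
    constructor
    · rintro ⟨n, hn⟩; exact lt_trans (by positivity) hn
    · intro hx; exact exists_nat_one_div_lt hx
  have hmono : Monotone (fun n : ℕ => Set.Ioi (1 / ((n : ℝ) + 1))) := by
    intro a b hab
    exact Set.Ioi_subset_Ioi (Nat.one_div_le_one_div hab)
  have L1 := tendsto_setIntegral_of_monotone (μ := volume) (f := gfun)
    (s := fun n : ℕ => Set.Ioi (1 / ((n : ℝ) + 1)))
    (fun _ => measurableSet_Ioi) hmono (by rw [hU]; exact gfun_integrable)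
  rw [hU] at L1
  -- Riemann sums
  have L2 := riemann_sum (fun n i => Real.exp (-((2 * i + 1) * (1 / ((n : ℝ) + 1))) ^ 2 / 2))
    (fun n => ((n : ℝ) + 1) / 2) (fun n => by positivity) (fun x => Real.exp (-(1 / 2) * x ^ 2))
    (fun x => Real.exp (3 / 2) * Real.exp (-1 * x))
    ((exp_neg_integrableOn_Ioi 0 one_pos).const_mul _)
    (Eventually.of_forall (fun n x hx => by
      have hn : (0 : ℝ) < (n : ℝ) + 1 := by positivity
      have hn0 : (0 : ℝ) ≤ n := by positivity
      have h2 := Nat.lt_floor_add_one (x * (((n : ℝ) + 1) / 2))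
      rw [abs_of_pos (Real.exp_pos _), ← Real.exp_add]
      set v := (2 * (⌊x * (((n : ℝ) + 1) / 2)⌋₊ : ℝ) + 1) * (1 / ((n : ℝ) + 1)) with hv
      have : x - 1 ≤ v := by
        rw [hv, mul_one_div, le_div_iff₀ hn]; nlinarith
      gcongr
      nlinarith [sq_nonneg (v - 1)]))
    (fun x hx => by
      have hT : Tendsto (fun n : ℕ => ((n : ℝ) + 1) / 2) atTop atTop :=
        (tendsto_atTop_add_const_right _ _ tendsto_natCast_atTop_atTop).atTop_div_const (by norm_num)
      have h1 := (tendsto_nat_floor_mul_div_atTop hx.le).comp hT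
      have h2 := h1.add (tendsto_one_div_add_atTop_nhds_zero_nat (𝕜 := ℝ))
      rw [add_zero] at h2
      have h3 : Tendsto (fun n : ℕ => -((2 * (⌊x * (((n : ℝ) + 1) / 2)⌋₊ : ℝ) + 1) *
          (1 / ((n : ℝ) + 1))) ^ 2 / 2) atTop (nhds (-x ^ 2 / 2)) := by
        refine (((h2.pow 2).neg).div_const 2).congr (fun n => ?_)
        have hn : (n : ℝ) + 1 ≠ 0 := by positivity
        simp only [Function.comp]
        congr 3
        field_simp
      rw [show -(1 / 2) * x ^ 2 = -x ^ 2 / 2 by ring]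
      exact (Real.continuous_exp.tendsto _).comp h3)
  rw [integral_gaussian_Ioi] at L2
  have L3 := L2.div_const 2
  have := tendsto_nhds_unique L1 (L3.congr (fun n => by
    rw [gfun_tail _ (by positivity)]
    have hn : (n : ℝ) + 1 ≠ 0 := by positivity
    generalize (∑' k : ℕ, Real.exp (-((2 * k + 1) * (1 / ((n : ℝ) + 1))) ^ 2 / 2)) = A
    field_simp))
  rw [this, show π / (1 / 2) = 2 * π by ring]
  ring

open MeasureTheory in
lemma psi_moment (r : ℕ) : IntegrableOn (fun x => x ^ r * psi x) (Set.Ioi 0) ∧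
    ∫ x in Set.Ioi (0 : ℝ), x ^ r * psi x =
      r * ((2 : ℝ) ^ (((r : ℝ) - 1) / 2) * Real.Gamma (((r : ℝ) + 1) / 2)) := by
  have hr0 : (0 : ℝ) ≤ r := by positivity
  have hi : ∀ k : ℕ, IntegrableOn (fun x : ℝ => x ^ k * Real.exp (-(1 / 2) * x ^ 2)) (Set.Ioi 0) := by
    intro k
    have := integrableOn_rpow_mul_exp_neg_mul_sq (b := 1 / 2) (by norm_num) (s := k)
      (by have : (0 : ℝ) ≤ k := by positivity
          linarith)
    simpa only [Real.rpow_natCast] using this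
  have hv : ∀ k : ℕ, ∫ x in Set.Ioi (0 : ℝ), x ^ k * Real.exp (-(1 / 2) * x ^ 2) =
      (2 : ℝ) ^ (((k : ℝ) - 1) / 2) * Real.Gamma (((k : ℝ) + 1) / 2) := by
    intro k
    have := integral_rpow_mul_exp_neg_mul_rpow (p := 2) (q := k) (b := 1 / 2) (by norm_num)
      (by have : (0 : ℝ) ≤ k := by positivity
          linarith) (by norm_num)
    simp only [Real.rpow_natCast, Real.rpow_two] at this
    rw [this]
    congr 1
    rw [one_div, Real.inv_rpow (by norm_num), ← Real.rpow_neg (by norm_num),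
      show (2 : ℝ)⁻¹ = (2 : ℝ) ^ (-1 : ℝ) by rw [Real.rpow_neg_one], ← Real.rpow_add (by norm_num)]
    congr 1; ring
  have e : ∀ x : ℝ, x ^ r * psi x = x ^ (r + 2) * Real.exp (-(1 / 2) * x ^ 2) -
      x ^ r * Real.exp (-(1 / 2) * x ^ 2) := by
    intro x
    unfold psi
    rw [show -x ^ 2 / 2 = -(1 / 2) * x ^ 2 by ring]; ring
  simp only [e]
  refine ⟨(hi _).sub (hi _), ?_⟩
  rw [integral_sub (hi _) (hi _), hv, hv]
  push_cast
  rw [show ((r : ℝ) + 2 + 1) / 2 = (r + 1) / 2 + 1 by ring, Real.Gamma_add_one (by positivity),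
    show ((r : ℝ) + 2 - 1) / 2 = (r - 1) / 2 + 1 by ring, Real.rpow_add_one (by norm_num)]
  ring

open MeasureTheory in
lemma gfun_moment (r : ℕ) (hr : 1 ≤ r) :
    ∫ x in Set.Ioi (0 : ℝ), x ^ r * gfun x =
      (∑' k : ℕ, 1 / (2 * (k : ℝ) + 1) ^ (r + 1)) * ∫ x in Set.Ioi (0 : ℝ), x ^ r * psi x := by
  have hm : ∀ k : ℕ, (0 : ℝ) < 2 * k + 1 := fun k => by positivity
  have sc : ∀ (f : ℝ → ℝ) (k : ℕ), ∫ x in Set.Ioi (0 : ℝ), x ^ r * f ((2 * k + 1) * x) =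
      1 / (2 * (k : ℝ) + 1) ^ (r + 1) * ∫ x in Set.Ioi (0 : ℝ), x ^ r * f x := by
    intro f k
    have h := integral_comp_mul_left_Ioi (fun x => x ^ r * f x) 0 (hm k)
    rw [mul_zero, smul_eq_mul] at h
    have e : ∀ x : ℝ, x ^ r * f ((2 * k + 1) * x) =
        1 / (2 * (k : ℝ) + 1) ^ r * (((2 * k + 1) * x) ^ r * f ((2 * k + 1) * x)) := by
      intro x
      have := (hm k).ne'
      rw [mul_pow]; field_simp
    simp only [e]
    rw [integral_const_mul, h]
    have := (hm k).ne'
    field_simp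
    ring
  have hinteg : ∀ k : ℕ, IntegrableOn (fun x : ℝ => x ^ r * psi ((2 * k + 1) * x)) (Set.Ioi 0) := by
    intro k
    have h := (integrableOn_Ioi_comp_mul_left_iff (fun x => x ^ r * psi x) 0 (hm k)).2
      (by rw [mul_zero]; exact (psi_moment r).1)
    have := h.const_mul (1 / (2 * (k : ℝ) + 1) ^ r)
    refine this.congr (Eventually.of_forall (fun x => ?_))
    have := (hm k).ne'
    simp only
    rw [mul_pow]; field_simp
  have hsum : Summable (fun k : ℕ => 1 / (2 * (k : ℝ) + 1) ^ (r + 1)) := by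
    have h1 : Summable (fun k : ℕ => 1 / (k : ℝ) ^ (r + 1)) :=
      Real.summable_one_div_nat_pow.2 (by omega)
    have := h1.comp_injective (i := fun k : ℕ => 2 * k + 1) (fun a b hab => by
      simp only at hab; omega)
    refine this.congr (fun k => ?_)
    simp
  unfold gfun
  simp only [← tsum_mul_left]
  rw [← integral_tsum_of_summable_integral_norm hinteg, ← tsum_mul_right]
  · congr 1; ext k; exact sc psi k
  · have e : ∀ k : ℕ, ∫ x in Set.Ioi (0 : ℝ), ‖x ^ r * psi ((2 * k + 1) * x)‖ =
        1 / (2 * (k : ℝ) + 1) ^ (r + 1) * ∫ x in Set.Ioi (0 : ℝ), x ^ r * |psi x| := by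
      intro k
      rw [← sc (fun x => |psi x|) k]
      refine setIntegral_congr_fun measurableSet_Ioi (fun x hx => ?_)
      have : (0 : ℝ) < x := hx
      simp only [norm_mul, Real.norm_eq_abs]
      rw [abs_of_pos (by positivity : 0 < x ^ r)]
    simp only [e]
    exact hsum.mul_right _

lemma odd_zeta (r : ℕ) (hr : 1 ≤ r) :
    (∑' k : ℕ, 1 / (2 * (k : ℝ) + 1) ^ (r + 1)) =
      (1 - 1 / 2 ^ (r + 1)) * ∑' k : ℕ, 1 / ((k : ℝ) + 1) ^ (r + 1) := by
  have h1 : Summable (fun k : ℕ => 1 / ((k : ℝ) + 1) ^ (r + 1)) := by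
    have := (summable_nat_add_iff 1).2
      (Real.summable_one_div_nat_pow.2 (by omega : 1 < r + 1))
    simpa using this
  have h2 := tsum_even_add_odd (f := fun k : ℕ => 1 / ((k : ℝ) + 1) ^ (r + 1))
    (h1.comp_injective (i := fun k : ℕ => 2 * k) (fun a b hab => by simp only at hab; omega))
    (h1.comp_injective (i := fun k : ℕ => 2 * k + 1) (fun a b hab => by simp only at hab; omega))
  have e : ∀ k : ℕ, 1 / (((2 * k + 1 : ℕ) : ℝ) + 1) ^ (r + 1) =
      1 / 2 ^ (r + 1) * (1 / ((k : ℝ) + 1) ^ (r + 1)) := by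
    intro k
    rw [one_div_mul_one_div, ← mul_pow]
    congr 2; push_cast; ring
  simp only [e, tsum_mul_left] at h2
  push_cast at h2
  linarith

lemma odd_zeta_pos (r : ℕ) (hr : 1 ≤ r) : 0 < ∑' k : ℕ, 1 / ((k : ℝ) + 1) ^ (r + 1) := by
  have h1 : Summable (fun k : ℕ => 1 / ((k : ℝ) + 1) ^ (r + 1)) := by
    have := (summable_nat_add_iff 1).2
      (Real.summable_one_div_nat_pow.2 (by omega : 1 < r + 1))
    simpa using this
  exact h1.tsum_pos (fun k => by positivity) 0 (by positivity)

lemma sqrt_ratio (r : ℕ) :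
    Tendsto (fun n : ℕ => √((n : ℝ) + 2) ^ r / (n : ℝ) ^ ((r : ℝ) / 2)) atTop (nhds 1) := by
  have h1 : Tendsto (fun n : ℕ => 1 + 2 / (n : ℝ)) atTop (nhds (1 + 0)) :=
    (tendsto_const_nhds.div_atTop tendsto_natCast_atTop_atTop).const_add 1
  have h2 := ((Real.continuous_sqrt.tendsto _).comp h1).pow r
  rw [add_zero, Real.sqrt_one, one_pow] at h2
  refine h2.congr' ?_
  filter_upwards [eventually_gt_atTop 0] with n hn
  have hn' : (0 : ℝ) < n := by exact_mod_cast hn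
  have e : (n : ℝ) ^ ((r : ℝ) / 2) = √(n : ℝ) ^ r := by
    rw [Real.sqrt_eq_rpow, ← Real.rpow_natCast, ← Real.rpow_mul hn'.le]
    congr 1; ring
  rw [e, ← div_pow, ← Real.sqrt_div' _ hn'.le]
  simp only [Function.comp]
  congr 2
  field_simp

lemma const_eval (r : ℕ) (G Z : ℝ) :
    ((1 - 1 / 2 ^ (r + 1)) * Z) * (r * ((2 : ℝ) ^ (((r : ℝ) - 1) / 2) * G)) / (√(2 * π) / 4) =
      (r : ℝ) / √π * G * (2 ^ (r + 1) - 1) * (2 : ℝ) ^ (-(r : ℝ) / 2) * Z := by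
  have hs : 0 < √(2 : ℝ) := by positivity
  have hp : 0 < √π := Real.sqrt_pos.2 Real.pi_pos
  have e1 : (2 : ℝ) ^ (((r : ℝ) - 1) / 2) = 2 ^ r * (2 : ℝ) ^ (-(r : ℝ) / 2) / √2 := by
    rw [Real.sqrt_eq_rpow, ← Real.rpow_natCast, ← Real.rpow_add (by norm_num),
      ← Real.rpow_sub (by norm_num)]
    congr 1; ring
  have h2 : √(2 : ℝ) * √2 = 2 := Real.mul_self_sqrt (by norm_num)
  rw [e1, Real.sqrt_mul (by norm_num)]
  generalize (2 : ℝ) ^ (-(r : ℝ) / 2) = t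
  have e2 : ((1 - 1 / 2 ^ (r + 1)) * Z) * (r * (2 ^ r * t / √2 * G)) / (√2 * √π / 4) =
    ((1 - 1 / 2 ^ (r + 1)) * Z) * (r * (2 ^ r * t * G)) * 4 / ((√2 * √2) * √π) := by
    field_simp
  rw [e2, h2, pow_succ]
  field_simp
  try ring


/-- For each fixed `r ≥ 1`, the `r`-th moment of the height of admissible walks on `ℤ`
satisfies `E H̃_n^r ∼ (r/√π) Γ((r+1)/2) (2^{r+1}−1) 2^{−r/2} ζ(r+1) n^{r/2}` as `n → ∞`. -/
theorem heightMomentZ_asymptotics (r : ℕ) (hr : 1 ≤ r) :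
    Tendsto
      (fun n : ℕ =>
        heightMomentZ n r /
          ((r : ℝ) / Real.sqrt π * Real.Gamma (((r : ℝ) + 1) / 2) * (2 ^ (r + 1) - 1) *
            (2 : ℝ) ^ (-(r : ℝ) / 2) * (∑' k : ℕ, 1 / ((k : ℝ) + 1) ^ (r + 1)) *
            (n : ℝ) ^ ((r : ℝ) / 2)))
      atTop (nhds 1) := by
  have c0 : 0 < 4 * √(2 / π) := by positivity
  have pull : ∀ s : ℕ, ∫ x in Set.Ioi (0 : ℝ), x ^ s * (4 * √(2 / π) * gfun x) =
      4 * √(2 / π) * ∫ x in Set.Ioi (0 : ℝ), x ^ s * gfun x := by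
    intro s
    rw [← MeasureTheory.integral_const_mul]
    congr 1; ext x; ring
  have hz : ∫ x in Set.Ioi (0 : ℝ), x ^ 0 * (4 * √(2 / π) * gfun x) =
      4 * √(2 / π) * (√(2 * π) / 4) := by
    rw [pull, ← gfun_integral_zero]
    simp only [pow_zero, one_mul]
  have L := heightMoment_limit r (by rw [hz]; positivity)
  rw [hz, pull r, mul_div_mul_left _ _ c0.ne', gfun_moment r hr, (psi_moment r).2, odd_zeta r hr,
    const_eval] at L
  have hc : 0 < (r : ℝ) / √π * Real.Gamma (((r : ℝ) + 1) / 2) * (2 ^ (r + 1) - 1) *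
      (2 : ℝ) ^ (-(r : ℝ) / 2) * (∑' k : ℕ, 1 / ((k : ℝ) + 1) ^ (r + 1)) := by
    have h1 := odd_zeta_pos r hr
    have h2 : 0 < Real.Gamma (((r : ℝ) + 1) / 2) := Real.Gamma_pos_of_pos (by positivity)
    have h3 : (0 : ℝ) < 2 ^ (r + 1) - 1 := by
      have : (1 : ℝ) < 2 ^ (r + 1) := one_lt_pow₀ (by norm_num) (by omega)
      linarith
    have h4 : (0 : ℝ) < r := by exact_mod_cast hr
    have hp : 0 < √π := Real.sqrt_pos.2 Real.pi_pos
    exact mul_pos (mul_pos (mul_pos (mul_pos (div_pos h4 hp) h2) h3) (by positivity)) h1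
  generalize (r : ℝ) / √π * Real.Gamma (((r : ℝ) + 1) / 2) * (2 ^ (r + 1) - 1) *
      (2 : ℝ) ^ (-(r : ℝ) / 2) * (∑' k : ℕ, 1 / ((k : ℝ) + 1) ^ (r + 1)) = c at hc L ⊢
  have M := (L.div_const c).mul (sqrt_ratio r)
  rw [div_self hc.ne', one_mul] at M
  refine M.congr (fun n => ?_)
  have hS : 0 < √((n : ℝ) + 2) ^ r := by positivity
  generalize √((n : ℝ) + 2) ^ r = S at hS ⊢
  rw [div_div, div_mul_div_comm, mul_comm S c, mul_right_comm, mul_div_mul_right _ _ hS.ne']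
end

section
/- Zhao's conjecture (strengthened): the number B_n of bidirectional ballot sequences of length n satisfies, as n → ∞, B_n = 2^n (1/(4n) + 1/(6n²) + 7/(45n³) + 10/(63n⁴) + 764/(4725n⁵) + 4952/(31185n⁶)) + O(2^n/n⁷); in particular B_n/2^n = 1/(4n) + 1/(6n²) + O(1/n³). -/
/-- `B n`: the number of bidirectional ballot sequences of length `n`, i.e. sequences
`b ∈ {0,1}^n` such that every nonempty prefix and every nonempty suffix contains strictly
more `1`'s than `0`'s (a prefix/suffix of length `k` has strictly more ones than zeros
iff twice its number of ones exceeds `k`). -/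
noncomputable def B (n : ℕ) : ℕ :=
  Nat.card {b : Fin n → Bool //
    ∀ k, 1 ≤ k → k ≤ n →
      k < 2 * (Finset.univ.filter (fun i : Fin n => (i : ℕ) < k ∧ b i)).card ∧
      k < 2 * (Finset.univ.filter (fun i : Fin n => n - k ≤ (i : ℕ) ∧ b i)).card}

namespace Zhao

/-- Partial sums of the ±1 walk attached to a 0/1 sequence. -/
def S {n : ℕ} (b : Fin n → Bool) (k : ℕ) : ℤ :=
  ∑ i : Fin n, if (i : ℕ) < k then (if b i then 1 else -1) else 0

lemma S_zero {n : ℕ} (b : Fin n → Bool) : S b 0 = 0 := by simp [S]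

lemma S_cons {n : ℕ} (x : Bool) (b : Fin n → Bool) (k : ℕ) :
    S (Fin.cons x b : Fin (n + 1) → Bool) (k + 1) = (if x then 1 else -1) + S b k := by
  simp [S, Fin.sum_univ_succ]

lemma card_lt {n k : ℕ} (h : k ≤ n) :
    (Finset.univ.filter (fun i : Fin n => (i : ℕ) < k)).card = k := by
  simp [Fin.card_filter_val_lt, h]

lemma pre_card {n k : ℕ} (b : Fin n → Bool) (h : k ≤ n) :
    (2 * (Finset.univ.filter (fun i : Fin n => (i : ℕ) < k ∧ b i)).card : ℤ) = k + S b k := by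
  have h1 : (k : ℤ) = ∑ i : Fin n, if (i : ℕ) < k then (1 : ℤ) else 0 := by
    rw [← Finset.sum_filter, Finset.sum_const, card_lt h]; simp
  rw [Finset.card_filter]
  push_cast
  conv_rhs => rw [h1]
  rw [S, ← Finset.sum_add_distrib, Finset.mul_sum]
  apply Finset.sum_congr rfl
  intro i _
  by_cases h1 : (i : ℕ) < k <;> cases hb : b i <;> simp [h1]

lemma suf_card {n k : ℕ} (b : Fin n → Bool) (h : k ≤ n) :
    (2 * (Finset.univ.filter (fun i : Fin n => n - k ≤ (i : ℕ) ∧ b i)).card : ℤ)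
      = k + S b n - S b (n - k) := by
  have h1 := pre_card b (le_refl n)
  have h2 := pre_card b (Nat.sub_le n k)
  have h3 : (Finset.univ.filter (fun i : Fin n => (i : ℕ) < n ∧ b i)).card =
      (Finset.univ.filter (fun i : Fin n => n - k ≤ (i : ℕ) ∧ b i)).card +
      (Finset.univ.filter (fun i : Fin n => (i : ℕ) < n - k ∧ b i)).card := by
    simp only [Finset.card_filter]
    rw [← Finset.sum_add_distrib]
    apply Finset.sum_congr rfl
    intro i _
    by_cases h1 : (i : ℕ) < n - k
    · simp only [h1, true_and]
      have : ¬ (n - k ≤ (i : ℕ)) := by omega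
      simp only [this, false_and, if_false, zero_add]
      simp
    · simp [h1, not_lt.mp h1]
  have h4 : ((n - k : ℕ) : ℤ) = n - k := by omega
  rw [h3] at h1
  push_cast at h1
  rw [h4] at h2
  linarith

/-- Number of walks from `s` to `L` in `k` steps staying strictly inside `(0, L)`
before the last step. -/
noncomputable def U (L : ℤ) (k : ℕ) (s : ℤ) : ℕ :=
  (Finset.univ.filter (fun b : Fin k → Bool =>
    (∀ i < k, 0 < s + S b i ∧ s + S b i < L) ∧ s + S b k = L)).card

lemma card_cons {k : ℕ} (P : (Fin (k + 1) → Bool) → Prop) [DecidablePred P] :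
    (Finset.univ.filter P).card =
      (Finset.univ.filter (fun b : Fin k → Bool => P (Fin.cons true b))).card +
      (Finset.univ.filter (fun b : Fin k → Bool => P (Fin.cons false b))).card := by
  simp only [Finset.card_filter]
  rw [← (Fin.consEquiv (fun _ : Fin (k + 1) => Bool)).sum_comp, Fintype.sum_prod_type,
    Fintype.sum_bool]
  rfl

lemma U_zero (L s : ℤ) : U L 0 s = if s = L then 1 else 0 := by
  by_cases h : s = L <;> simp [U, S, h]

lemma U_out (L : ℤ) (k : ℕ) (s : ℤ) (h : ¬ (0 < s ∧ s < L)) : U L (k + 1) s = 0 := by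
  rw [U, Finset.card_eq_zero, Finset.filter_eq_empty_iff]
  rintro b - ⟨h1, -⟩
  have := h1 0 (by omega)
  rw [S_zero, add_zero] at this
  exact h this

lemma U_succ (L : ℤ) (k : ℕ) (s : ℤ) (h : 0 < s ∧ s < L) :
    U L (k + 1) s = U L k (s + 1) + U L k (s - 1) := by
  rw [U, card_cons]
  congr 1
  · unfold U
    congr 1
    ext b
    simp only [Finset.mem_filter, Finset.mem_univ, true_and, S_cons, if_true, ← add_assoc]
    refine and_congr_left fun _ => ⟨fun H i hi => ?_, fun H i hi => ?_⟩
    · have := H (i + 1) (by omega)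
      simpa only [S_cons, if_true, ← add_assoc] using this
    · rcases i with _ | i
      · simpa [S_zero] using h
      · simpa only [S_cons, if_true, ← add_assoc] using H i (by omega)
  · unfold U
    congr 1
    ext b
    have e : ∀ i, s + ((-1) + S b i) = s - 1 + S b i := fun i => by ring
    simp only [Finset.mem_filter, Finset.mem_univ, true_and, S_cons, Bool.false_eq_true, if_false, e]
    refine and_congr_left fun _ => ⟨fun H i hi => ?_, fun H i hi => ?_⟩
    · have := H (i + 1) (by omega)
      simpa only [S_cons, Bool.false_eq_true, if_false, e] using this
    · rcases i with _ | i
      · simpa [S_zero] using h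
      · simpa only [S_cons, Bool.false_eq_true, if_false, e] using H i (by omega)

lemma S_le {n : ℕ} (b : Fin n → Bool) : S b n ≤ n := by
  have := pre_card b (le_refl n)
  have h2 : (Finset.univ.filter (fun i : Fin n => (i : ℕ) < n ∧ b i)).card ≤ n := by
    refine (Finset.card_filter_le _ _).trans (by simp)
  omega

lemma U_large (L : ℤ) (k : ℕ) (h : (k : ℤ) + 1 < L) : U L k 1 = 0 := by
  rw [U, Finset.card_eq_zero, Finset.filter_eq_empty_iff]
  rintro b - ⟨-, h1⟩
  have := S_le b
  omega

lemma B_cond {m : ℕ} (b : Fin (m + 2) → Bool) :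
    (∀ k, 1 ≤ k → k ≤ m + 2 →
      k < 2 * (Finset.univ.filter (fun i : Fin (m + 2) => (i : ℕ) < k ∧ b i)).card ∧
      k < 2 * (Finset.univ.filter (fun i : Fin (m + 2) => m + 2 - k ≤ (i : ℕ) ∧ b i)).card) ↔
    (∀ i < m + 1, 0 < S b (i + 1) ∧ S b (i + 1) < S b (m + 2)) ∧ 0 < S b (m + 2) := by
  constructor
  · intro H
    have A : ∀ k, 1 ≤ k → k ≤ m + 2 → 0 < S b k := by
      intro k h1 h2
      have := (H k h1 h2).1
      have h3 := pre_card b h2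
      omega
    refine ⟨fun i hi => ⟨A _ (by omega) (by omega), ?_⟩, A _ (by omega) (by omega)⟩
    have h2 : m + 2 - (i + 1) ≤ m + 2 := by omega
    have := (H (m + 2 - (i + 1)) (by omega) h2).2
    have h3 := suf_card b h2
    have h4 : m + 2 - (m + 2 - (i + 1)) = i + 1 := by omega
    rw [h4] at h3 this
    omega
  · rintro ⟨H, H0⟩ k h1 h2
    have h3 := pre_card b h2
    have h4 := suf_card b h2
    have A : ∀ k, 1 ≤ k → k ≤ m + 2 → 0 < S b k := by
      intro k h1 h2
      rcases Nat.lt_or_ge k (m + 2) with h | h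
      · obtain ⟨i, rfl⟩ : ∃ i, k = i + 1 := ⟨k - 1, by omega⟩
        exact (H i (by omega)).1
      · obtain rfl : k = m + 2 := by omega
        exact H0
    have h5 := A k h1 h2
    have h6 : S b (m + 2 - k) < S b (m + 2) := by
      rcases Nat.eq_zero_or_pos (m + 2 - k) with h | h
      · rw [h, S_zero]; exact H0
      · obtain ⟨i, hi⟩ : ∃ i, m + 2 - k = i + 1 := ⟨m + 2 - k - 1, by omega⟩
        rw [hi]; exact (H i (by omega)).2
    constructor <;> omega

lemma B_eq (m : ℕ) : B (m + 2) = ∑ L ∈ Finset.Icc (1 : ℤ) (m + 2), U L (m + 1) 1 := by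
  classical
  unfold B
  rw [Nat.card_eq_fintype_card, Fintype.card_subtype]
  simp only [B_cond]
  rw [Finset.card_eq_sum_card_fiberwise (f := fun b => S b (m + 2)) (t := Finset.Icc (1 : ℤ) (m + 2))]
  · apply Finset.sum_congr rfl
    intro L hL
    rw [Finset.mem_Icc] at hL
    rw [Finset.filter_filter, card_cons]
    have e2 : U L (m + 1) (-1) = 0 := U_out _ _ _ (by omega)
    rw [← add_zero (U L (m + 1) 1), ← e2]
    congr 1
    · unfold U
      congr 1
      ext b
      simp only [Finset.mem_filter, Finset.mem_univ, true_and, S_cons, if_true]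
      constructor
      · rintro ⟨⟨h1, h2⟩, h3⟩
        rw [h3] at h1
        exact ⟨h1, h3⟩
      · rintro ⟨h1, h3⟩
        rw [h3]
        exact ⟨⟨h1, by omega⟩, rfl⟩
    · unfold U
      congr 1
      ext b
      simp only [Finset.mem_filter, Finset.mem_univ, true_and, S_cons, Bool.false_eq_true, if_false]
      constructor
      · rintro ⟨⟨h1, h2⟩, h3⟩
        rw [h3] at h1
        exact ⟨h1, h3⟩
      · rintro ⟨h1, h3⟩
        rw [h3]
        exact ⟨⟨h1, by omega⟩, rfl⟩
  · intro b hb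
    simp only [Finset.coe_filter, Finset.mem_univ, true_and, Set.mem_ofPred_eq] at hb
    have := S_le b
    simp only [Finset.coe_Icc, Set.mem_Icc]
    push_cast at this
    exact ⟨hb.2, this⟩

end Zhao

namespace Zhao
open Real

lemma sum_cos_aux (x : ℝ) (L : ℕ) :
    2 * sin (x / 2) * ∑ j ∈ Finset.range L, cos (j * x) = sin (L * x - x / 2) + sin (x / 2) := by
  induction L with
  | zero => simp
  | succ k ih =>
    rw [Finset.sum_range_succ, mul_add, ih]
    have e1 : ((k + 1 : ℕ) : ℝ) * x - x / 2 = k * x + x / 2 := by push_cast; ring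
    rw [e1, sin_add, sin_sub]
    ring

lemma sum_cos (x : ℝ) (L : ℕ) (h : sin (x / 2) ≠ 0) (h2 : sin (L * x) = 0) :
    ∑ j ∈ Finset.range L, cos (j * x) = (1 - cos (L * x)) / 2 := by
  have := sum_cos_aux x L
  rw [sin_sub, h2] at this
  have h3 : 2 * sin (x / 2) * (∑ j ∈ Finset.range L, cos (j * x) - (1 - cos (L * x)) / 2) = 0 := by
    linear_combination this
  have h4 : 2 * sin (x / 2) ≠ 0 := by simpa using h
  have := (mul_eq_zero.mp h3).resolve_left h4
  linarith

/-- Spectral form of the walk counts. -/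
noncomputable def p (L k : ℕ) (s : ℝ) : ℝ :=
  2 / L * ∑ j ∈ Finset.range L,
    sin (j * (π / L) * s) * sin (j * (π / L) * (L - 1)) * (2 * cos (j * (π / L))) ^ k

lemma p_succ (L k : ℕ) (s : ℝ) : p L (k + 1) s = p L k (s + 1) + p L k (s - 1) := by
  unfold p
  rw [← mul_add, ← Finset.sum_add_distrib]
  congr 1
  apply Finset.sum_congr rfl
  intro j _
  have e1 : (j : ℝ) * (π / L) * (s + 1) = j * (π / L) * s + j * (π / L) := by ring
  have e2 : (j : ℝ) * (π / L) * (s - 1) = j * (π / L) * s - j * (π / L) := by ring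
  rw [e1, e2, sin_add, sin_sub (j * (π / L) * s), pow_succ]
  ring

lemma p_left (L k : ℕ) : p L k 0 = 0 := by simp [p]

lemma p_right (L k : ℕ) : p L k L = 0 := by
  unfold p
  rw [Finset.sum_eq_zero, mul_zero]
  intro j hj
  have : (L : ℝ) ≠ 0 := by
    have := Finset.mem_range.mp hj
    exact_mod_cast (by omega : L ≠ 0)
  have e : (j : ℝ) * (π / L) * L = j * π := by field_simp
  rw [e, sin_nat_mul_pi]; simp

lemma p_base (L : ℕ) (s : ℕ) (h0 : 0 < s) (hs : s < L) :
    p L 0 s = if s + 1 = L then 1 else 0 := by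
  have hL : (0 : ℝ) < L := by exact_mod_cast (by omega : 0 < L)
  have hpi := pi_pos
  have hs' : (s : ℝ) + 1 ≤ L := by exact_mod_cast hs
  have h0' : (1 : ℝ) ≤ s := by exact_mod_cast h0
  set x1 : ℝ := π / L * (L - 1 - s) with hx1
  set x2 : ℝ := π / L * (L - 1 + s) with hx2
  have e1 : p L 0 s = 1 / L * (∑ j ∈ Finset.range L, cos (j * x1) - ∑ j ∈ Finset.range L, cos (j * x2)) := by
    unfold p
    rw [← Finset.sum_sub_distrib, Finset.mul_sum, Finset.mul_sum]
    apply Finset.sum_congr rfl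
    intro j _
    have a1 : (j : ℝ) * x1 = j * (π / L) * (L - 1) - j * (π / L) * s := by rw [hx1]; ring
    have a2 : (j : ℝ) * x2 = j * (π / L) * (L - 1) + j * (π / L) * s := by rw [hx2]; ring
    rw [a1, a2, cos_sub, cos_add]
    ring
  have c2 : ∑ j ∈ Finset.range L, cos (j * x2) = (1 - cos (L * x2)) / 2 := by
    apply sum_cos
    · apply ne_of_gt
      apply sin_pos_of_pos_of_lt_pi
      · have : 0 < (L : ℝ) - 1 + s := by linarith
        rw [hx2]; positivity
      · rw [hx2, div_mul_eq_mul_div, div_div, div_lt_iff₀ (by positivity)]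
        nlinarith
    · have : (L : ℝ) * x2 = ((L - 1 + s : ℤ) : ℝ) * π := by
        rw [hx2]; push_cast; field_simp
      rw [this, sin_int_mul_pi]
  rw [e1, c2]
  split_ifs with h
  · have hs1 : (s : ℝ) = L - 1 := by rw [← h]; push_cast; ring
    have : x1 = 0 := by rw [hx1, hs1]; ring
    have h2 : (L : ℝ) * x2 = ((s : ℕ) : ℝ) * (2 * π) := by
      rw [hx2, hs1]; field_simp; ring
    rw [this, h2, cos_nat_mul_two_pi]
    simp
    field_simp
  · have hs2 : (s : ℝ) + 2 ≤ L := by exact_mod_cast (by omega : s + 2 ≤ L)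
    have c1 : ∑ j ∈ Finset.range L, cos (j * x1) = (1 - cos (L * x1)) / 2 := by
      apply sum_cos
      · apply ne_of_gt
        apply sin_pos_of_pos_of_lt_pi
        · have : 0 < (L : ℝ) - 1 - s := by linarith
          rw [hx1]; positivity
        · rw [hx1, div_mul_eq_mul_div, div_div, div_lt_iff₀ (by positivity)]
          nlinarith
      · have : (L : ℝ) * x1 = ((L - 1 - s : ℤ) : ℝ) * π := by
          rw [hx1]; push_cast; field_simp
        rw [this, sin_int_mul_pi]
    have : (L : ℝ) * x2 = L * x1 + (s : ℕ) * (2 * π) := by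
      rw [hx1, hx2]; field_simp; ring
    rw [c1, this, cos_add_nat_mul_two_pi]
    simp

lemma U_eq_p (L : ℕ) (k : ℕ) : ∀ s : ℕ, s ≤ L → (U L (k + 1) s : ℝ) = p L k s := by
  induction k with
  | zero =>
    intro s hs
    by_cases h : 0 < s ∧ s < L
    · rw [U_succ _ _ _ (by omega), U_zero, U_zero, p_base L s h.1 h.2]
      have h2 : ¬ ((s : ℤ) - 1 = L) := by omega
      simp only [h2, if_false, add_zero]
      by_cases h3 : s + 1 = L
      · have : (s : ℤ) + 1 = L := by omega
        simp [h3, this]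
      · have : ¬ (s : ℤ) + 1 = L := by omega
        simp [h3, this]
    · rw [U_out _ _ _ (by omega)]
      rcases Nat.eq_zero_or_pos s with h1 | h1
      · subst h1; simp [p_left]
      · obtain rfl : s = L := by omega
        rw [p_right]; simp
  | succ k ih =>
    intro s hs
    by_cases h : 0 < s ∧ s < L
    · rw [U_succ _ _ _ (by omega), p_succ]
      push_cast
      have e1 : ((s : ℤ) + 1) = ((s + 1 : ℕ) : ℤ) := by omega
      have e2 : ((s : ℤ) - 1) = ((s - 1 : ℕ) : ℤ) := by omega
      have e3 : ((s : ℝ) - 1) = ((s - 1 : ℕ) : ℝ) := by rw [Nat.cast_sub h.1]; simp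
      rw [e1, e2, ih _ (by omega), ih _ (by omega), e3]
      push_cast; rfl
    · rw [U_out _ _ _ (by omega)]
      rcases Nat.eq_zero_or_pos s with h1 | h1
      · subst h1; simp [p_left]
      · obtain rfl : s = L := by omega
        rw [p_right]; simp

/-- The kernel `cos^m sin^2`. -/
noncomputable def g (m : ℕ) (x : ℝ) : ℝ := cos x ^ m * sin x ^ 2

lemma U_trig (L m : ℕ) (hL : 0 < L) :
    (U L (m + 1) 1 : ℝ) / 2 ^ (m + 2) =
      1 / (2 * L) * ∑ j ∈ Finset.range L, (-1) ^ (j + 1) * g m (π * j / L) := by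
  have := U_eq_p L m 1 hL
  push_cast at this
  rw [this, p, Finset.mul_sum, Finset.mul_sum, Finset.sum_div]
  apply Finset.sum_congr rfl
  intro j hj
  have hL' : (L : ℝ) ≠ 0 := by exact_mod_cast (by omega : L ≠ 0)
  have e1 : (j : ℝ) * (π / L) * (L - 1) = j * π - π * j / L := by field_simp
  have e2 : (j : ℝ) * (π / L) = π * j / L := by ring
  rw [e1, e2, sin_sub, sin_nat_mul_pi, cos_nat_mul_pi, g, mul_pow]
  field_simp
  ring

/-- folded kernel -/
noncomputable def hh (m L j : ℕ) : ℝ := if 2 * j < L then (-1) ^ (j + 1) * g m (π * j / L) else 0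

lemma fold (L m : ℕ) (hL : 0 < L) (hm : 0 < m) :
    ∑ j ∈ Finset.range L, (-1 : ℝ) ^ (j + 1) * g m (π * j / L) =
      (1 + (-1) ^ (L + m)) * ∑ j ∈ Finset.range (L + 1), hh m L j := by
  have hL' : (L : ℝ) ≠ 0 := by exact_mod_cast (by omega : L ≠ 0)
  have e0 : ∑ j ∈ Finset.range L, (-1 : ℝ) ^ (j + 1) * g m (π * j / L) =
      ∑ j ∈ Finset.range (L + 1), (-1 : ℝ) ^ (j + 1) * g m (π * j / L) := by
    rw [Finset.sum_range_succ]
    have : π * L / L = π := by field_simp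
    rw [this, g]; simp
  have e1 : ∑ j ∈ Finset.range (L + 1), hh m L (L - j) = ∑ j ∈ Finset.range (L + 1), hh m L j := by
    have := Finset.sum_range_reflect (fun j => hh m L j) (L + 1)
    rw [← this]
    apply Finset.sum_congr rfl
    intro j hj
    congr 1
  rw [e0, add_mul, one_mul]
  conv_rhs => rw [← e1, e1]
  nth_rewrite 2 [← e1]
  rw [Finset.mul_sum, ← Finset.sum_add_distrib]
  apply Finset.sum_congr rfl
  intro j hj
  have hj' : j ≤ L := by have := Finset.mem_range.mp hj; omega
  unfold hh
  rcases lt_trichotomy (2 * j) L with h | h | h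
  · have : ¬ (2 * (L - j) < L) := by omega
    simp [h, this]
  · have h2 : ¬ (2 * (L - j) < L) := by omega
    have h1 : ¬ (2 * j < L) := by omega
    simp only [h1, h2, if_false, mul_zero, add_zero]
    have : π * j / L = π / 2 := by
      rw [← h]; push_cast
      have : (j : ℝ) ≠ 0 := by exact_mod_cast (by omega : j ≠ 0)
      field_simp
    rw [this, g, cos_pi_div_two, zero_pow (by omega)]; simp
  · have h2 : (2 * (L - j) < L) := by omega
    have h1 : ¬ (2 * j < L) := by omega
    simp only [h1, h2, if_false, if_true, zero_add]
    have e3 : π * ((L - j : ℕ) : ℝ) / L = π - π * j / L := by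
      rw [Nat.cast_sub hj']; field_simp
    rw [e3, g, g, cos_pi_sub, sin_pi_sub, neg_pow (cos _)]
    obtain ⟨d, rfl⟩ : ∃ d, L = j + d := ⟨L - j, by omega⟩
    have e4 : j + d - j = d := by omega
    rw [e4]
    have e5 : (-1 : ℝ) ^ (j + d + m) * ((-1) ^ (d + 1) * ((-1) ^ m)) = (-1) ^ (j + 1) := by
      rw [← pow_add, ← pow_add]
      have : j + d + m + (d + 1 + m) = (j + 1) + 2 * (d + m) := by ring
      rw [this, pow_add, pow_mul]; simp
    rw [← e5]; ring

lemma hh_range (m L J : ℕ) (hJ : L ≤ 2 * J) :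
    ∑ j ∈ Finset.range (L + 1), hh m L j = ∑ j ∈ Finset.range J, hh m L j := by
  simp only [hh]
  rw [← Finset.sum_filter, ← Finset.sum_filter]
  congr 1
  ext j
  simp only [Finset.mem_filter, Finset.mem_range]
  omega

lemma U_fold_even (L m J : ℕ) (hL : 0 < L) (hm : 0 < m) (hp : Even (L + m)) (hJ : L ≤ 2 * J) :
    (U L (m + 1) 1 : ℝ) / 2 ^ (m + 2) = ∑ j ∈ Finset.range J, hh m L j / L := by
  rw [U_trig L m hL, fold L m hL hm, hp.neg_one_pow, hh_range m L J hJ, ← Finset.sum_div]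
  ring

lemma U_fold_odd (L m : ℕ) (hL : 0 < L) (hm : 0 < m) (hp : Odd (L + m)) :
    U L (m + 1) 1 = 0 := by
  have h := U_trig L m hL
  rw [fold L m hL hm, hp.neg_one_pow] at h
  simpa using h

end Zhao

namespace Zhao
open Real MeasureTheory FourierTransform

/-- Building block: `cos^a(π/y) sin^b(π/y) y^{-c}` on `y > 2`, zero elsewhere. -/
noncomputable def T (a b c : ℕ) (y : ℝ) : ℝ :=
  if y ≤ 2 then 0 else cos (π * y⁻¹) ^ a * sin (π * y⁻¹) ^ b * y⁻¹ ^ c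

/-- The unrestricted formula. -/
noncomputable def T0 (a b c : ℕ) (y : ℝ) : ℝ :=
  cos (π * y⁻¹) ^ a * sin (π * y⁻¹) ^ b * y⁻¹ ^ c

lemma T0_two (a b c : ℕ) (ha : 0 < a) : T0 a b c 2 = 0 := by
  have : π * (2 : ℝ)⁻¹ = π / 2 := by ring
  rw [T0, this, cos_pi_div_two, zero_pow (by omega)]; simp

lemma T_of_ge (a b c : ℕ) (ha : 0 < a) (y : ℝ) (hy : 2 ≤ y) : T a b c y = T0 a b c y := by
  rcases hy.eq_or_lt with h | h
  · rw [← h, T0_two a b c ha, T]; simp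
  · rw [T, if_neg (by linarith)]; rfl

lemma T_of_le (a b c : ℕ) (y : ℝ) (hy : y ≤ 2) : T a b c y = 0 := by
  rw [T, if_pos hy]

lemma T0_deriv (a b c : ℕ) (ha : 0 < a) (y : ℝ) (hy : 0 < y) :
    HasDerivAt (T0 a b c)
      (π * a * T0 (a - 1) (b + 1) (c + 2) y - π * b * T0 (a + 1) (b - 1) (c + 2) y
        - c * T0 a b (c + 1) y) y := by
  have h0 : HasDerivAt (fun y : ℝ => y⁻¹) (-(y ^ 2)⁻¹) y := hasDerivAt_inv hy.ne'
  have h1 : HasDerivAt (fun y : ℝ => π * y⁻¹) (π * (-(y ^ 2)⁻¹)) y := h0.const_mul π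
  have h2 := (h1.cos.pow a)
  have h3 := (h1.sin.pow b)
  have h4 := h0.pow c
  have h5 := (h2.mul h3).mul h4
  refine h5.congr_deriv ?_
  simp only [T0, Pi.mul_apply, Pi.pow_apply]
  have e : (y ^ 2)⁻¹ = y⁻¹ ^ 2 := by rw [inv_pow]
  rw [e]
  obtain ⟨a, rfl⟩ : ∃ a', a = a' + 1 := ⟨a - 1, by omega⟩
  rcases b with _ | b <;> rcases c with _ | c <;> simp <;> ring

lemma T_deriv (a b c : ℕ) (ha : 2 ≤ a) (y : ℝ) :
    HasDerivAt (T a b c)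
      (π * a * T (a - 1) (b + 1) (c + 2) y - π * b * T (a + 1) (b - 1) (c + 2) y
        - c * T a b (c + 1) y) y := by
  have right : ∀ y, 2 ≤ y → HasDerivWithinAt (T a b c)
      (π * a * T (a - 1) (b + 1) (c + 2) y - π * b * T (a + 1) (b - 1) (c + 2) y
        - c * T a b (c + 1) y) (Set.Ici 2) y := by
    intro y hy
    have := (T0_deriv a b c (by omega) y (by linarith)).hasDerivWithinAt (s := Set.Ici 2)
    rw [T_of_ge _ _ _ (by omega) y hy, T_of_ge _ _ _ (by omega) y hy,
      T_of_ge _ _ _ (by omega) y hy]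
    exact this.congr (fun z hz => T_of_ge _ _ _ (by omega) z hz) (T_of_ge _ _ _ (by omega) y hy)
  have left : ∀ y, y ≤ 2 → HasDerivWithinAt (T a b c)
      (π * a * T (a - 1) (b + 1) (c + 2) y - π * b * T (a + 1) (b - 1) (c + 2) y
        - c * T a b (c + 1) y) (Set.Iic 2) y := by
    intro y hy
    rw [T_of_le _ _ _ y hy, T_of_le _ _ _ y hy, T_of_le _ _ _ y hy]
    have := (hasDerivWithinAt_const y (Set.Iic (2 : ℝ)) (0 : ℝ))
    have h2 := this.congr (f₁ := T a b c) (fun z hz => T_of_le _ _ _ z hz) (T_of_le _ _ _ y hy)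
    simpa using h2
  rcases lt_trichotomy y 2 with h | h | h
  · exact (left y h.le).hasDerivAt (Iic_mem_nhds h)
  · have := (left y h.le).union (right y h.ge)
    rw [Set.Iic_union_Ici] at this
    exact this.hasDerivAt Filter.univ_mem
  · exact (right y h.le).hasDerivAt (Ici_mem_nhds h)

lemma T_cont (a b c : ℕ) (ha : 2 ≤ a) : Continuous (T a b c) :=
  continuous_iff_continuousAt.mpr fun y => (T_deriv a b c ha y).continuousAt

lemma exists_K (d : ℕ) : ∃ K : ℝ, 0 < K ∧ ∀ u : ℝ, 0 ≤ u →
    (u ^ (d + 2) + u ^ d) * exp (-u ^ 2) ≤ K := by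
  refine ⟨((d + 2).factorial + d.factorial) * exp 1, by positivity, fun u hu => ?_⟩
  have h1 := pow_div_factorial_le_exp u hu (d + 2)
  have h2 := pow_div_factorial_le_exp u hu d
  rw [div_le_iff₀ (by positivity)] at h1 h2
  have h3 : exp u ≤ exp 1 * exp (u ^ 2) := by
    rw [← exp_add]; apply exp_le_exp.mpr; nlinarith [sq_nonneg (u - 1)]
  rw [exp_neg, ← div_eq_mul_inv, div_le_iff₀ (exp_pos _)]
  have hp : (0 : ℝ) ≤ (d + 2).factorial + d.factorial := by positivity
  nlinarith [mul_le_mul_of_nonneg_left h3 hp]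

lemma T_bound (b c d : ℕ) (hd : b + c = d + 2) : ∃ K : ℝ, 0 < K ∧ ∀ (r : ℝ) (a : ℕ), 0 < r →
    r ^ 2 ≤ 2 * a → ∀ y, |T a b c y| ≤ K / r ^ (b + c) * (1 + (y / r) ^ 2)⁻¹ := by
  obtain ⟨K, hK, hu⟩ := exists_K d
  refine ⟨π ^ b * K, by positivity, fun r a hr ha y => ?_⟩
  by_cases hy : y ≤ 2
  · rw [T_of_le _ _ _ _ hy, abs_zero]; positivity
  push Not at hy
  have hy0 : 0 < y := by linarith
  have hθ : π * y⁻¹ ≤ π / 2 := by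
    rw [div_eq_mul_inv]
    exact mul_le_mul_of_nonneg_left (inv_anti₀ (by norm_num) hy.le) pi_pos.le
  have hθ0 : 0 ≤ π * y⁻¹ := by positivity
  have hc0 : 0 ≤ cos (π * y⁻¹) := cos_nonneg_of_neg_pi_div_two_le_of_le (by linarith [pi_pos]) hθ
  have hc1 : cos (π * y⁻¹) ≤ exp (-(2 * (y⁻¹) ^ 2)) := by
    have h2 := cos_le_one_sub_mul_cos_sq (x := π * y⁻¹) (by rw [abs_of_nonneg hθ0]; linarith [pi_pos])
    have h3 := add_one_le_exp (-(2 * (y⁻¹) ^ 2))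
    have h4 : 2 / π ^ 2 * (π * y⁻¹) ^ 2 = 2 * (y⁻¹) ^ 2 := by field_simp
    rw [h4] at h2
    linarith
  set u := r / y with hudef
  have hu0 : 0 < u := by positivity
  have hca : cos (π * y⁻¹) ^ a ≤ exp (-u ^ 2) := by
    calc _ ≤ exp (-(2 * (y⁻¹) ^ 2)) ^ a := pow_le_pow_left₀ hc0 hc1 a
      _ = exp (-(2 * a * (y⁻¹) ^ 2)) := by rw [← exp_nat_mul]; congr 1; ring
      _ ≤ _ := by
        apply exp_le_exp.mpr
        rw [hudef, div_eq_mul_inv, mul_pow]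
        have : 0 ≤ y⁻¹ ^ 2 := by positivity
        nlinarith
  have hs : |sin (π * y⁻¹)| ^ b ≤ (π * y⁻¹) ^ b := by
    apply pow_le_pow_left₀ (abs_nonneg _)
    calc _ ≤ |π * y⁻¹| := abs_sin_le_abs
      _ = _ := abs_of_nonneg hθ0
  rw [T, if_neg (by linarith), abs_mul, abs_mul, abs_pow, abs_pow, abs_of_nonneg hc0,
    abs_of_nonneg (by positivity : 0 ≤ y⁻¹ ^ c)]
  have hyu : y⁻¹ = u / r := by rw [hudef]; field_simp
  have hyr : y / r = u⁻¹ := by rw [hudef]; field_simp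
  calc cos (π * y⁻¹) ^ a * |sin (π * y⁻¹)| ^ b * y⁻¹ ^ c
      ≤ exp (-u ^ 2) * (π * y⁻¹) ^ b * y⁻¹ ^ c := by gcongr
    _ = π ^ b * (y⁻¹ ^ (b + c) * exp (-u ^ 2)) := by rw [mul_pow, pow_add]; ring
    _ = π ^ b / r ^ (b + c) * (((u ^ (d + 2) + u ^ d) * exp (-u ^ 2)) * (1 + (u⁻¹) ^ 2)⁻¹) := by
        rw [hyu, div_pow, hd]
        have : (1 + (u⁻¹) ^ 2)⁻¹ = u ^ 2 / (u ^ 2 + 1) := by field_simp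
        rw [this]
        field_simp
        ring
    _ ≤ π ^ b / r ^ (b + c) * (K * (1 + (u⁻¹) ^ 2)⁻¹) := by
        gcongr
        exact hu u hu0.le
    _ = _ := by rw [hyr]; ring

lemma T_int (a b c : ℕ) (ha : 2 ≤ a) (hbc : 2 ≤ b + c) : Integrable (T a b c) := by
  obtain ⟨K, hK, h⟩ := T_bound b c (b + c - 2) (by omega)
  have h1 := h 1 a one_pos (by norm_num; exact_mod_cast (by omega : 1 ≤ 2 * a))
  refine Integrable.mono' (integrable_inv_one_add_sq.const_mul (K / 1 ^ (b + c)))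
    (T_cont a b c ha).aestronglyMeasurable (Filter.Eventually.of_forall fun y => ?_)
  have := h1 y
  rw [div_one] at this
  exact this

/-- complex version -/
noncomputable def TC (a b c : ℕ) (y : ℝ) : ℂ := (T a b c y : ℂ)

lemma TC_int (a b c : ℕ) (ha : 2 ≤ a) (hbc : 2 ≤ b + c) : Integrable (TC a b c) :=
  (T_int a b c ha hbc).ofReal

lemma norm_fourier_le (f : ℝ → ℂ) (ξ : ℝ) : ‖𝓕 f ξ‖ ≤ ∫ v, ‖f v‖ := by
  rw [Real.fourier_real_eq]
  refine (norm_integral_le_integral_norm _).trans (le_of_eq ?_)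
  simp

lemma TC_fourier_zero (b c : ℕ) (hbc : 2 ≤ b + c) : ∃ C : ℝ, 0 < C ∧
    ∀ (r : ℝ) (a : ℕ), 0 < r → 2 ≤ a → r ^ 2 ≤ 2 * a → ∀ ξ, ‖𝓕 (TC a b c) ξ‖ ≤ C * (r / r ^ (b + c)) := by
  obtain ⟨K, hK, h⟩ := T_bound b c (b + c - 2) (by omega)
  refine ⟨K * π, by positivity, fun r a hr ha2 ha ξ => (norm_fourier_le _ _).trans ?_⟩
  have hi : Integrable (fun y : ℝ => (1 + (y / r) ^ 2)⁻¹) :=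
    integrable_inv_one_add_sq.comp_div hr.ne'
  calc ∫ v, ‖TC a b c v‖ ≤ ∫ y, K / r ^ (b + c) * (1 + (y / r) ^ 2)⁻¹ := by
        apply integral_mono (TC_int a b c ha2 hbc).norm (hi.const_mul _)
        intro y
        have := h r a hr ha y
        simpa [TC] using this
    _ = K / r ^ (b + c) * (r * π) := by
        rw [integral_const_mul]
        congr 1
        have := Measure.integral_comp_div (fun y : ℝ => (1 + y ^ 2)⁻¹) r
        rw [this, integral_univ_inv_one_add_sq, abs_of_pos hr]; rfl
    _ = _ := by ring

lemma fourier_lin (f1 f2 f3 : ℝ → ℂ) (h1 : Integrable f1) (h2 : Integrable f2)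
    (h3 : Integrable f3) (α β γ : ℝ) (hα : 0 ≤ α) (hβ : 0 ≤ β) (hγ : 0 ≤ γ) (ξ : ℝ) :
    ‖𝓕 (fun y => (α : ℂ) * f1 y - β * f2 y - γ * f3 y) ξ‖ ≤
      α * ‖𝓕 f1 ξ‖ + β * ‖𝓕 f2 ξ‖ + γ * ‖𝓕 f3 ξ‖ := by
  have key : 𝓕 (fun y => (α : ℂ) * f1 y - β * f2 y - γ * f3 y) ξ =
      α * 𝓕 f1 ξ - β * 𝓕 f2 ξ - γ * 𝓕 f3 ξ := by
    have cv : ∀ f : ℝ → ℂ, Integrable f → Integrable (fun v : ℝ => 𝐞 (-(v * ξ)) • f v) := by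
      intro f hf
      have := (Real.fourierIntegral_convergent_iff (μ := volume) (f := f) ξ).mpr hf
      simpa [mul_comm] using this
    simp only [Real.fourier_real_eq]
    have i12 : Integrable (fun v : ℝ => (α : ℂ) * (𝐞 (-(v * ξ)) • f1 v) - β * (𝐞 (-(v * ξ)) • f2 v)) :=
      ((cv f1 h1).const_mul _).sub ((cv f2 h2).const_mul _)
    rw [← integral_const_mul, ← integral_const_mul, ← integral_const_mul,
      ← integral_sub ((cv f1 h1).const_mul _) ((cv f2 h2).const_mul _),
      ← integral_sub i12 ((cv f3 h3).const_mul _)]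
    congr 1
    ext v
    simp only [Circle.smul_def, smul_eq_mul]
    ring
  rw [key]
  refine (norm_sub_le _ _).trans ?_
  refine (add_le_add_left (norm_sub_le _ _) _).trans (le_of_eq ?_)
  simp [abs_of_nonneg, hα, hβ, hγ]

lemma TC_deriv (a b c : ℕ) (ha : 2 ≤ a) (y : ℝ) :
    HasDerivAt (TC a b c)
      (((π * a : ℝ) : ℂ) * TC (a - 1) (b + 1) (c + 2) y - ((π * b : ℝ) : ℂ) * TC (a + 1) (b - 1) (c + 2) y
        - ((c : ℝ) : ℂ) * TC a b (c + 1) y) y := by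
  have := (T_deriv a b c ha y).ofReal_comp
  refine this.congr_deriv ?_
  simp [TC]

lemma fourier_step (a b c : ℕ) (ha : 3 ≤ a) (hbc : 2 ≤ b + c) (ξ : ℝ) :
    2 * π * |ξ| * ‖𝓕 (TC a b c) ξ‖ ≤ π * a * ‖𝓕 (TC (a - 1) (b + 1) (c + 2)) ξ‖
      + π * b * ‖𝓕 (TC (a + 1) (b - 1) (c + 2)) ξ‖ + c * ‖𝓕 (TC a b (c + 1)) ξ‖ := by
  have hi1 := TC_int (a - 1) (b + 1) (c + 2) (by omega) (by omega)
  have hi2 := TC_int (a + 1) (b - 1) (c + 2) (by omega) (by omega)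
  have hi3 := TC_int a b (c + 1) (by omega) (by omega)
  have hd : deriv (TC a b c) = fun y => ((π * a : ℝ) : ℂ) * TC (a - 1) (b + 1) (c + 2) y
      - ((π * b : ℝ) : ℂ) * TC (a + 1) (b - 1) (c + 2) y - ((c : ℝ) : ℂ) * TC a b (c + 1) y := by
    ext y; exact (TC_deriv a b c (by omega) y).deriv
  have h := Real.fourier_deriv (TC_int a b c (by omega) hbc)
    (fun y => (TC_deriv a b c (by omega) y).differentiableAt)
    (by rw [hd]; exact ((hi1.const_mul _).sub (hi2.const_mul _)).sub (hi3.const_mul _))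
  have h2 := congrFun h ξ
  have h3 := fourier_lin _ _ _ hi1 hi2 hi3 (π * a) (π * b) c (by positivity) (by positivity)
    (by positivity) ξ
  rw [← hd, h2] at h3
  refine le_trans (le_of_eq ?_) h3
  rw [norm_smul]
  simp [abs_of_pos pi_pos]

lemma fourier_decay (k : ℕ) : ∀ b c : ℕ, 2 ≤ b + c → ∃ C : ℝ, 0 < C ∧
    ∀ (r : ℝ) (a : ℕ), 1 ≤ r → r ^ 2 + 2 * k + 4 ≤ 2 * a → (a : ℝ) + k ≤ 3 * r ^ 2 → ∀ ξ, ξ ≠ 0 →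
      ‖𝓕 (TC a b c) ξ‖ ≤ C * (r / r ^ (b + c)) / (r * |ξ|) ^ k := by
  induction k with
  | zero =>
    intro b c hbc
    obtain ⟨C, hC, h⟩ := TC_fourier_zero b c hbc
    refine ⟨C, hC, fun r a hr h1 h2 ξ hξ => ?_⟩
    rw [pow_zero, div_one]
    have : (2 : ℝ) ≤ a := by push_cast at h1; nlinarith
    exact h r a (by linarith) (by exact_mod_cast this) (by push_cast at h1; linarith) ξ
  | succ k ih =>
    intro b c hbc
    obtain ⟨C1, hC1, H1⟩ := ih (b + 1) (c + 2) (by omega)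
    obtain ⟨C2, hC2, H2⟩ := ih (b - 1) (c + 2) (by omega)
    obtain ⟨C3, hC3, H3⟩ := ih b (c + 1) (by omega)
    refine ⟨(3 * π * C1 + π * b * C2 + c * C3) / (2 * π), by positivity, fun r a hr h1 h2 ξ hξ => ?_⟩
    push_cast at h1 h2
    have hr0 : 0 < r := by linarith
    have hk : (0 : ℝ) ≤ k := by positivity
    have ha : (3 : ℝ) ≤ a := by nlinarith
    have ha' : 3 ≤ a := by exact_mod_cast ha
    have hx : 0 < |ξ| := abs_pos.mpr hξ
    have e1 : ((a - 1 : ℕ) : ℝ) = a - 1 := by rw [Nat.cast_sub (by omega)]; simp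
    have s := fourier_step a b c ha' hbc ξ
    have A1 := H1 r (a - 1) hr (by rw [e1]; linarith) (by rw [e1]; linarith) ξ hξ
    have A2 := H2 r (a + 1) hr (by push_cast; linarith) (by push_cast; linarith) ξ hξ
    have A3 := H3 r a hr (by linarith) (by linarith) ξ hξ
    set W := (r / r ^ (b + c)) / r / (r * |ξ|) ^ k with hW
    have B1 : π * a * ‖𝓕 (TC (a - 1) (b + 1) (c + 2)) ξ‖ ≤ 3 * π * C1 * W := by
      calc _ ≤ π * (3 * r ^ 2) * (C1 * (r / r ^ (b + 1 + (c + 2))) / (r * |ξ|) ^ k) := by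
            gcongr
            linarith
        _ = _ := by
            rw [hW]
            have : b + 1 + (c + 2) = (b + c) + 3 := by ring
            rw [this, pow_add]
            field_simp
    have B2 : π * b * ‖𝓕 (TC (a + 1) (b - 1) (c + 2)) ξ‖ ≤ π * b * C2 * W := by
      rcases b with _ | b
      · simp
      · calc _ ≤ π * ((b + 1 : ℕ) : ℝ) * (C2 * (r / r ^ (b + 1 - 1 + (c + 2))) / (r * |ξ|) ^ k) := by
              gcongr
          _ = _ := by
              rw [hW]
              have : b + 1 - 1 + (c + 2) = (b + 1 + c) + 1 := by omega
              rw [this, pow_add]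
              field_simp
    have B3 : c * ‖𝓕 (TC a b (c + 1)) ξ‖ ≤ c * C3 * W := by
      calc _ ≤ c * (C3 * (r / r ^ (b + (c + 1))) / (r * |ξ|) ^ k) := by gcongr
        _ = _ := by
            rw [hW]
            have : b + (c + 1) = (b + c) + 1 := by ring
            rw [this, pow_add]
            field_simp
    have B : 2 * π * |ξ| * ‖𝓕 (TC a b c) ξ‖ ≤ (3 * π * C1 + π * b * C2 + c * C3) * W := by
      linarith
    have hpi := pi_pos
    calc ‖𝓕 (TC a b c) ξ‖ = (2 * π * |ξ| * ‖𝓕 (TC a b c) ξ‖) / (2 * π * |ξ|) := by field_simp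
      _ ≤ ((3 * π * C1 + π * b * C2 + c * C3) * W) / (2 * π * |ξ|) := by gcongr
      _ = _ := by rw [hW, pow_succ]; field_simp

end Zhao

namespace Zhao
open Real MeasureTheory FourierTransform

lemma fourier_scale (f : ℝ → ℂ) (j : ℝ) (hj : 0 < j) (k : ℝ) :
    𝓕 (fun x : ℝ => (1 / j : ℂ) * f (2 / j * x)) k = 1 / 2 * 𝓕 f (k * j / 2) := by
  simp only [Real.fourier_real_eq]
  have h := Measure.integral_comp_mul_left (fun w : ℝ => 𝐞 (-(w * (k * j / 2))) • f w) (2 / j)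
  have e : ∀ v : ℝ, 2 / j * v * (k * j / 2) = v * k := fun v => by field_simp
  simp only [e] at h
  have h2 : (∫ v : ℝ, 𝐞 (-(v * k)) • ((1 / j : ℂ) * f (2 / j * v))) =
      (1 / j : ℂ) * ∫ v : ℝ, 𝐞 (-(v * k)) • f (2 / j * v) := by
    rw [← integral_const_mul]
    congr 1
    ext v
    simp only [Circle.smul_def, smul_eq_mul]
    ring
  rw [h2, h]
  have h3 : |(2 / j)⁻¹| = j / 2 := by rw [abs_of_pos (by positivity)]; field_simp
  rw [h3, Complex.real_smul]
  have : (j : ℂ) ≠ 0 := by exact_mod_cast hj.ne'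
  generalize (∫ y : ℝ, 𝐞 (-(y * (k * j / 2))) • f y) = Z
  push_cast
  field_simp

lemma T_decay (m : ℕ) (hm : 2 ≤ m) : ∃ K : ℝ, 0 < K ∧ ∀ y, |T m 2 1 y| ≤ K / y ^ 2 := by
  obtain ⟨K, hK, h⟩ := T_bound 2 1 1 rfl
  refine ⟨K, hK, fun y => ?_⟩
  by_cases hy : y = 0
  · subst hy; rw [T_of_le _ _ _ _ (by norm_num)]; simp
  have h1 := h 1 m one_pos (by norm_num; exact_mod_cast (by omega : 1 ≤ 2 * m)) y
  refine h1.trans ?_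
  rw [div_one, one_pow, div_one, div_eq_mul_inv]
  gcongr
  linarith

/-- the rescaled sample -/
noncomputable def tau (m : ℕ) (e : ℕ) (j : ℕ) (x : ℤ) : ℝ :=
  1 / j * T m 2 1 ((2 * x + e) / j)

lemma tau_bound (m e : ℕ) (hm : 2 ≤ m) (he : e < 2) (j : ℕ) : ∃ K : ℝ, 0 < K ∧
    ∀ x : ℤ, |tau m e j x| ≤ K * (1 / (x : ℝ) ^ 2) := by
  obtain ⟨K, hK, h⟩ := T_decay m hm
  rcases Nat.eq_zero_or_pos j with hj | hj
  · exact ⟨1, one_pos, fun x => by subst hj; simp [tau]; positivity⟩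
  have hj' : (1 : ℝ) ≤ j := by exact_mod_cast hj
  refine ⟨1 / j * (K * j ^ 2), by positivity, fun x => ?_⟩
  rw [tau, abs_mul, abs_of_nonneg (by positivity : (0 : ℝ) ≤ 1 / j), mul_assoc]
  gcongr
  rcases eq_or_ne x 0 with hx | hx
  · subst hx
    rw [T_of_le]
    · simp
    · have : (e : ℝ) ≤ 1 := by exact_mod_cast (by omega : e ≤ 1)
      rw [div_le_iff₀ (by linarith)]; push_cast; linarith
  · refine (h _).trans ?_
    have hx2 : (0 : ℝ) < (x : ℝ) ^ 2 := by positivity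
    have h3 : (x : ℝ) ^ 2 ≤ (2 * x + e) ^ 2 := by
      have : x ^ 2 ≤ (2 * x + e) ^ 2 := by
        apply sq_le_sq.mpr
        rcases lt_or_gt_of_ne hx with h | h
        · rw [abs_of_neg h]; apply le_abs.mpr; right; omega
        · rw [abs_of_pos h]; apply le_abs.mpr; left; omega
      exact_mod_cast this
    rw [div_pow, div_div_eq_mul_div, mul_one_div]
    gcongr

lemma tau_summable (m e : ℕ) (hm : 2 ≤ m) (he : e < 2) (j : ℕ) : Summable (tau m e j) := by
  obtain ⟨K, hK, h⟩ := tau_bound m e hm he j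
  exact Summable.of_norm_bounded ((Real.summable_one_div_int_pow.mpr one_lt_two).mul_left K) h

lemma poisson : ∃ C0 : ℝ, 0 < C0 ∧ ∀ (m e : ℕ) (D : ℝ), 2 ≤ m → e < 2 → 0 ≤ D →
    (∀ ξ : ℝ, ξ ≠ 0 → ‖𝓕 (TC m 2 1) ξ‖ ≤ D / |ξ| ^ 12) → ∀ j : ℕ, 0 < j →
    |∑' x : ℤ, tau m e j x - (∫ y, T m 2 1 y) / 2| ≤ D * C0 / (j : ℝ) ^ 12 := by
  have hs12 : Summable fun k : ℤ => 1 / (k : ℝ) ^ 12 :=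
    Real.summable_one_div_int_pow.mpr (by norm_num)
  refine ⟨1 / 2 * 2 ^ 12 * (∑' k : ℤ, 1 / (k : ℝ) ^ 12 + 1), ?_, ?_⟩
  · have : 0 ≤ ∑' k : ℤ, 1 / (k : ℝ) ^ 12 := tsum_nonneg fun k => by
      have : (0 : ℝ) ≤ (k : ℝ) ^ 12 := Even.pow_nonneg (by decide) _
      positivity
    positivity
  intro m e D hm he hD hdec j hj
  have hj' : (0 : ℝ) < j := by exact_mod_cast hj
  set f : ℝ → ℂ := fun x : ℝ => (1 / (j : ℝ) : ℂ) * TC m 2 1 (2 / (j : ℝ) * x) with hf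
  have hfk : ∀ k : ℝ, 𝓕 f k = 1 / 2 * 𝓕 (TC m 2 1) (k * j / 2) := fun k =>
    fourier_scale (TC m 2 1) j hj' k
  have hcont : Continuous f := by
    have h1 := T_cont m 2 1 hm
    have h2 : Continuous (TC m 2 1) := Complex.continuous_ofReal.comp h1
    exact continuous_const.mul (h2.comp (continuous_const.mul continuous_id))
  have hO : f =O[Filter.cocompact ℝ] fun x : ℝ => |x| ^ (-(2 : ℝ)) := by
    obtain ⟨K, hK, h⟩ := T_decay m hm
    apply Asymptotics.IsBigO.of_bound (1 / j * (K * j ^ 2 / 4))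
    refine Filter.Eventually.of_forall fun x => ?_
    have e1 : |x| ^ (-(2 : ℝ)) = (x ^ 2)⁻¹ := by
      rw [rpow_neg (abs_nonneg x)]
      congr 1
      rw [← sq_abs]; exact_mod_cast rpow_natCast |x| 2
    have e2 : ‖f x‖ = 1 / j * |T m 2 1 (2 / j * x)| := by
      simp [hf, TC]
    rw [e1, e2, Real.norm_of_nonneg (by positivity), mul_assoc]
    gcongr
    refine (h _).trans (le_of_eq ?_)
    rw [mul_pow, div_pow]
    rcases eq_or_ne x 0 with hx | hx
    · subst hx; simp
    · field_simp
      norm_num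
  have hb : ∀ k : ℤ, k ≠ 0 → ‖𝓕 f k‖ ≤ 1 / 2 * 2 ^ 12 * D / j ^ 12 * (1 / (k : ℝ) ^ 12) := by
    intro k hk
    have hk' : (k : ℝ) ≠ 0 := by exact_mod_cast hk
    rw [hfk, norm_mul]
    have := hdec (k * j / 2) (by positivity)
    have e3 : |(k : ℝ) * j / 2| ^ 12 = (k : ℝ) ^ 12 * j ^ 12 / 2 ^ 12 := by
      rw [Even.pow_abs (by decide), div_pow, mul_pow]
    rw [e3] at this
    have e4 : ‖(1 / 2 : ℂ)‖ = 1 / 2 := by norm_num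
    rw [e4]
    calc _ ≤ 1 / 2 * (D / ((k : ℝ) ^ 12 * j ^ 12 / 2 ^ 12)) := by gcongr
      _ = _ := by field_simp
  have hFs : Summable fun k : ℤ => 𝓕 f k := by
    apply Summable.of_norm_bounded_eventually
      (hs12.mul_left (1 / 2 * 2 ^ 12 * D / j ^ 12))
    rw [Filter.eventually_cofinite]
    apply (Set.finite_singleton (0 : ℤ)).subset
    intro k hk
    by_contra h
    exact hk (hb k h)
  have hP := Real.tsum_eq_tsum_fourier_of_rpow_decay_of_summable hcont one_lt_two hO hFs (e / 2)
  have hL : ∑' n : ℤ, f ((e : ℝ) / 2 + n) = ((∑' x : ℤ, tau m e j x : ℝ) : ℂ) := by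
    rw [Complex.ofReal_tsum]
    congr 1
    ext x
    simp only [hf, tau, TC]
    have : 2 / (j : ℝ) * ((e : ℝ) / 2 + x) = (2 * x + e) / j := by field_simp; ring
    rw [this]
    push_cast
    ring
  have hn : ∀ k : ℤ, ‖fourier k ((((e : ℝ) / 2 : ℝ)) : UnitAddCircle)‖ = 1 := by
    intro k; rw [fourier_apply]; exact Circle.norm_coe _
  have hFs2 : Summable fun k : ℤ => 𝓕 f k * fourier k ((((e : ℝ) / 2 : ℝ)) : UnitAddCircle) := by
    apply Summable.of_norm
    simp only [norm_mul, hn, mul_one]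
    exact hFs.norm
  rw [hL, hFs2.tsum_eq_add_tsum_ite 0] at hP
  have hz : 𝓕 f ((0 : ℤ) : ℝ) * fourier 0 ((((e : ℝ) / 2 : ℝ)) : UnitAddCircle) =
      (((∫ y, T m 2 1 y) / 2 : ℝ) : ℂ) := by
    rw [hfk, Real.fourier_real_eq]
    have : (∫ v : ℝ, 𝐞 (-(v * (((0 : ℤ) : ℝ) * j / 2))) • TC m 2 1 v) = ((∫ y, T m 2 1 y : ℝ) : ℂ) := by
      rw [← integral_complex_ofReal]
      congr 1
      ext v
      simp [TC]
    rw [this]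
    simp
    ring
  rw [hz] at hP
  have hfin : ‖((∑' x : ℤ, tau m e j x - (∫ y, T m 2 1 y) / 2 : ℝ) : ℂ)‖ ≤ D * (1 / 2 * 2 ^ 12 * (∑' k : ℤ, 1 / (k : ℝ) ^ 12 + 1)) / (j : ℝ) ^ 12 := by
    rw [Complex.ofReal_sub, hP, add_sub_cancel_left]
    have := tsum_of_norm_bounded (f := fun k : ℤ => if k = 0 then 0 else 𝓕 f k * fourier k ((((e : ℝ) / 2 : ℝ)) : UnitAddCircle)) ((hs12.mul_left (1 / 2 * 2 ^ 12 * D / j ^ 12)).hasSum) (by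
      intro k
      by_cases hk : k = 0
      · simp [hk]
      · simp only [hk, if_false, norm_mul, hn, mul_one]
        exact hb k hk)
    refine this.trans ?_
    rw [tsum_mul_left]
    have h5 : 0 ≤ D * (1 / 2 * 2 ^ 12) / (j : ℝ) ^ 12 := by positivity
    calc _ = D * (1 / 2 * 2 ^ 12) / (j : ℝ) ^ 12 * ∑' k : ℤ, 1 / (k : ℝ) ^ 12 := by ring
      _ ≤ D * (1 / 2 * 2 ^ 12) / (j : ℝ) ^ 12 * (∑' k : ℤ, 1 / (k : ℝ) ^ 12 + 1) := by
          gcongr; linarith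
      _ = _ := by ring
  rwa [Complex.norm_real] at hfin

end Zhao

namespace Zhao
open Real MeasureTheory Filter Topology

lemma cs_deriv (a b : ℕ) (x : ℝ) : HasDerivAt (fun x => cos x ^ a * sin x ^ b)
    (b * (cos x ^ (a + 1) * sin x ^ (b - 1)) - a * (cos x ^ (a - 1) * sin x ^ (b + 1))) x := by
  have h := ((hasDerivAt_cos x).pow a).mul ((hasDerivAt_sin x).pow b)
  refine h.congr_deriv ?_
  simp only [Pi.pow_apply]
  ring

lemma cs_le (a b : ℕ) (x : ℝ) : |cos x ^ a * sin x ^ b| ≤ 1 := by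
  rw [abs_mul, abs_pow, abs_pow]
  exact mul_le_one₀ (pow_le_one₀ (abs_nonneg _) (abs_cos_le_one x)) (by positivity)
    (pow_le_one₀ (abs_nonneg _) (abs_sin_le_one x))

lemma cs_lip (a b : ℕ) (x y : ℝ) :
    |cos y ^ a * sin y ^ b - cos x ^ a * sin x ^ b| ≤ (a + b) * |y - x| := by
  have := Convex.norm_image_sub_le_of_norm_hasDerivWithin_le (s := Set.univ)
    (f := fun x => cos x ^ a * sin x ^ b) (x := x) (y := y) (C := (a + b : ℝ))
    (fun x _ => (cs_deriv a b x).hasDerivWithinAt) (fun x _ => ?_) convex_univ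
    (Set.mem_univ _) (Set.mem_univ _)
  · simpa only [Real.norm_eq_abs] using this
  · rw [Real.norm_eq_abs]
    refine (abs_sub _ _).trans ?_
    rw [abs_mul, abs_mul (a : ℝ), Nat.abs_cast, Nat.abs_cast]
    have h1 := mul_le_mul_of_nonneg_left (cs_le (a + 1) (b - 1) x) (Nat.cast_nonneg (α := ℝ) b)
    have h2 := mul_le_mul_of_nonneg_left (cs_le (a - 1) (b + 1) x) (Nat.cast_nonneg (α := ℝ) a)
    linarith

lemma second_diff (m : ℕ) : ∃ C : ℝ, 0 < C ∧ ∀ x h : ℝ, 0 ≤ h →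
    |g m (x + h) - g m x / 2 - g m (x + 2 * h) / 2| ≤ C * h ^ 2 := by
  set d : ℝ → ℝ := fun x => 2 * (cos x ^ (m + 1) * sin x ^ 1) - m * (cos x ^ (m - 1) * sin x ^ 3)
    with hd
  have hg : ∀ x, HasDerivAt (g m) (d x) x := fun x => by
    have := cs_deriv m 2 x
    exact this.congr_deriv (by simp [hd])
  set M : ℝ := 2 * ((m + 1 : ℕ) + (1 : ℕ)) + m * ((m - 1 : ℕ) + (3 : ℕ)) with hM
  have hM0 : 0 < M := by positivity
  have hlip : ∀ x y, |d y - d x| ≤ M * |y - x| := by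
    intro x y
    have h1 := mul_le_mul_of_nonneg_left (cs_lip (m + 1) 1 x y) (zero_le_two (α := ℝ))
    have h2 := mul_le_mul_of_nonneg_left (cs_lip (m - 1) 3 x y) (Nat.cast_nonneg (α := ℝ) m)
    have e : d y - d x = 2 * (cos y ^ (m + 1) * sin y ^ 1 - cos x ^ (m + 1) * sin x ^ 1)
      - m * (cos y ^ (m - 1) * sin y ^ 3 - cos x ^ (m - 1) * sin x ^ 3) := by simp only [hd]; ring
    rw [e]
    refine (abs_sub _ _).trans ?_
    rw [abs_mul, abs_mul, Nat.abs_cast, abs_two, hM]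
    linarith
  refine ⟨M, hM0, fun x h hh0 => ?_⟩
  rcases hh0.eq_or_lt with h0 | h0
  · subst h0; simp; ring
  have hc : Continuous (g m) := continuous_iff_continuousAt.mpr fun x => (hg x).continuousAt
  obtain ⟨u, hu, hu'⟩ := exists_hasDerivAt_eq_slope (g m) d (show x < x + h by linarith)
    hc.continuousOn (fun x _ => hg x)
  obtain ⟨v, hv, hv'⟩ := exists_hasDerivAt_eq_slope (g m) d (show x + h < x + 2 * h by linarith)
    hc.continuousOn (fun x _ => hg x)
  have e : g m (x + h) - g m x / 2 - g m (x + 2 * h) / 2 = h / 2 * (d u - d v) := by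
    rw [hu', hv']
    have e1 : x + h - x = h := by ring
    have e2 : x + 2 * h - (x + h) = h := by ring
    rw [e1, e2]
    field_simp
    ring
  rw [e, abs_mul, abs_of_pos (by positivity : 0 < h / 2)]
  have h3 : |u - v| ≤ 2 * h := by
    rw [abs_le]; constructor <;> linarith [hu.1, hu.2, hv.1, hv.2]
  calc h / 2 * |d u - d v| ≤ h / 2 * (M * (2 * h)) := by
        gcongr; exact (hlip v u).trans (by gcongr)
    _ = M * h ^ 2 := by ring

lemma alt_sum (t : ℕ → ℝ) (K : ℕ) :
    ∑ i ∈ Finset.range K, (t (2 * i + 1) - t (2 * i) / 2 - t (2 * i + 2) / 2) =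
      ∑ j ∈ Finset.range (2 * K), (-1) ^ (j + 1) * t j - t (2 * K) / 2 + t 0 / 2 := by
  induction K with
  | zero => simp
  | succ K ih =>
    rw [Finset.sum_range_succ, ih, show 2 * (K + 1) = 2 * K + 1 + 1 by ring,
      Finset.sum_range_succ, Finset.sum_range_succ]
    have h1 : (-1 : ℝ) ^ (2 * K + 1) = -1 := by rw [pow_succ, pow_mul]; simp
    have h2 : (-1 : ℝ) ^ (2 * K + 1 + 1) = 1 := by rw [pow_succ, h1]; simp
    rw [h1, h2]
    ring

lemma tau_eq (m e j : ℕ) (x : ℤ) (L : ℕ) (hL : 0 < L) (hx : 2 * x + e = L) :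
    tau m e j x = if 2 * j < L then g m (π * j / L) / L else 0 := by
  have hx' : (2 * (x : ℝ) + e) = L := by exact_mod_cast hx
  have hL' : (0 : ℝ) < L := by exact_mod_cast hL
  rw [tau, hx']
  rcases Nat.eq_zero_or_pos j with hj | hj
  · subst hj; simp [hL, g]
  have hj' : (0 : ℝ) < j := by exact_mod_cast hj
  by_cases h : 2 * j < L
  · have h' : (2 * j : ℝ) < L := by exact_mod_cast h
    rw [if_pos h, T, if_neg (by rw [not_le, lt_div_iff₀ hj']; exact h'), g]
    have : π * ((L : ℝ) / j)⁻¹ = π * j / L := by field_simp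
    rw [this]
    field_simp
  · have h' : (L : ℝ) ≤ 2 * j := by exact_mod_cast not_lt.mp h
    rw [if_neg h, T_of_le, mul_zero]
    rw [div_le_iff₀ hj']; exact h'

lemma tau_neg (m e j : ℕ) (x : ℤ) (hx : 2 * x + e ≤ 0) : tau m e j x = 0 := by
  have hx' : (2 * (x : ℝ) + e) ≤ 0 := by exact_mod_cast hx
  rw [tau, T_of_le, mul_zero]
  have : (2 * (x : ℝ) + e) / j ≤ 0 := div_nonpos_of_nonpos_of_nonneg hx' (by positivity)
  linarith

/-- partial sums over `j`, suitably averaged -/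
noncomputable def termK (m e K : ℕ) (x : ℤ) : ℝ :=
  ∑ i ∈ Finset.range K, (tau m e (2 * i + 1) x - tau m e (2 * i) x / 2 - tau m e (2 * i + 2) x / 2)

/-- limit -/
noncomputable def glim (m e : ℕ) (x : ℤ) : ℝ := (U (2 * x + e) (m + 1) 1 : ℝ) / 2 ^ (m + 2)

lemma glim_neg (m e : ℕ) (x : ℤ) (hx : 2 * x + e ≤ 0) : glim m e x = 0 := by
  rw [glim, U_out _ _ _ (by omega)]; simp

lemma termK_small (m e K : ℕ) (hm : 0 < m) (he : Even (m + e)) (x : ℤ) (hx : 2 * x + e ≤ 4 * K) :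
    termK m e K x = glim m e x := by
  rcases le_or_gt (2 * x + e) 0 with h | h
  · rw [glim_neg m e x h, termK]
    apply Finset.sum_eq_zero
    intro i _
    rw [tau_neg m e _ x h, tau_neg m e _ x h, tau_neg m e _ x h]; ring
  · obtain ⟨L, hL⟩ : ∃ L : ℕ, 2 * x + e = L := ⟨(2 * x + e).toNat, by omega⟩
    have hL0 : 0 < L := by omega
    have hp : Even (L + m) := by
      obtain ⟨q, hq⟩ := he
      have : (L : ℤ) + m = 2 * (x + q) := by omega
      exact (Int.even_coe_nat _).mp ⟨x + q, by push_cast; omega⟩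
    rw [glim, hL, U_fold_even L m (2 * K) hL0 hm hp (by omega), termK,
      alt_sum (fun j => tau m e j x) K]
    simp only [tau_eq m e _ x L hL0 hL]
    rw [if_neg (by omega), if_pos (by omega)]
    have : g m (π * (0 : ℕ) / L) = 0 := by simp [g]
    rw [this]
    simp only [zero_div, sub_zero, add_zero]
    apply Finset.sum_congr rfl
    intro j _
    rw [hh]
    split_ifs
    · ring
    · simp

lemma termK_large (m e : ℕ) : ∃ C : ℝ, 0 < C ∧ ∀ (K : ℕ) (x : ℤ), e < 2 → 4 * (K : ℤ) < 2 * x + e →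
    |termK m e K x| ≤ C * (1 / (x : ℝ) ^ 2) := by
  obtain ⟨C, hC, H⟩ := second_diff m
  refine ⟨C * π ^ 2, by positivity, fun K x he hx => ?_⟩
  rcases Nat.eq_zero_or_pos K with hK | hK
  · subst hK; simp [termK]; positivity
  obtain ⟨L, hL⟩ : ∃ L : ℕ, 2 * x + e = L := ⟨(2 * x + e).toNat, by omega⟩
  have hL0 : 0 < L := by omega
  have hL' : (0 : ℝ) < L := by exact_mod_cast hL0
  have hx0 : 0 < x := by omega
  have hx' : (0 : ℝ) < x := by exact_mod_cast hx0
  have hxL : (x : ℝ) ≤ L := by exact_mod_cast (by omega : x ≤ L)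
  have hKL : (K : ℝ) ≤ L := by exact_mod_cast (by omega : K ≤ L)
  have hterm : ∀ i ∈ Finset.range K,
      |tau m e (2 * i + 1) x - tau m e (2 * i) x / 2 - tau m e (2 * i + 2) x / 2| ≤
        C * (π / L) ^ 2 / L := by
    intro i hi
    have hi' := Finset.mem_range.mp hi
    rw [tau_eq m e _ x L hL0 hL, tau_eq m e _ x L hL0 hL, tau_eq m e _ x L hL0 hL,
      if_pos (by omega), if_pos (by omega), if_pos (by omega)]
    have := H (π * (2 * i : ℕ) / L) (π / L) (by positivity)
    have e1 : π * (2 * i + 1 : ℕ) / L = π * (2 * i : ℕ) / L + π / L := by push_cast; ring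
    have e2 : π * (2 * i + 2 : ℕ) / L = π * (2 * i : ℕ) / L + 2 * (π / L) := by push_cast; ring
    rw [e1, e2]
    have e3 : ∀ a b c : ℝ, a / L - b / L / 2 - c / L / 2 = (a - b / 2 - c / 2) / L := by
      intro a b c; ring
    rw [e3, abs_div, abs_of_pos hL']
    gcongr
  calc |termK m e K x| ≤ ∑ i ∈ Finset.range K, C * (π / L) ^ 2 / L :=
        (Finset.abs_sum_le_sum_abs _ _).trans (Finset.sum_le_sum hterm)
    _ = K * (C * (π / L) ^ 2 / L) := by simp
    _ ≤ L * (C * (π / L) ^ 2 / L) := by gcongr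
    _ = C * π ^ 2 * (1 / (L : ℝ) ^ 2) := by field_simp
    _ ≤ _ := by gcongr

lemma glim_support (m e : ℕ) (x : ℤ) (hx : x ∉ Finset.Icc (-(e : ℤ)) (m + 2)) : glim m e x = 0 := by
  rw [Finset.mem_Icc] at hx
  rcases le_or_gt (2 * x + e) 0 with h | h
  · exact glim_neg m e x h
  · by_cases h2 : 2 * x + (e : ℤ) ≤ m + 2
    · omega
    · rw [glim, U_large _ _ (by push_cast; omega)]; simp

lemma glim_nonneg (m e : ℕ) (x : ℤ) : 0 ≤ glim m e x := by unfold glim; positivity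

lemma glim_summable (m e : ℕ) : Summable (glim m e) :=
  summable_of_ne_finset_zero (s := Finset.Icc (-(e : ℤ)) (m + 2)) fun x hx => glim_support m e x hx

lemma tendsto_term (m e : ℕ) (hm : 0 < m) (he : Even (m + e)) (he2 : e < 2) :
    Tendsto (fun K : ℕ => ∑' x : ℤ, termK m e K x) atTop (𝓝 (∑' x : ℤ, glim m e x)) := by
  obtain ⟨C, hC, H⟩ := termK_large m e
  apply tendsto_tsum_of_dominated_convergence
    (bound := fun x : ℤ => glim m e x + C * (1 / (x : ℝ) ^ 2))
  · exact (glim_summable m e).add ((Real.summable_one_div_int_pow.mpr one_lt_two).mul_left C)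
  · intro x
    apply tendsto_const_nhds.congr'
    filter_upwards [eventually_ge_atTop (2 * x + e).toNat] with K hK
    exact (termK_small m e K hm he x (by omega)).symm
  · refine Eventually.of_forall fun K x => ?_
    have h1 := glim_nonneg m e x
    have h2 : 0 ≤ C * (1 / (x : ℝ) ^ 2) := by positivity
    rcases le_or_gt (2 * x + e) (4 * (K : ℤ)) with h | h
    · rw [termK_small m e K hm he x h, Real.norm_of_nonneg h1]; linarith
    · rw [Real.norm_eq_abs]
      linarith [H K x he2 h]

lemma tsum_term (m e K : ℕ) (hm : 2 ≤ m) (he : e < 2) :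
    ∑' x : ℤ, termK m e K x = ∑ i ∈ Finset.range K,
      (∑' x, tau m e (2 * i + 1) x - (∑' x, tau m e (2 * i) x) / 2
        - (∑' x, tau m e (2 * i + 2) x) / 2) := by
  have hs := fun j => (tau_summable m e hm he j).hasSum
  have := hasSum_sum (s := Finset.range K) (f := fun i x => tau m e (2 * i + 1) x - tau m e (2 * i) x / 2 - tau m e (2 * i + 2) x / 2)
    (fun i _ => ((hs (2 * i + 1)).sub ((hs (2 * i)).div_const 2)).sub ((hs (2 * i + 2)).div_const 2))
  exact this.tsum_eq

lemma main_bound : ∃ Z : ℝ, 0 < Z ∧ ∀ (m e : ℕ) (G I : ℝ), 2 ≤ m → e < 2 → 0 ≤ G →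
    (∀ j : ℕ, 0 < j → |∑' x : ℤ, tau m e j x - I / 2| ≤ G / (j : ℝ) ^ 12) →
    ∀ K : ℕ, 0 < K → |∑' x : ℤ, termK m e K x - I / 4| ≤ G * Z := by
  have hs12 : Summable fun k : ℕ => 1 / ((k + 1 : ℕ) : ℝ) ^ 12 :=
    (summable_nat_add_iff 1).mpr (Real.summable_one_div_nat_pow.mpr (by norm_num))
  have hZ0 : 0 ≤ ∑' k : ℕ, 1 / ((k + 1 : ℕ) : ℝ) ^ 12 := tsum_nonneg fun k => by positivity
  refine ⟨2 * (∑' k : ℕ, 1 / ((k + 1 : ℕ) : ℝ) ^ 12) + 1, by positivity, ?_⟩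
  intro m e G I hm he hG h K hK
  set E : ℕ → ℝ := fun j => if j = 0 then 0 else ∑' x : ℤ, tau m e j x - I / 2 with hE
  have hEb : ∀ j : ℕ, |E j| ≤ G / (j : ℝ) ^ 12 := by
    intro j
    by_cases hj : j = 0
    · simp [hE, hj]
    · simp only [hE, hj, if_false]; exact h j (by omega)
  have t0 : ∀ x, tau m e 0 x = 0 := fun x => by simp [tau]
  have key : ∑' x : ℤ, termK m e K x - I / 4 =
      ∑ i ∈ Finset.range K, (E (2 * i + 1) - E (2 * i) / 2 - E (2 * i + 2) / 2) := by
    rw [tsum_term m e K hm he]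
    obtain ⟨k, rfl⟩ : ∃ k, K = k + 1 := ⟨K - 1, by omega⟩
    rw [Finset.sum_range_succ', Finset.sum_range_succ' (fun i => E (2 * i + 1) - E (2 * i) / 2 - E (2 * i + 2) / 2)]
    have : ∀ i ∈ Finset.range k, (∑' x, tau m e (2 * (i + 1) + 1) x - (∑' x, tau m e (2 * (i + 1)) x) / 2
        - (∑' x, tau m e (2 * (i + 1) + 2) x) / 2) =
        (E (2 * (i + 1) + 1) - E (2 * (i + 1)) / 2 - E (2 * (i + 1) + 2) / 2) := by
      intro i _
      simp only [hE]
      rw [if_neg (by omega), if_neg (by omega), if_neg (by omega)]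
      ring
    rw [Finset.sum_congr rfl this]
    simp [hE, t0]
    ring
  rw [key]
  have hterm : ∀ i ∈ Finset.range K, |E (2 * i + 1) - E (2 * i) / 2 - E (2 * i + 2) / 2| ≤
      2 * G * (1 / ((i + 1 : ℕ) : ℝ) ^ 12) := by
    intro i _
    have b1 : |E (2 * i + 1)| ≤ G * (1 / ((i + 1 : ℕ) : ℝ) ^ 12) := by
      refine (hEb _).trans ?_
      rw [mul_one_div]; gcongr; omega
    have b3 : |E (2 * i + 2)| ≤ G * (1 / ((i + 1 : ℕ) : ℝ) ^ 12) := by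
      refine (hEb _).trans ?_
      rw [mul_one_div]; gcongr <;> omega
    have b2 : |E (2 * i)| ≤ G * (1 / ((i + 1 : ℕ) : ℝ) ^ 12) := by
      rcases Nat.eq_zero_or_pos i with hi | hi
      · subst hi; simp [hE]; exact hG
      · refine (hEb _).trans ?_
        rw [mul_one_div]; gcongr; omega
    rw [abs_le] at b1 b2 b3 ⊢
    constructor <;> linarith
  calc _ ≤ ∑ i ∈ Finset.range K, 2 * G * (1 / ((i + 1 : ℕ) : ℝ) ^ 12) :=
        (Finset.abs_sum_le_sum_abs _ _).trans (Finset.sum_le_sum hterm)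
    _ = 2 * G * ∑ i ∈ Finset.range K, (1 / ((i + 1 : ℕ) : ℝ) ^ 12) := by rw [Finset.mul_sum]
    _ ≤ 2 * G * ∑' k : ℕ, 1 / ((k + 1 : ℕ) : ℝ) ^ 12 := by
        gcongr
        exact hs12.sum_le_tsum _ fun i _ => by positivity
    _ ≤ _ := by nlinarith

lemma B_tsum (m e : ℕ) (hm : 0 < m) (he : Even (m + e)) :
    ∑' x : ℤ, glim m e x = (B (m + 2) : ℝ) / 2 ^ (m + 2) := by
  set F : ℤ → ℝ := fun L => (U L (m + 1) 1 : ℝ) / 2 ^ (m + 2) with hF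
  have h1 : ∑' L : ℤ, F L = (B (m + 2) : ℝ) / 2 ^ (m + 2) := by
    rw [tsum_eq_sum (s := Finset.Icc (1 : ℤ) (m + 2)), B_eq, ← Finset.sum_div]
    · push_cast; rfl
    · intro L hL
      rw [Finset.mem_Icc] at hL
      simp only [hF]
      by_cases h : 1 ≤ L
      · rw [U_large _ _ (by push_cast; omega)]; simp
      · rw [U_out _ _ _ (by omega)]; simp
  rw [← h1]
  have hinj : Function.Injective (fun x : ℤ => 2 * x + (e : ℤ)) := fun x y h => by
    simp only at h; omega
  refine hinj.tsum_eq (f := F) ?_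
  intro L hL
  rw [Function.mem_support] at hL
  by_contra hr
  apply hL
  by_cases h : 1 ≤ L
  · obtain ⟨l, rfl⟩ : ∃ l : ℕ, L = l := ⟨L.toNat, by omega⟩
    have : Odd (l + m) := by
      rw [← Nat.not_even_iff_odd]
      rintro ⟨q, hq⟩
      obtain ⟨q', hq'⟩ := he
      apply hr
      refine ⟨(q : ℤ) - q', ?_⟩
      simp only
      omega
    simp only [hF]
    rw [U_fold_odd l m (by omega) hm this]; simp
  · simp only [hF]
    rw [U_out _ _ _ (by omega)]; simp

end Zhao

namespace Zhao
open Real MeasureTheory Filter Topology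

/-- truncated expansion of `θ / sin θ` in powers of `w = 1 - cos θ` -/
noncomputable def RR (w : ℝ) : ℝ :=
  1 + w / 3 + 2 * w ^ 2 / 15 + 2 * w ^ 3 / 35 + 8 * w ^ 4 / 315 + 8 * w ^ 5 / 693

/-- truncated expansion of `sin θ / θ` in powers of `w = 1 - cos θ` -/
noncomputable def QQ (w : ℝ) : ℝ :=
  1 - w / 3 - w ^ 2 / 45 - w ^ 3 / 189 - 23 * w ^ 4 / 14175 - 263 * w ^ 5 / 467775

lemma RR_deriv (x : ℝ) : HasDerivAt (fun x => x - sin x * RR (1 - cos x))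
    (48 / 693 * (1 - cos x) ^ 6) x := by
  have hw : HasDerivAt (fun x => 1 - cos x) (sin x) x := by
    simpa using (hasDerivAt_cos x).const_sub 1
  have hR : ∀ w : ℝ, HasDerivAt RR
      (1 / 3 + 4 * w / 15 + 6 * w ^ 2 / 35 + 32 * w ^ 3 / 315 + 40 * w ^ 4 / 693) w := by
    intro w
    have h := (((((hasDerivAt_const w (1 : ℝ)).add ((hasDerivAt_id w).div_const 3)).add
      (((hasDerivAt_pow 2 w).const_mul 2).div_const 15)).add
      (((hasDerivAt_pow 3 w).const_mul 2).div_const 35)).add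
      (((hasDerivAt_pow 4 w).const_mul 8).div_const 315)).add
      (((hasDerivAt_pow 5 w).const_mul 8).div_const 693)
    refine (h.congr_deriv ?_)
    norm_num
    ring
  have h := (hasDerivAt_id x).sub ((hasDerivAt_sin x).mul ((hR (1 - cos x)).comp x hw))
  refine h.congr_deriv ?_
  have hs : sin x ^ 2 = 1 - cos x ^ 2 := sin_sq x
  simp only [Function.comp, RR]
  have : ∀ D : ℝ, sin x * (D * sin x) = D * (1 - cos x ^ 2) := by
    intro D; rw [← hs]; ring
  rw [this]
  ring

lemma sin_approx : ∃ C : ℝ, 0 < C ∧ ∀ x : ℝ, 0 ≤ x → x ≤ π / 2 →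
    |sin x - x * QQ (1 - cos x)| ≤ C * x * (1 - cos x) ^ 6 := by
  refine ⟨2, by norm_num, fun x hx hx2 => ?_⟩
  rcases hx.eq_or_lt with h0 | h0
  · subst h0; simp
  have hc0 : 0 ≤ cos x := cos_nonneg_of_neg_pi_div_two_le_of_le (by linarith) hx2
  have hc1 := cos_le_one x
  have hs0 : 0 ≤ sin x := sin_nonneg_of_nonneg_of_le_pi hx (by linarith)
  have hs1 : sin x ≤ x := sin_le hx
  set w := 1 - cos x with hw
  have hw0 : 0 ≤ w := by linarith
  have hw1 : w ≤ 1 := by linarith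
  obtain ⟨u, hu, hu'⟩ := exists_hasDerivAt_eq_slope (fun x => x - sin x * RR (1 - cos x))
    (fun x => 48 / 693 * (1 - cos x) ^ 6) h0
    (continuous_iff_continuousAt.mpr fun x => (RR_deriv x).continuousAt).continuousOn
    (fun x _ => RR_deriv x)
  have hcu : cos x ≤ cos u := cos_le_cos_of_nonneg_of_le_pi hu.1.le (by linarith) hu.2.le
  have hf : x - sin x * RR w = x * (48 / 693 * (1 - cos u) ^ 6) := by
    rw [hu']; simp only [sin_zero, zero_mul, sub_zero, hw]; field_simp
  have hcu1 := cos_le_one u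
  have hu6 : (1 - cos u) ^ 6 ≤ w ^ 6 := by
    apply pow_le_pow_left₀ <;> linarith
  have hu60 : 0 ≤ (1 - cos u) ^ 6 := by positivity
  have hp : ∀ k : ℕ, 0 ≤ w ^ k ∧ w ^ k ≤ 1 := fun k => ⟨by positivity, pow_le_one₀ hw0 hw1⟩
  have hQ1 : |QQ w| ≤ 1 := by
    have := hp 2; have := hp 3; have := hp 4; have := hp 5
    rw [QQ, abs_le]; constructor <;> linarith
  have hQR : 1 - QQ w * RR w = w ^ 6 * (251401/49116375 + 27436/49116375 * w + 6602/49116375 * w^2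
    + 4864/147349125 * w ^ 3 + 2104/324168075 * w ^ 4) := by
    rw [QQ, RR]; ring
  have hq : |1 - QQ w * RR w| ≤ w ^ 6 := by
    have := hp 2; have := hp 3; have := hp 4
    rw [hQR, abs_mul, abs_of_nonneg (hp 6).1]
    apply mul_le_of_le_one_right (hp 6).1
    rw [abs_le]; constructor <;> linarith
  have e : sin x - x * QQ w = sin x * (1 - QQ w * RR w) - (x - sin x * RR w) * QQ w := by ring
  rw [e]
  refine (abs_sub _ _).trans ?_
  rw [abs_mul, abs_mul (x - _), hf, abs_of_nonneg hs0,
    abs_of_nonneg (by positivity : 0 ≤ x * (48 / 693 * (1 - cos u) ^ 6))]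
  calc _ ≤ x * w ^ 6 + x * (1 * w ^ 6) * 1 := by
        gcongr; norm_num
    _ = _ := by ring

lemma J_lim : Tendsto (fun y : ℝ => π * y⁻¹) atTop (𝓝 0) := by
  simpa using tendsto_inv_atTop_zero.const_mul π

lemma J_aux (k : ℕ) : IntegrableOn (fun y => π * T0 k 1 2 y) (Set.Ioi 2) ∧
    ∫ y in Set.Ioi 2, π * T0 k 1 2 y = 1 / (k + 1 : ℝ) := by
  have hder : ∀ y ∈ Set.Ici (2 : ℝ), HasDerivAt (fun y => T0 (k + 1) 0 0 y / (k + 1 : ℝ))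
      (π * T0 k 1 2 y) y := by
    intro y hy
    have hy' : (2 : ℝ) ≤ y := hy
    refine ((T0_deriv (k + 1) 0 0 (by omega) y (by linarith)).div_const _).congr_deriv ?_
    have : (k + 1 : ℝ) ≠ 0 := by positivity
    simp
    field_simp
  have hlim : Tendsto (fun y => T0 (k + 1) 0 0 y / (k + 1 : ℝ)) atTop (𝓝 (1 / (k + 1 : ℝ))) := by
    have h1 : Tendsto (fun y : ℝ => cos (π * y⁻¹)) atTop (𝓝 1) := by
      have := (continuous_cos.tendsto 0).comp J_lim
      rw [cos_zero] at this
      exact this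
    have := (h1.pow (k + 1)).div_const (k + 1 : ℝ)
    simpa [T0] using this
  have hpos : ∀ y ∈ Set.Ioi (2 : ℝ), 0 ≤ π * T0 k 1 2 y := by
    intro y hy
    have hy' : (2 : ℝ) < y := hy
    have h1 : π * y⁻¹ ≤ π / 2 := by
      rw [div_eq_mul_inv]; gcongr
    have h0 : 0 ≤ π * y⁻¹ := by positivity
    have hc := cos_nonneg_of_neg_pi_div_two_le_of_le (by linarith [pi_pos]) h1
    have hs := sin_nonneg_of_nonneg_of_le_pi h0 (by linarith [pi_pos])
    unfold T0; positivity
  have hIntegr := integrableOn_Ioi_deriv_of_nonneg' hder hpos hlim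
  refine ⟨hIntegr, ?_⟩
  rw [integral_Ioi_of_hasDerivAt_of_tendsto' hder hIntegr hlim, T0_two _ _ _ (by omega)]
  simp

/-- coefficients of `QQ (1 - t)` -/
noncomputable def qa : ℕ → ℝ
  | 0 => 297958/467775
  | 1 => 188491/467775
  | 2 => -3572/66825
  | 3 => 1163/66825
  | 4 => -2074/467775
  | 5 => 263/467775
  | _ => 0

/-- coefficients of `(1 - t)^6` -/
noncomputable def qb : ℕ → ℝ
  | 0 => 1
  | 1 => -6
  | 2 => 15
  | 3 => -20
  | 4 => 15
  | 5 => -6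
  | 6 => 1
  | _ => 0

lemma J_sum (c : ℕ → ℝ) (m : ℕ) :
    IntegrableOn (fun y => ∑ i ∈ Finset.range 7, c i * (π * T0 (m + i) 1 2 y)) (Set.Ioi 2) ∧
    ∫ y in Set.Ioi 2, ∑ i ∈ Finset.range 7, c i * (π * T0 (m + i) 1 2 y) =
      ∑ i ∈ Finset.range 7, c i / (m + i + 1 : ℝ) := by
  have h : ∀ i ∈ Finset.range 7, IntegrableOn (fun y => c i * (π * T0 (m + i) 1 2 y)) (Set.Ioi 2) :=
    fun i _ => (J_aux (m + i)).1.const_mul _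
  refine ⟨integrable_finsetSum _ h, ?_⟩
  rw [integral_finsetSum _ h]
  apply Finset.sum_congr rfl
  intro i _
  rw [integral_const_mul, (J_aux (m + i)).2]
  push_cast
  ring

lemma I_approx : ∃ C : ℝ, 0 < C ∧ ∀ m : ℕ, 2 ≤ m →
    |(∫ y, T m 2 1 y) - ∑ i ∈ Finset.range 7, qa i / (m + i + 1 : ℝ)| ≤
      C * ∑ i ∈ Finset.range 7, qb i / (m + i + 1 : ℝ) := by
  obtain ⟨C, hC, H⟩ := sin_approx
  refine ⟨C, hC, fun m hm => ?_⟩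
  have hT : ∫ y, T m 2 1 y = ∫ y in Set.Ioi 2, T m 2 1 y := by
    rw [← integral_indicator measurableSet_Ioi]
    congr 1
    ext y
    by_cases hy : 2 < y
    · simp [hy]
    · simp [hy]; exact T_of_le _ _ _ _ (not_lt.mp hy)
  rw [hT, ← (J_sum qa m).2, ← (J_sum qb m).2,
    ← integral_sub (T_int m 2 1 hm (by norm_num)).integrableOn (J_sum qa m).1,
    ← integral_const_mul, ← Real.norm_eq_abs]
  apply norm_integral_le_of_norm_le ((J_sum qb m).1.const_mul C)
  refine (ae_restrict_iff' measurableSet_Ioi).mpr (Eventually.of_forall fun y hy => ?_)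
  have hy' : (2 : ℝ) < y := hy
  have h1 : π * y⁻¹ ≤ π / 2 := by
    rw [div_eq_mul_inv]; gcongr
  have h0 : 0 ≤ π * y⁻¹ := by positivity
  have hc := cos_nonneg_of_neg_pi_div_two_le_of_le (by linarith [pi_pos]) h1
  have hs := sin_nonneg_of_nonneg_of_le_pi h0 (by linarith [pi_pos])
  have hH := H _ h0 h1
  rw [T_of_ge m 2 1 (by omega) y hy'.le]
  set x := π * y⁻¹ with hx
  have e1 : T0 m 2 1 y - ∑ i ∈ Finset.range 7, qa i * (π * T0 (m + i) 1 2 y) =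
      cos x ^ m * sin x * y⁻¹ * (sin x - x * QQ (1 - cos x)) := by
    simp only [T0, Finset.sum_range_succ, Finset.sum_range_zero, qa, QQ, ← hx]
    rw [show x * _ = π * y⁻¹ * _ by rw [hx]]
    ring
  have e2 : C * ∑ i ∈ Finset.range 7, qb i * (π * T0 (m + i) 1 2 y) =
      cos x ^ m * sin x * y⁻¹ * (C * x * (1 - cos x) ^ 6) := by
    simp only [T0, Finset.sum_range_succ, Finset.sum_range_zero, qb, ← hx]
    rw [show C * x * _ = C * (π * y⁻¹) * _ by rw [hx]]
    ring
  rw [e1, e2, Real.norm_eq_abs, abs_mul, abs_of_nonneg (by positivity)]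
  gcongr

lemma qb_bound (n : ℝ) (hn : 4 ≤ n) :
    ∑ i ∈ Finset.range 7, qb i / (n - 2 + i + 1 : ℝ) ≤ 1440 / n ^ 7 := by
  have e : ∑ i ∈ Finset.range 7, qb i / (n - 2 + i + 1 : ℝ) =
      720 / ((n - 1) * n * (n + 1) * (n + 2) * (n + 3) * (n + 4) * (n + 5)) := by
    have h1 : n - 1 ≠ 0 := by linarith
    have h2 : n ≠ 0 := by linarith
    have h3 : n + 1 ≠ 0 := by linarith
    have h4 : n + 2 ≠ 0 := by linarith
    have h5 : n + 3 ≠ 0 := by linarith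
    have h6 : n + 4 ≠ 0 := by linarith
    have h7 : n + 5 ≠ 0 := by linarith
    simp only [Finset.sum_range_succ, Finset.sum_range_zero, qb]
    rw [show n - 2 + (0 : ℕ) + 1 = n - 1 by push_cast; ring,
      show n - 2 + (1 : ℕ) + 1 = n by push_cast; ring,
      show n - 2 + (2 : ℕ) + 1 = n + 1 by push_cast; ring,
      show n - 2 + (3 : ℕ) + 1 = n + 2 by push_cast; ring,
      show n - 2 + (4 : ℕ) + 1 = n + 3 by push_cast; ring,
      show n - 2 + (5 : ℕ) + 1 = n + 4 by push_cast; ring,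
      show n - 2 + (6 : ℕ) + 1 = n + 5 by push_cast; ring]
    field_simp
    ring
  rw [e, div_le_div_iff₀ (by have : 0 < n - 1 := by linarith
                             positivity) (by positivity)]
  have h8 : n ^ 2 ≤ 2 * ((n - 1) * (n + 1)) := by nlinarith
  have h9 : n ^ 5 ≤ n * (n + 2) * (n + 3) * (n + 4) * (n + 5) := by
    have : n ^ 5 = n * n * n * n * n := by ring
    rw [this]; gcongr <;> linarith
  have := mul_le_mul h8 h9 (by positivity) (by nlinarith)
  nlinarith

lemma geo (n s : ℝ) (hn : 4 ≤ n) (hs : -1 ≤ s) :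
    |1 / (n + s) - (1 / n - s / n ^ 2 + s ^ 2 / n ^ 3 - s ^ 3 / n ^ 4 + s ^ 4 / n ^ 5
      - s ^ 5 / n ^ 6)| ≤ 2 * s ^ 6 / n ^ 7 := by
  have hn0 : 0 < n := by linarith
  have hns : 0 < n + s := by linarith
  have e : 1 / (n + s) - (1 / n - s / n ^ 2 + s ^ 2 / n ^ 3 - s ^ 3 / n ^ 4 + s ^ 4 / n ^ 5
      - s ^ 5 / n ^ 6) = s ^ 6 / (n ^ 6 * (n + s)) := by
    field_simp
    ring
  have hs6 : 0 ≤ s ^ 6 := by positivity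
  rw [e, abs_of_nonneg (by positivity), div_le_div_iff₀ (by positivity) (by positivity)]
  have : s ^ 6 * n ^ 6 * n ≤ s ^ 6 * n ^ 6 * (2 * (n + s)) := by
    gcongr; linarith
  linarith

lemma qa_bound : ∃ C : ℝ, 0 < C ∧ ∀ n : ℝ, 4 ≤ n →
    |(∑ i ∈ Finset.range 7, qa i / (n - 2 + i + 1 : ℝ)) / 4 -
      (1 / (4 * n) + 1 / (6 * n ^ 2) + 7 / (45 * n ^ 3) +
            10 / (63 * n ^ 4) + 764 / (4725 * n ^ 5) +
            4952 / (31185 * n ^ 6))| ≤ C / n ^ 7 := by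
  refine ⟨10000, by norm_num, fun n hn => ?_⟩
  have hn0 : 0 < n := by linarith
  have h0 := geo n (-1) hn (by norm_num)
  have h1 := geo n 0 hn (by norm_num)
  have h2 := geo n 1 hn (by norm_num)
  have h3 := geo n 2 hn (by norm_num)
  have h4 := geo n 3 hn (by norm_num)
  have h5 := geo n 4 hn (by norm_num)
  simp only [Finset.sum_range_succ, Finset.sum_range_zero, qa]
  rw [show n - 2 + (0 : ℕ) + 1 = n + (-1) by push_cast; ring,
      show n - 2 + (1 : ℕ) + 1 = n + 0 by push_cast; ring,
      show n - 2 + (2 : ℕ) + 1 = n + 1 by push_cast; ring,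
      show n - 2 + (3 : ℕ) + 1 = n + 2 by push_cast; ring,
      show n - 2 + (4 : ℕ) + 1 = n + 3 by push_cast; ring,
      show n - 2 + (5 : ℕ) + 1 = n + 4 by push_cast; ring]
  simp only [div_eq_mul_inv, mul_inv] at h0 h1 h2 h3 h4 h5 ⊢
  rw [abs_le] at h0 h1 h2 h3 h4 h5 ⊢
  norm_num at h0 h1 h2 h3 h4 h5 ⊢
  constructor <;> linarith

end Zhao

namespace Zhao
open Real MeasureTheory Filter Topology FourierTransform

lemma B_approx : ∃ C : ℝ, 0 < C ∧ ∀ m : ℕ, 30 ≤ m →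
    |(B (m + 2) : ℝ) / 2 ^ (m + 2) - (∫ y, T m 2 1 y) / 4| ≤ C / ((m + 2 : ℕ) : ℝ) ^ 7 := by
  obtain ⟨C1, hC1, H1⟩ := fourier_decay 12 2 1 (by norm_num)
  obtain ⟨C0, hC0, H0⟩ := poisson
  obtain ⟨Z, hZ, HZ⟩ := main_bound
  refine ⟨C1 * C0 * Z, by positivity, fun m hm => ?_⟩
  set n : ℝ := ((m + 2 : ℕ) : ℝ) with hn
  have hm' : (30 : ℝ) ≤ m := by exact_mod_cast hm
  have hnm : n = m + 2 := by rw [hn]; push_cast; ring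
  have hn0 : 0 < n := by linarith
  have hr2 : √n ^ 2 = n := Real.sq_sqrt hn0.le
  have hr1 : 1 ≤ √n := Real.one_le_sqrt.mpr (by linarith)
  have hr0 : 0 < √n := by linarith
  have he : Even (m + m % 2) := by
    rw [Nat.even_iff]; omega
  have he2 : m % 2 < 2 := Nat.mod_lt _ (by norm_num)
  have hD : ∀ ξ : ℝ, ξ ≠ 0 → ‖𝓕 (TC m 2 1) ξ‖ ≤ (C1 / n ^ 7) / |ξ| ^ 12 := by
    intro ξ hξ
    have := H1 √n m hr1 (by rw [hr2]; push_cast; linarith) (by rw [hr2]; push_cast; linarith) ξ hξ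
    refine this.trans (le_of_eq ?_)
    have hξ' : 0 < |ξ| := abs_pos.mpr hξ
    have e7 : n ^ 7 = √n ^ 14 := by rw [← hr2, ← pow_mul]; simp
    rw [e7]
    field_simp
  have hP := H0 m (m % 2) (C1 / n ^ 7) (by omega) he2 (by positivity) hD
  have hM := HZ m (m % 2) (C1 / n ^ 7 * C0) (∫ y, T m 2 1 y) (by omega) he2 (by positivity) hP
  have hlim := (tendsto_term m (m % 2) (by omega) he he2)
  rw [B_tsum m (m % 2) (by omega) he] at hlim
  have hlim2 := (hlim.sub_const ((∫ y, T m 2 1 y) / 4)).abs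
  have := le_of_tendsto hlim2 (eventually_atTop.mpr ⟨1, fun K hK => hM K (by omega)⟩)
  refine this.trans (le_of_eq ?_)
  ring

end Zhao

/-- Zhao's conjecture (strengthened): the number of bidirectional ballot sequences satisfies
`B_n = 2^n (1/(4n) + 1/(6n²) + 7/(45n³) + 10/(63n⁴) + 764/(4725n⁵) + 4952/(31185n⁶))
 + O(2^n/n⁷)` as `n → ∞`. -/
theorem zhao_conjecture :
    ∃ C > (0 : ℝ), ∃ N₀ : ℕ, ∀ n : ℕ, N₀ ≤ n →
      |(B n : ℝ) -
          2 ^ n * (1 / (4 * (n : ℝ)) + 1 / (6 * (n : ℝ) ^ 2) + 7 / (45 * (n : ℝ) ^ 3) +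
            10 / (63 * (n : ℝ) ^ 4) + 764 / (4725 * (n : ℝ) ^ 5) +
            4952 / (31185 * (n : ℝ) ^ 6))| ≤
        C * 2 ^ n / (n : ℝ) ^ 7 := by
  obtain ⟨C1, hC1, H1⟩ := Zhao.B_approx
  obtain ⟨C2, hC2, H2⟩ := Zhao.I_approx
  obtain ⟨C3, hC3, H3⟩ := Zhao.qa_bound
  refine ⟨C1 + C2 * 1440 + C3, by positivity, 32, fun n hn => ?_⟩
  obtain ⟨m, rfl⟩ : ∃ m, n = m + 2 := ⟨n - 2, by omega⟩
  have h1 := H1 m (by omega)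
  have h2 := H2 m (by omega)
  set N : ℝ := ((m + 2 : ℕ) : ℝ) with hN
  have hN4 : 4 ≤ N := by rw [hN]; exact_mod_cast (by omega : 4 ≤ m + 2)
  have hmN : (m : ℝ) = N - 2 := by rw [hN]; push_cast; ring
  rw [hmN] at h2
  have h2' := h2.trans (mul_le_mul_of_nonneg_left (Zhao.qb_bound N hN4) hC2.le)
  have h3 := H3 N hN4
  have hp : (0 : ℝ) < 2 ^ (m + 2) := by positivity
  set P := 1 / (4 * N) + 1 / (6 * N ^ 2) + 7 / (45 * N ^ 3) +
            10 / (63 * N ^ 4) + 764 / (4725 * N ^ 5) + 4952 / (31185 * N ^ 6) with hP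
  have key : |(B (m + 2) : ℝ) / 2 ^ (m + 2) - P| ≤ (C1 + C2 * 1440 + C3) / N ^ 7 := by
    have hd : (C1 + C2 * 1440 + C3) / N ^ 7 = C1 / N ^ 7 + C2 * (1440 / N ^ 7) + C3 / N ^ 7 := by
      ring
    have h0 : 0 ≤ C2 * (1440 / N ^ 7) := by positivity
    rw [hd]
    rw [abs_le] at h1 h2' h3 ⊢
    constructor <;> linarith
  have e : (B (m + 2) : ℝ) - 2 ^ (m + 2) * P =
      2 ^ (m + 2) * ((B (m + 2) : ℝ) / 2 ^ (m + 2) - P) := by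
    field_simp
  rw [e, abs_mul, abs_of_pos hp]
  calc _ ≤ 2 ^ (m + 2) * ((C1 + C2 * 1440 + C3) / N ^ 7) := by gcongr
    _ = _ := by ring
end
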